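/- Let f ∈ L_p^0(T²), 1<p<∞, α₁,α₂>0, and 0<δ₁,δ₂≤π. Then the mixed modulus of smoothness and the mixed K-functional are equivalent: ω_{α₁,α₂}(f,δ₁,δ₂)_p ≍ K(f,δ₁,δ₂,α₁,α₂,p), with constants independent of f, δ₁, δ₂. -/

import Mathlib

open MeasureTheory Real
open scoped ENNReal

noncomputable section

/-- The `L_p` norm of a function of two variables over the period square `(0,2π]²`. -/
def Lp2Norm (p : ℝ) (f : ℝ → ℝ → ℝ) : ℝ≥0∞ :=
  (∫⁻ x in Set.Ioc (0:ℝ) (2*π), ∫⁻ y in Set.Ioc (0:ℝ) (2*π),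
      ENNReal.ofReal (|f x y| ^ p)) ^ (1/p)

/-- `f ∈ L_p^0(T²)`: measurable, `2π`-periodic in each variable, finite `L_p` norm,
and zero mean in each variable separately. -/
structure MemLp0 (p : ℝ) (f : ℝ → ℝ → ℝ) : Prop where
  meas : Measurable (Function.uncurry f)
  periodic_x : ∀ y, Function.Periodic (fun x => f x y) (2*π)
  periodic_y : ∀ x, Function.Periodic (f x) (2*π)
  norm_ne_top : Lp2Norm p f ≠ ⊤
  mean_x : ∀ᵐ (y : ℝ) ∂volume, (∫ x in (0:ℝ)..(2*π), f x y) = 0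
  mean_y : ∀ᵐ (x : ℝ) ∂volume, (∫ y in (0:ℝ)..(2*π), f x y) = 0

/-- Generalized (fractional) binomial coefficient `C(α,ν) = α(α-1)⋯(α-ν+1)/ν!`. -/
def fracBinom (α : ℝ) : ℕ → ℝ
  | 0 => 1
  | n+1 => fracBinom α n * (α - (n : ℝ)) / ((n : ℝ) + 1)

/-- Fractional difference of order `α` with step `h` in the first variable. -/
def diffX (α h : ℝ) (f : ℝ → ℝ → ℝ) : ℝ → ℝ → ℝ :=
  fun x y => ∑' ν : ℕ, (-1 : ℝ) ^ ν * fracBinom α ν * f (x + (α - (ν : ℝ)) * h) y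

/-- Fractional difference of order `α` with step `h` in the second variable. -/
def diffY (α h : ℝ) (f : ℝ → ℝ → ℝ) : ℝ → ℝ → ℝ :=
  fun x y => ∑' ν : ℕ, (-1 : ℝ) ^ ν * fracBinom α ν * f x (y + (α - (ν : ℝ)) * h)

/-- The mixed (fractional) modulus of smoothness `ω_{α₁,α₂}(f, δ₁, δ₂)_p`. -/
def mixedMod (p α₁ α₂ δ₁ δ₂ : ℝ) (f : ℝ → ℝ → ℝ) : ℝ≥0∞ :=
  ⨆ (h₁ : ℝ) (_ : |h₁| ≤ δ₁) (h₂ : ℝ) (_ : |h₂| ≤ δ₂),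
    Lp2Norm p (diffX α₁ h₁ (diffY α₂ h₂ f))

/-- Complex Fourier coefficient of a (real-valued) function on `T²`. -/
def fourierCoefZ (f : ℝ → ℝ → ℝ) (m₁ m₂ : ℤ) : ℂ :=
  (((2*π)^2)⁻¹ : ℝ) * ∫ x in (0:ℝ)..(2*π), ∫ y in (0:ℝ)..(2*π),
    (f x y : ℂ) * Complex.exp (-Complex.I * ((m₁ : ℂ) * (x : ℂ) + (m₂ : ℂ) * (y : ℂ)))

/-- `g` is the mixed Weyl derivative `f^{(ρ₁,ρ₂)}` of `f` (and `g ∈ L_p^0(T²)`):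
the Fourier coefficients of `g` arise from those of `f` by multiplication
with `(i m₁)^{ρ₁} (i m₂)^{ρ₂}`. -/
def HasWeylDeriv (p ρ₁ ρ₂ : ℝ) (f g : ℝ → ℝ → ℝ) : Prop :=
  MemLp0 p g ∧ ∀ m₁ m₂ : ℤ,
    fourierCoefZ g m₁ m₂ =
      (Complex.I * (m₁ : ℂ)) ^ (ρ₁ : ℂ) * (Complex.I * (m₂ : ℂ)) ^ (ρ₂ : ℂ) * fourierCoefZ f m₁ m₂

/-- The mixed `K`-functional `K(f, t₁, t₂, α₁, α₂, p)`. -/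
def Kfunc (p α₁ α₂ t₁ t₂ : ℝ) (f : ℝ → ℝ → ℝ) : ℝ≥0∞ :=
  ⨅ (g₁ : ℝ → ℝ → ℝ) (d₁ : ℝ → ℝ → ℝ) (_ : MemLp0 p g₁) (_ : HasWeylDeriv p α₁ 0 g₁ d₁)
    (g₂ : ℝ → ℝ → ℝ) (d₂ : ℝ → ℝ → ℝ) (_ : MemLp0 p g₂) (_ : HasWeylDeriv p 0 α₂ g₂ d₂)
    (g : ℝ → ℝ → ℝ) (d : ℝ → ℝ → ℝ) (_ : MemLp0 p g) (_ : HasWeylDeriv p α₁ α₂ g d),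
      Lp2Norm p (fun x y => f x y - g₁ x y - g₂ x y - g x y)
      + ENNReal.ofReal (t₁ ^ α₁) * Lp2Norm p d₁
      + ENNReal.ofReal (t₂ ^ α₂) * Lp2Norm p d₂
      + ENNReal.ofReal (t₁ ^ α₁ * t₂ ^ α₂) * Lp2Norm p d

namespace FracSmooth

/-- The coefficients `(-1)^ν C(α,ν)` of the fractional difference. -/
def diffCoef (α : ℝ) (ν : ℕ) : ℝ := (-1 : ℝ) ^ ν * fracBinom α ν

lemma fracBinom_eq_choose (α : ℝ) (n : ℕ) : fracBinom α n = Ring.choose α n := by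
  have h : ∀ n : ℕ, (n.factorial : ℝ) * fracBinom α n = (descPochhammer ℤ n).smeval α := by
    intro n
    induction n with
    | zero => simp [fracBinom]
    | succ n ih =>
      rw [descPochhammer_succ_right, Polynomial.smeval_mul, ← ih, Nat.factorial_succ, fracBinom]
      have : ((n : ℝ) + 1) ≠ 0 := by positivity
      simp [Polynomial.smeval_natCast]
      field_simp
  have h1 := h n
  rw [Ring.descPochhammer_eq_factorial_smul_choose, nsmul_eq_mul] at h1
  exact mul_left_cancel₀ (by positivity) h1

@[simp] lemma diffCoef_zero (α : ℝ) : diffCoef α 0 = 1 := by simp [diffCoef, fracBinom]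

lemma diffCoef_succ (α : ℝ) (n : ℕ) :
    diffCoef α (n + 1) = diffCoef α n * (n - α) / (n + 1) := by
  simp only [diffCoef, fracBinom, pow_succ]
  ring

lemma hasSum_diffCoef_of_norm_lt_one (α : ℝ) {z : ℂ} (hz : ‖z‖ < 1) :
    HasSum (fun ν => (diffCoef α ν : ℂ) * z ^ ν) ((1 - z) ^ (α : ℂ)) := by
  have h := (Complex.one_add_cpow_hasFPowerSeriesOnBall_zero (a := (α : ℂ))).hasSum
    (y := -z) (by simpa [Metric.mem_eball, edist_zero_right, enorm_eq_nnnorm, ← NNReal.coe_lt_coe] using hz)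
  simp only [zero_add] at h
  have h2 : ∀ n, binomialSeries ℂ (α : ℂ) n (fun _ => -z) = (diffCoef α n : ℂ) * z ^ n := by
    intro n
    simp only [binomialSeries_apply, List.ofFn_const, List.prod_replicate, smul_eq_mul,
      ← Complex.ofReal_choose, ← fracBinom_eq_choose, diffCoef]
    rw [neg_pow z]
    push_cast
    ring
  simpa only [h2, ← sub_eq_add_neg] using h

lemma summable_abs_diffCoef {α : ℝ} (hα : 0 < α) : Summable fun ν => |diffCoef α ν| := by
  obtain ⟨N, hN⟩ := exists_nat_ge α
  rw [← summable_nat_add_iff N]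
  have key : ∀ n : ℕ, α * |diffCoef α (n + N)| =
      (n + N : ℝ) * |diffCoef α (n + N)| - (n + N + 1 : ℝ) * |diffCoef α (n + N + 1)| := by
    intro n
    rw [diffCoef_succ, abs_div, abs_mul]
    push_cast
    rw [abs_of_nonneg (a := (n : ℝ) + N - α) (by have := Nat.cast_nonneg (α := ℝ) n; linarith),
      abs_of_pos (a := (n : ℝ) + N + 1) (by positivity)]
    field_simp
    ring
  have hs : ∀ n : ℕ, ∑ i ∈ Finset.range n, |diffCoef α (i + N)| ≤ N * |diffCoef α N| / α := by
    intro n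
    rw [le_div_iff₀ hα, Finset.sum_mul]
    have : ∑ i ∈ Finset.range n, |diffCoef α (i + N)| * α =
        N * |diffCoef α N| - (n + N) * |diffCoef α (n + N)| := by
      induction n with
      | zero => simp
      | succ n ih =>
        rw [Finset.sum_range_succ, ih, mul_comm _ α, key n]
        push_cast
        rw [show n + 1 + N = n + N + 1 by ring]
        ring
    rw [this]
    have : (0:ℝ) ≤ (n + N) * |diffCoef α (n + N)| := by positivity
    linarith
  exact summable_of_sum_range_le (fun _ => abs_nonneg _) hs

lemma continuousAt_one_sub_mul_cpow {α : ℝ} (hα : 0 < α) {z : ℂ} (hz : ‖z‖ ≤ 1) :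
    ContinuousAt (fun w : ℂ => w ^ (α : ℂ)) (1 - z) := by
  refine Complex.continuousAt_cpow_const_of_re_pos (Or.inl ?_) (by simpa)
  simpa using (Complex.re_le_norm z).trans hz

lemma hasSum_diffCoef {α : ℝ} (hα : 0 < α) {z : ℂ} (hz : ‖z‖ ≤ 1) :
    HasSum (fun ν => (diffCoef α ν : ℂ) * z ^ ν) ((1 - z) ^ (α : ℂ)) := by
  have hs := summable_abs_diffCoef hα
  have hb : ∀ (w : ℂ), ‖w‖ ≤ 1 → ∀ ν, ‖(diffCoef α ν : ℂ) * w ^ ν‖ ≤ |diffCoef α ν| := by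
    intro w hw ν
    rw [norm_mul, norm_pow, Complex.norm_real, Real.norm_eq_abs]
    exact mul_le_of_le_one_right (abs_nonneg _) (pow_le_one₀ (norm_nonneg _) hw)
  have hsum : Summable (fun ν => (diffCoef α ν : ℂ) * z ^ ν) :=
    Summable.of_norm_bounded hs (hb z hz)
  have ht : Filter.Tendsto (fun r : ℝ => ((r : ℂ) * z)) (nhdsWithin 1 (Set.Iio 1)) (nhds z) := by
    have : Continuous fun r : ℝ => ((r : ℂ) * z) := by fun_prop
    simpa using (this.tendsto 1).mono_left nhdsWithin_le_nhds
  have hev : ∀ᶠ r : ℝ in nhdsWithin 1 (Set.Iio 1), 0 < r ∧ r < 1 := by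
    filter_upwards [self_mem_nhdsWithin, mem_nhdsWithin_of_mem_nhds (Ioi_mem_nhds one_pos)] with r h1 h2
      using ⟨h2, h1⟩
  have h1 : Filter.Tendsto (fun r : ℝ => ∑' ν, (diffCoef α ν : ℂ) * ((r : ℂ) * z) ^ ν)
      (nhdsWithin 1 (Set.Iio 1)) (nhds (∑' ν, (diffCoef α ν : ℂ) * z ^ ν)) := by
    refine tendsto_tsum_of_dominated_convergence hs (fun ν => ?_) ?_
    · exact (((continuous_pow ν).tendsto z).comp ht).const_mul _
    · filter_upwards [hev] with r hr ν
      apply hb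
      rw [norm_mul, Complex.norm_real, Real.norm_of_nonneg hr.1.le]
      nlinarith [norm_nonneg z, hr.1, hr.2]
  have h2 : Filter.Tendsto (fun r : ℝ => ∑' ν, (diffCoef α ν : ℂ) * ((r : ℂ) * z) ^ ν)
      (nhdsWithin 1 (Set.Iio 1)) (nhds ((1 - z) ^ (α : ℂ))) := by
    have : Filter.Tendsto (fun r : ℝ => (1 - (r : ℂ) * z) ^ (α : ℂ))
        (nhdsWithin 1 (Set.Iio 1)) (nhds ((1 - z) ^ (α : ℂ))) :=
      (continuousAt_one_sub_mul_cpow hα hz).tendsto.comp (ht.const_sub 1)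
    refine this.congr' ?_
    filter_upwards [hev] with r hr
    refine (hasSum_diffCoef_of_norm_lt_one α ?_).tsum_eq.symm
    rw [norm_mul, Complex.norm_real, Real.norm_of_nonneg hr.1.le]
    nlinarith [norm_nonneg z, hr.1, hr.2]
  have := tendsto_nhds_unique h1 h2
  rw [← this]
  exact hsum.hasSum

section Multipliers

variable {ι E : Type*} [NormedAddCommGroup E] [NormedSpace ℂ E]

/-- The symbol `a` is dominated, with constant `C`, by the family `B` of symbols: for every finite
combination of the vectors `e i`, the norm after applying `a` is at most `C` times any common bound
for the norms after applying the members of `B`. -/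
def Dom (e : ι → E) (C : ℝ) (a : ι → ℂ) (B : Set (ι → ℂ)) : Prop :=
  ∀ (s : Finset ι) (c : ι → ℂ) (M : ℝ), (∀ b ∈ B, ‖∑ i ∈ s, (c i * b i) • e i‖ ≤ M) →
    ‖∑ i ∈ s, (c i * a i) • e i‖ ≤ C * M

/-- The symbol `a` is a Fourier multiplier with respect to the system `e`, with norm at most `C`. -/
def IsMul (e : ι → E) (C : ℝ) (a : ι → ℂ) : Prop :=
  ∀ (s : Finset ι) (c : ι → ℂ), ‖∑ i ∈ s, (c i * a i) • e i‖ ≤ C * ‖∑ i ∈ s, c i • e i‖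

variable {e : ι → E} {C C' : ℝ} {a b : ι → ℂ} {B B' : Set (ι → ℂ)}

lemma IsMul.mono (h : IsMul e C a) (hC : C ≤ C') : IsMul e C' a := fun s c =>
  (h s c).trans (mul_le_mul_of_nonneg_right hC (norm_nonneg _))

lemma isMul_const (z : ℂ) : IsMul e ‖z‖ fun _ => z := fun s c => by
  rw [← norm_smul, Finset.smul_sum]
  simp [smul_smul, mul_comm]

lemma isMul_one : IsMul e 1 fun _ => 1 := by simpa using isMul_const (e := e) 1

lemma isMul_zero : IsMul e 0 fun _ => 0 := by simpa using isMul_const (e := e) 0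

lemma IsMul.add (ha : IsMul e C a) (hb : IsMul e C' b) : IsMul e (C + C') fun i => a i + b i :=
  fun s c => by
  simp only [mul_add, add_smul, Finset.sum_add_distrib, add_mul]
  exact (norm_add_le _ _).trans (add_le_add (ha s c) (hb s c))

lemma IsMul.mul (hC : 0 ≤ C) (ha : IsMul e C a) (hb : IsMul e C' b) :
    IsMul e (C * C') fun i => a i * b i := fun s c => by
  have h := ha s fun i => c i * b i
  have h' := mul_le_mul_of_nonneg_left (hb s c) hC
  simp only [mul_assoc] at h h' ⊢
  simp only [mul_comm (a _) (b _)]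
  exact h.trans h'

lemma IsMul.const_mul (z : ℂ) (ha : IsMul e C a) : IsMul e (‖z‖ * C) fun i => z * a i :=
  (isMul_const z).mul (norm_nonneg z) ha

lemma IsMul.neg (ha : IsMul e C a) : IsMul e C fun i => -a i := by
  simpa using ha.const_mul (-1)

lemma IsMul.sub (ha : IsMul e C a) (hb : IsMul e C' b) : IsMul e (C + C') fun i => a i - b i := by
  simpa [sub_eq_add_neg] using ha.add hb.neg

lemma IsMul.pow (hC : 0 ≤ C) (ha : IsMul e C a) (n : ℕ) : IsMul e (C ^ n) fun i => a i ^ n := by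
  induction n with
  | zero => simpa using isMul_one
  | succ n ih => simpa only [pow_succ] using ih.mul (by positivity) ha

lemma isMul_sum {κ : Type*} (t : Finset κ) {D : κ → ℝ} {A : κ → ι → ℂ}
    (h : ∀ k ∈ t, IsMul e (D k) (A k)) :
    IsMul e (∑ k ∈ t, D k) fun i => ∑ k ∈ t, A k i := by
  classical
  induction t using Finset.induction_on with
  | empty => simpa using isMul_zero
  | insert k t hk ih =>
    simp only [Finset.sum_insert hk]
    exact (h k (by simp)).add (ih fun j hj => h j (by simp [hj]))

lemma IsMul.of_tendsto {A : ℕ → ι → ℂ} (h : ∀ n, IsMul e C (A n))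
    (ha : ∀ i, Filter.Tendsto (fun n => A n i) Filter.atTop (nhds (a i))) : IsMul e C a := by
  intro s c
  refine le_of_tendsto' (x := Filter.atTop) (f := fun n => ‖∑ i ∈ s, (c i * A n i) • e i‖) ?_
    fun n => h n s c
  exact (tendsto_finsetSum _ fun i _ => ((ha i).const_mul _).smul_const _).norm

lemma IsMul.congr (ha : IsMul e C a) (h : ∀ i, a i = b i) : IsMul e C b := by
  rwa [← funext h]

lemma isMul_of_hasSum {D : ℕ → ℝ} {A : ℕ → ι → ℂ} (h : ∀ n, IsMul e (D n) (A n))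
    (hD0 : ∀ n, 0 ≤ D n) (hD : Summable D) (ha : ∀ i, HasSum (fun n => A n i) (a i)) :
    IsMul e (∑' n, D n) a :=
  IsMul.of_tendsto (fun n => (isMul_sum (Finset.range n) fun k _ => h k).mono
    (hD.sum_le_tsum _ fun i _ => hD0 i)) fun i => (ha i).tendsto_sum_nat

lemma IsMul.dom (hC : 0 ≤ C) (ha : IsMul e C a) (hb : b ∈ B) : Dom e C (fun i => a i * b i) B :=
  fun s c M hM => by
  have := (ha s fun i => c i * b i).trans (mul_le_mul_of_nonneg_left (hM b hb) hC)
  simpa only [mul_assoc, mul_comm (a _)] using this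

lemma Dom.isMul_mul (hC : 0 ≤ C) (ha : IsMul e C a) (hb : Dom e C' b B) :
    Dom e (C * C') (fun i => a i * b i) B := fun s c M hM => by
  have h1 := ha s fun i => c i * b i
  have h2 := mul_le_mul_of_nonneg_left (hb s c M hM) hC
  simp only [mul_assoc] at h1 h2 ⊢
  simp only [mul_comm (a _) (b _)]
  exact h1.trans h2

lemma Dom.mono {M : ℝ} (hB : B.Nonempty) (h : Dom e C a B) (hC : C ≤ M) : Dom e M a B :=
  fun s c K hK => (h s c K hK).trans (mul_le_mul_of_nonneg_right hC (by
    obtain ⟨b, hb⟩ := hB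
    exact (norm_nonneg _).trans (hK b hb)))

lemma Dom.mul (ha : Dom e C a B) (hb : Dom e C' b B') :
    Dom e (C * C') (fun i => a i * b i) (Set.image2 (fun u v i => u i * v i) B B') := by
  intro s c M hM
  have h := ha s (fun i => c i * b i) (C' * M) fun u hu => by
    have := hb s (fun i => c i * u i) M fun v hv => by
      have := hM _ ⟨u, hu, v, hv, rfl⟩
      simpa only [mul_assoc] using this
    simpa only [mul_assoc, mul_comm (u _)] using this
  convert h using 1
  · congr 1
    refine Finset.sum_congr rfl fun i _ => ?_
    congr 1
    ring
  · ring

/-- Averages of dominated symbols are dominated. -/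
lemma dom_integral {Ω : Type*} [MeasurableSpace Ω] {ρ : Measure Ω} [IsProbabilityMeasure ρ]
    [CompleteSpace E] {A : Ω → ι → ℂ} (h : ∀ ω, Dom e C (A ω) B)
    (hA : ∀ i, Integrable (fun ω => A ω i) ρ) :
    Dom e C (fun i => ∫ ω, A ω i ∂ρ) B := by
  intro s c M hM
  have : ∑ i ∈ s, (c i * ∫ ω, A ω i ∂ρ) • e i = ∫ ω, ∑ i ∈ s, (c i * A ω i) • e i ∂ρ := by
    rw [integral_finsetSum _ fun i _ => ((hA i).const_mul _).smul_const _]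
    refine Finset.sum_congr rfl fun i _ => ?_
    rw [integral_smul_const, integral_const_mul]
  rw [this]
  simpa using norm_integral_le_of_norm_le_const (μ := ρ) (C := C * M)
    (Filter.Eventually.of_forall fun ω => h ω s c M hM)

/-- `f i ≥ k` defines a uniformly bounded family of spectral projections. -/
def HalfMul (e : ι → E) (f : ι → ℤ) (C : ℝ) : Prop :=
  ∀ k : ℤ, IsMul e C fun i => if k ≤ f i then 1 else 0

/-- Translations along the frequency `f` are contractions. -/
def TransMul (e : ι → E) (f : ι → ℤ) : Prop :=
  ∀ s : ℝ, IsMul e 1 fun i => Complex.exp (Complex.I * s * f i)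

lemma HalfMul.neg {f : ι → ℤ} (h : HalfMul e f C) : HalfMul e (fun i => -f i) (1 + C) := by
  intro k
  refine (isMul_one.sub (h (1 - k))).congr fun i => ?_
  by_cases hk : k ≤ -f i
  · rw [if_pos hk, if_neg (by omega), sub_zero]
  · rw [if_neg hk, if_pos (by omega), sub_self]

lemma HalfMul.mono {f : ι → ℤ} (h : HalfMul e f C) (hC : C ≤ C') : HalfMul e f C' :=
  fun k => (h k).mono hC

lemma TransMul.neg {f : ι → ℤ} (h : TransMul e f) : TransMul e (fun i => -f i) := by
  intro s
  refine (h (-s)).congr fun i => ?_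
  push_cast
  ring_nf

/-- Sequences of bounded variation on a half-line are multipliers. -/
lemma HalfMul.isMul_of_variation {f : ι → ℤ} (h : HalfMul e f C) (hC : 0 ≤ C) {a : ℤ → ℂ} (k : ℤ)
    {V : ℝ} (hV : ∀ n : ℕ, ‖a k‖ + ∑ j ∈ Finset.range n, ‖a (k + j + 1) - a (k + j)‖ ≤ V) :
    IsMul e (C * V) fun i => if k ≤ f i then a (f i) else 0 := by
  have hA : ∀ n : ℕ, IsMul e (C * V) fun i => a k * (if k ≤ f i then 1 else 0) +
      ∑ j ∈ Finset.range n, (a (k + j + 1) - a (k + j)) * (if k + j + 1 ≤ f i then 1 else 0) := by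
    intro n
    refine (((h k).const_mul (a k)).add (isMul_sum (Finset.range n) fun j _ =>
      (h (k + j + 1)).const_mul (a (k + j + 1) - a (k + j)))).mono ?_
    rw [← Finset.sum_mul, ← add_mul, mul_comm]
    exact mul_le_mul_of_nonneg_left (hV n) hC
  have key : ∀ (m : ℤ) (n : ℕ), k ≤ m → m ≤ k + n →
      a k + ∑ j ∈ Finset.range n, (a (k + j + 1) - a (k + j)) * (if k + j + 1 ≤ m then 1 else 0)
        = a m := by
    intro m n hk
    induction n with
    | zero =>
      intro hm
      have : m = k := by simp at hm; omega
      simp [this]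
    | succ n ih =>
      intro hm
      rw [Finset.sum_range_succ]
      push_cast at hm
      rcases (show m ≤ k + n ∨ m = k + n + 1 by omega) with h' | h'
      · rw [if_neg (by omega), mul_zero, add_zero, ih h']
      · subst h'
        have : ∀ j ∈ Finset.range n, (a (k + j + 1) - a (k + j)) *
            (if k + (j : ℤ) + 1 ≤ k + n + 1 then 1 else 0) = a (k + (j + 1 : ℕ)) - a (k + j) := by
          intro j hj
          rw [Finset.mem_range] at hj
          rw [if_pos (by omega), mul_one]
          push_cast
          rw [add_assoc]
        rw [Finset.sum_congr rfl this, Finset.sum_range_sub fun j : ℕ => a (k + j)]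
        simp
  refine IsMul.of_tendsto hA fun i => ?_
  by_cases hk : k ≤ f i
  · simp only [if_pos hk]
    refine tendsto_const_nhds.congr' ?_
    filter_upwards [Filter.eventually_ge_atTop (f i - k).toNat] with n hn
    rw [mul_one, key (f i) n hk (by omega)]
  · simp only [if_neg hk]
    refine tendsto_const_nhds.congr fun n => ?_
    rw [mul_zero, zero_add, Finset.sum_eq_zero]
    intro j _
    rw [if_neg (by omega), mul_zero]

end Multipliers

section Scalar

lemma mul_cpow_of_arg {x y : ℂ} (hx : x ≠ 0) (hy : y ≠ 0)
    (h : x.arg + y.arg ∈ Set.Ioc (-π) π) (s : ℂ) : (x * y) ^ s = x ^ s * y ^ s := by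
  rw [Complex.cpow_def_of_ne_zero (mul_ne_zero hx hy), Complex.cpow_def_of_ne_zero hx,
    Complex.cpow_def_of_ne_zero hy, Complex.log_mul hx hy h, add_mul, Complex.exp_add]

lemma ofReal_mul_cpow {v : ℝ} (hv : 0 < v) {y : ℂ} (hy : y ≠ 0) (s : ℂ) :
    ((v : ℂ) * y) ^ s = (v : ℂ) ^ s * y ^ s := by
  refine mul_cpow_of_arg (by exact_mod_cast hv.ne') hy ?_ s
  rw [Complex.arg_ofReal_of_nonneg hv.le, zero_add]
  exact Complex.arg_mem_Ioc y

/-- The function `(1 - exp (-i u)) / (i u)`, with value `1` at the origin. -/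
def phi (u : ℝ) : ℂ := ∫ s in (0 : ℝ)..1, Complex.exp (-(Complex.I * (u * s : ℝ)))

lemma norm_exp_neg_I_mul (t : ℝ) : ‖Complex.exp (-(Complex.I * t))‖ = 1 := by
  have := Complex.norm_exp_ofReal_mul_I (-t)
  rwa [show ((-t : ℝ) : ℂ) * Complex.I = -(Complex.I * t) by push_cast; ring] at this

lemma I_mul_phi (u : ℝ) : Complex.I * u * phi u = 1 - Complex.exp (-(Complex.I * u)) := by
  rcases eq_or_ne u 0 with rfl | hu
  · simp
  · have hc : -(Complex.I * u) ≠ 0 := by simpa using hu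
    have := integral_exp_mul_complex (a := 0) (b := 1) hc
    rw [phi]
    have h2 : ∀ s : ℝ, -(Complex.I * ((u * s : ℝ) : ℂ)) = -(Complex.I * u) * s := by
      intro s; push_cast; ring
    simp_rw [h2]
    rw [this]
    have hc' : Complex.I * (u : ℂ) ≠ 0 := by simpa using hu
    simp only [Complex.ofReal_one, Complex.ofReal_zero, mul_one, mul_zero, Complex.exp_zero]
    rw [div_neg, mul_neg, mul_div_cancel₀ _ hc']
    ring

lemma continuous_exp_neg_I_mul (u : ℝ) :
    Continuous fun s : ℝ => Complex.exp (-(Complex.I * (u * s : ℝ))) := by fun_prop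

lemma norm_phi_le (u : ℝ) : ‖phi u‖ ≤ 1 := by
  have := intervalIntegral.norm_integral_le_of_norm_le_const (a := (0 : ℝ)) (b := 1) (C := 1)
    (f := fun s : ℝ => Complex.exp (-(Complex.I * (u * s : ℝ)))) fun s _ =>
      (norm_exp_neg_I_mul _).le
  rw [phi]
  simpa using this

lemma norm_phi_sub_le (u v : ℝ) : ‖phi u - phi v‖ ≤ |u - v| := by
  rw [phi, phi, ← intervalIntegral.integral_sub
    ((continuous_exp_neg_I_mul u).intervalIntegrable _ _)
    ((continuous_exp_neg_I_mul v).intervalIntegrable _ _)]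
  have := intervalIntegral.norm_integral_le_of_norm_le_const (a := (0 : ℝ)) (b := 1) (C := |u - v|)
    (f := fun s : ℝ => Complex.exp (-(Complex.I * (u * s : ℝ))) -
      Complex.exp (-(Complex.I * (v * s : ℝ)))) fun s hs => ?_
  · simpa using this
  · rw [Set.uIoc_of_le zero_le_one] at hs
    have h1 : Complex.exp (-(Complex.I * (u * s : ℝ))) - Complex.exp (-(Complex.I * (v * s : ℝ))) =
        Complex.exp (-(Complex.I * (v * s : ℝ))) *
          (Complex.exp (Complex.I * ((v - u) * s : ℝ)) - 1) := by
      rw [mul_sub, ← Complex.exp_add, mul_one]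
      congr 2
      push_cast
      ring
    rw [h1, norm_mul, norm_exp_neg_I_mul, one_mul]
    refine (Real.norm_exp_I_mul_ofReal_sub_one_le).trans ?_
    rw [Real.norm_eq_abs, abs_mul, abs_sub_comm, abs_of_pos hs.1]
    exact mul_le_of_le_one_right (abs_nonneg _) hs.2

lemma half_le_re_phi {u : ℝ} (hu : |u| ≤ 1) : 1 / 2 ≤ (phi u).re := by
  have hre : (phi u).re = ∫ s in (0 : ℝ)..1, Real.cos (u * s) := by
    have := intervalIntegral.intervalIntegral_re (𝕜 := ℂ)
      ((continuous_exp_neg_I_mul u).intervalIntegrable (μ := volume) 0 1)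
    simp only [RCLike.re_to_complex] at this
    rw [phi, ← this]
    refine intervalIntegral.integral_congr fun s _ => ?_
    simp [Complex.exp_re]
  rw [hre]
  have h1 : ∫ _ in (0 : ℝ)..1, (1 / 2 : ℝ) ≤ ∫ s in (0 : ℝ)..1, Real.cos (u * s) := by
    refine intervalIntegral.integral_mono_on zero_le_one (by simp)
      (Continuous.intervalIntegrable (by fun_prop) _ _) fun s hs => ?_
    have h2 := Real.one_sub_sq_div_two_le_cos (x := u * s)
    have h3 : |u * s| ≤ 1 := by
      rw [abs_mul, abs_of_nonneg hs.1]
      exact mul_le_one₀ hu hs.1 hs.2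
    have h4 := (sq_le_one_iff_abs_le_one _).2 h3
    linarith
  simpa using h1

/-- The values of `phi` on `[-1, 1]` stay in this convex compact part of the slit plane. -/
def phiRange : Set ℂ := {z | 1 / 2 ≤ z.re} ∩ Metric.closedBall 0 1

lemma phi_mem_phiRange {u : ℝ} (hu : |u| ≤ 1) : phi u ∈ phiRange :=
  ⟨half_le_re_phi hu, by simpa using norm_phi_le u⟩

lemma isCompact_phiRange : IsCompact phiRange :=
  (isCompact_closedBall _ _).inter_left (isClosed_le continuous_const Complex.continuous_re)

lemma convex_phiRange : Convex ℝ phiRange :=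
  (convex_halfSpace_re_ge _).inter (convex_closedBall _ _)

lemma phiRange_subset_slitPlane : phiRange ⊆ Complex.slitPlane := fun _ hz =>
  Or.inl (lt_of_lt_of_le (by norm_num) hz.1)

lemma exists_bound_phi_cpow (γ : ℝ) : ∃ G : ℝ, 0 ≤ G ∧ (∀ u : ℝ, |u| ≤ 1 → ‖phi u ^ (γ : ℂ)‖ ≤ G) ∧
    ∀ u v : ℝ, |u| ≤ 1 → |v| ≤ 1 → ‖phi u ^ (γ : ℂ) - phi v ^ (γ : ℂ)‖ ≤ G * |u - v| := by
  have hd : ∀ z ∈ phiRange, HasDerivAt (fun w : ℂ => w ^ (γ : ℂ)) (γ * z ^ (γ - 1 : ℂ)) z :=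
    fun z hz => by
      simpa using (hasDerivAt_id z).cpow_const (c := (γ : ℂ)) (phiRange_subset_slitPlane hz)
  obtain ⟨G₁, hG₁⟩ := isCompact_phiRange.exists_bound_of_continuousOn
    (f := fun w : ℂ => w ^ (γ : ℂ)) fun z hz => (hd z hz).continuousAt.continuousWithinAt
  obtain ⟨G₂, hG₂⟩ := isCompact_phiRange.exists_bound_of_continuousOn
    (f := fun w : ℂ => γ * w ^ (γ - 1 : ℂ)) fun z hz =>
      ((continuousAt_cpow_const (phiRange_subset_slitPlane hz)).const_mul _).continuousWithinAt
  refine ⟨max G₁ G₂, ?_, fun u hu => (hG₁ _ (phi_mem_phiRange hu)).trans (le_max_left _ _),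
    fun u v hu hv => ?_⟩
  · exact (norm_nonneg _).trans ((hG₁ _ (phi_mem_phiRange (u := 0) (by simp))).trans
      (le_max_left _ _))
  · refine (convex_phiRange.norm_image_sub_le_of_norm_hasDerivWithin_le (C := max G₁ G₂)
      (fun z hz => (hd z hz).hasDerivWithinAt) (fun z hz => (hG₂ z hz).trans (le_max_right _ _))
      (phi_mem_phiRange hv) (phi_mem_phiRange hu)).trans ?_
    exact mul_le_mul_of_nonneg_left (norm_phi_sub_le u v) ((norm_nonneg _).trans
      ((hG₁ _ (phi_mem_phiRange hu)).trans (le_max_left _ _)))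

/-- Factorization of the symbol of the fractional difference at low frequencies. -/
lemma one_sub_exp_cpow {v η : ℝ} (hv : 0 < v) (hv1 : v ≤ 1) (hη : η = 1 ∨ η = -1) (γ : ℝ) :
    (1 - Complex.exp (-(Complex.I * (η * v : ℝ)))) ^ (γ : ℂ) =
      (v : ℂ) ^ (γ : ℂ) * (Complex.I * η) ^ (γ : ℂ) * phi (η * v) ^ (γ : ℂ) := by
  have habs : |η * v| ≤ 1 := by
    rcases hη with rfl | rfl <;> simp [abs_of_pos hv, hv1]
  have hre := half_le_re_phi habs
  have hphi : phi (η * v) ≠ 0 := by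
    intro h
    rw [h] at hre
    norm_num at hre
  have hη0 : Complex.I * (η : ℂ) ≠ 0 := by
    rcases hη with rfl | rfl <;> simp
  rw [← I_mul_phi, show Complex.I * ((η * v : ℝ) : ℂ) * phi (η * v) =
      (v : ℂ) * ((Complex.I * η) * phi (η * v)) by push_cast; ring,
    ofReal_mul_cpow hv (mul_ne_zero hη0 hphi), mul_cpow_of_arg hη0 hphi ?_, mul_assoc]
  have h1 := (abs_lt.1 (Complex.abs_arg_lt_pi_div_two_iff.2
    (Or.inl (show 0 < (phi (η * v)).re by linarith))))
  rcases hη with h | h <;> rw [h] at h1 ⊢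
  · simp only [Complex.ofReal_one, mul_one, Complex.arg_I]
    constructor <;> linarith [h1.1, h1.2]
  · simp only [Complex.ofReal_neg, Complex.ofReal_one, mul_neg, mul_one, Complex.arg_neg_I]
    constructor <;> linarith [h1.1, h1.2]

end Scalar

section SymbolCalculus

variable {ι E : Type*} [NormedAddCommGroup E] [NormedSpace ℂ E]
variable {e : ι → E} {f : ι → ℤ} {C : ℝ}

/-- The symbol of the fractional difference of order `α` and step `h`, up to a translation. -/
def diffSym (α h : ℝ) (m : ℤ) : ℂ := (1 - Complex.exp (-(Complex.I * (h * m : ℝ)))) ^ (α : ℂ)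

/-- The `ℓ¹` norm of the coefficients of the fractional difference. -/
def diffBound (α : ℝ) : ℝ := ∑' ν, |diffCoef α ν|

lemma diffBound_nonneg (α : ℝ) : 0 ≤ diffBound α := tsum_nonneg fun _ => abs_nonneg _

lemma hasSum_diffSym {α : ℝ} (hα : 0 < α) (h : ℝ) (m : ℤ) :
    HasSum (fun ν : ℕ => (diffCoef α ν : ℂ) * Complex.exp (Complex.I * (-(ν * h) : ℝ) * m))
      (diffSym α h m) := by
  refine (hasSum_diffCoef hα (z := Complex.exp (-(Complex.I * (h * m : ℝ))))
    (norm_exp_neg_I_mul _).le).congr_fun fun ν => ?_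
  rw [← Complex.exp_nat_mul]
  congr 2
  push_cast
  ring

lemma TransMul.isMul_diffSym (hT : TransMul e f) {α : ℝ} (hα : 0 < α) (h : ℝ) :
    IsMul e (diffBound α) fun i => diffSym α h (f i) := by
  refine isMul_of_hasSum (D := fun ν => |diffCoef α ν|) (fun ν => ?_) (fun ν => abs_nonneg _)
    (summable_abs_diffCoef hα) fun i => hasSum_diffSym hα h (f i)
  simpa using (hT (-(ν * h))).const_mul (diffCoef α ν : ℂ)

lemma HalfMul.isMul_low (hf : HalfMul e f C) (hC : 0 ≤ C) {k G : ℝ} (hk : 0 < k) (hG : 0 ≤ G)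
    {g : ℝ → ℂ} (hb : ∀ u, 0 ≤ u → u ≤ 1 → ‖g u‖ ≤ G)
    (hL : ∀ u v, 0 ≤ u → u ≤ 1 → 0 ≤ v → v ≤ 1 → ‖g u - g v‖ ≤ G * |u - v|) :
    IsMul e (C * (3 * G)) fun i => if 0 < f i ∧ k * f i ≤ 1 then g (k * f i) else 0 := by
  set a : ℤ → ℂ := fun m => if k * m ≤ 1 then g (k * m) else 0 with ha
  have hb' : ∀ m : ℤ, 0 ≤ m → ‖a m‖ ≤ G := fun m hm => by
    simp only [ha]
    have : (0 : ℝ) ≤ m := by exact_mod_cast hm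
    split_ifs with h
    · exact hb _ (by positivity) h
    · simpa using hG
  have hsum : ∀ n : ℕ, ∑ j ∈ Finset.range n, ‖a (1 + j + 1) - a (1 + j)‖ ≤
      if k * (1 + n) ≤ 1 then G * (k * n) else 2 * G := by
    intro n
    induction n with
    | zero => simp; split_ifs <;> positivity
    | succ n ih =>
      rw [Finset.sum_range_succ]
      push_cast
      have hn : (0 : ℝ) ≤ n := n.cast_nonneg
      split_ifs with h
      · have h' : k * (1 + n) ≤ 1 := by nlinarith
        rw [if_pos h'] at ih
        have h1 : ‖a (1 + n + 1) - a (1 + n)‖ ≤ G * k := by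
          simp only [ha]
          push_cast
          rw [if_pos (by linarith), if_pos (by linarith)]
          refine (hL _ _ (by positivity) (by linarith) (by positivity) (by linarith)).trans_eq ?_
          rw [← mul_sub, add_sub_cancel_left, mul_one, abs_of_pos hk]
        linarith
      · have h0 : a (1 + n + 1) = 0 := by
          simp only [ha]
          push_cast
          rw [if_neg (by linarith)]
        rw [h0, zero_sub, norm_neg]
        split_ifs at ih with h'
        · have := hb' (1 + n) (by positivity)
          have : G * (k * n) ≤ G * 1 := mul_le_mul_of_nonneg_left (by linarith) hG
          linarith
        · have : a (1 + n) = 0 := by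
            simp only [ha]
            push_cast
            rw [if_neg h']
          rw [this, norm_zero, add_zero]
          exact ih
  refine (hf.isMul_of_variation hC (a := a) 1 (V := 3 * G) fun n => ?_).congr fun i => ?_
  · have h1 := hb' 1 (by norm_num)
    have h2 := hsum n
    split_ifs at h2 with h
    · have : G * (k * n) ≤ G * 1 := mul_le_mul_of_nonneg_left (by linarith) hG
      linarith
    · linarith
  · simp only [ha]
    by_cases h1 : 0 < f i <;> by_cases h2 : k * f i ≤ 1 <;>
      simp [h1, h2, show (1 ≤ f i) ↔ 0 < f i from Iff.rfl]

lemma HalfMul.isMul_high (hf : HalfMul e f C) (hC : 0 ≤ C) {k γ : ℝ} (hk : 0 < k) (hγ : 0 ≤ γ) :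
    IsMul e (C * 2) fun i => if 0 < f i ∧ 1 < k * f i then (((k * f i) ^ (-γ) : ℝ) : ℂ) else 0 := by
  set K : ℤ := ⌊1 / k⌋ + 1 with hK
  have hKk : ∀ m : ℤ, K ≤ m ↔ 1 < k * m := fun m => by
    rw [hK, Int.add_one_le_iff, Int.floor_lt, div_lt_iff₀ hk, mul_comm]
  set r : ℤ → ℝ := fun m => (k * m) ^ (-γ) with hr
  have hanti : ∀ m : ℤ, K ≤ m → r (m + 1) ≤ r m := fun m hm => by
    have := (hKk m).1 hm
    refine Real.rpow_le_rpow_of_nonpos (by linarith) ?_ (by linarith)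
    push_cast
    nlinarith
  have hpos : ∀ m : ℤ, K ≤ m → 0 ≤ r m ∧ r m ≤ 1 := fun m hm => by
    have := (hKk m).1 hm
    exact ⟨Real.rpow_nonneg (by linarith) _, Real.rpow_le_one_of_one_le_of_nonpos this.le
      (by linarith)⟩
  refine (hf.isMul_of_variation hC (a := fun m => (r m : ℂ)) K (V := 2) fun n => ?_).congr
    fun i => ?_
  · have h1 : ∀ j ∈ Finset.range n, ‖((r (K + j + 1) : ℂ)) - r (K + j)‖ =
        r (K + j) - r (K + (j + 1 : ℕ)) := fun j _ => by
      rw [← Complex.ofReal_sub, Complex.norm_real, Real.norm_eq_abs, abs_sub_comm,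
        abs_of_nonneg (sub_nonneg.2 (hanti _ (by omega)))]
      rw [Nat.cast_add, Nat.cast_one, add_assoc K]
    rw [Finset.sum_congr rfl h1, Finset.sum_range_sub' fun j : ℕ => r (K + j), Complex.norm_real,
      Real.norm_eq_abs, abs_of_nonneg (hpos K le_rfl).1]
    have h2 := hpos (K + n) (by omega)
    have h3 := hpos K le_rfl
    simp only [Nat.cast_zero, add_zero]
    linarith
  · by_cases h2 : 1 < k * f i
    · have h1 : 0 < f i := by
        by_contra h
        have : (f i : ℝ) ≤ 0 := by exact_mod_cast not_lt.1 h
        nlinarith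
      rw [if_pos ((hKk _).2 h2), if_pos ⟨h1, h2⟩]
    · rw [if_neg fun h => h2 ((hKk _).1 h), if_neg fun h => h2 h.2]

end SymbolCalculus

section Scalar

lemma norm_I_mul_cpow {η : ℝ} (hη : η = 1 ∨ η = -1) (γ : ℝ) :
    ‖(Complex.I * η) ^ (γ : ℂ)‖ = 1 := by
  rw [Complex.norm_cpow_real]
  rcases hη with rfl | rfl <;> simp

lemma I_mul_cpow {F : ℝ} (hF : 0 < F) {η : ℝ} (hη : η = 1 ∨ η = -1) (γ : ℝ) :
    (Complex.I * (η * F : ℝ)) ^ (γ : ℂ) = ((F ^ γ : ℝ) : ℂ) * (Complex.I * η) ^ (γ : ℂ) := by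
  rw [Complex.ofReal_cpow hF.le, ← ofReal_mul_cpow hF]
  · congr 1
    push_cast
    ring
  · rcases hη with rfl | rfl <;> simp

lemma phi_neg (u : ℝ) : phi (-u) = (starRingEnd ℂ) (phi u) := by
  rw [phi, phi, intervalIntegral.integral_of_le zero_le_one,
    intervalIntegral.integral_of_le zero_le_one, ← integral_conj]
  refine integral_congr_ae (Filter.Eventually.of_forall fun s => ?_)
  simp only [← Complex.exp_conj, map_neg, map_mul, Complex.conj_I, Complex.conj_ofReal]
  push_cast
  ring_nf

lemma diffSym_eq_zero_or {α : ℝ} (h : ℝ) (m : ℤ)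
    (hz : 1 - Complex.exp (-(Complex.I * (h * m : ℝ))) = 0) (hα : 0 < α) : diffSym α h m = 0 := by
  rw [diffSym, hz, Complex.zero_cpow]
  exact_mod_cast hα.ne'

lemma diffSym_mul {α β : ℝ} (hα : 0 < α) (hβ : 0 < β) (h : ℝ) (m : ℤ) :
    diffSym α h m * diffSym β h m = diffSym (α + β) h m := by
  by_cases hz : 1 - Complex.exp (-(Complex.I * (h * m : ℝ))) = 0
  · rw [diffSym_eq_zero_or h m hz hα, diffSym_eq_zero_or h m hz (add_pos hα hβ), zero_mul]
  · rw [diffSym, diffSym, diffSym, ← Complex.cpow_add _ _ hz, Complex.ofReal_add]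

lemma diffSym_natCast (N : ℕ) (h : ℝ) (m : ℤ) :
    diffSym N h m = (1 - Complex.exp (-(Complex.I * (h * m : ℝ)))) ^ N := by
  rw [diffSym, Complex.ofReal_natCast, Complex.cpow_natCast]

/-- Coefficients of `1 - (1 - z) ^ N`. -/
def avgCoef (N j : ℕ) : ℂ := (-1) ^ j * N.choose (j + 1)

lemma one_sub_one_sub_pow (N : ℕ) (z : ℂ) :
    1 - (1 - z) ^ N = ∑ j ∈ Finset.range N, avgCoef N j * z ^ (j + 1) := by
  rw [sub_eq_neg_add 1 z, add_pow, Finset.sum_range_succ']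
  simp only [one_pow, mul_one, pow_zero, Nat.choose_zero_right, Nat.cast_one]
  rw [sub_add_cancel_right, ← Finset.sum_neg_distrib]
  refine Finset.sum_congr rfl fun j _ => ?_
  rw [avgCoef, neg_pow z]
  ring

/-- The mean over `s ∈ [0,1]` of `1 - (1 - exp (-i u s)) ^ N`. -/
def avgSym (N : ℕ) (u : ℝ) : ℂ := ∑ j ∈ Finset.range N, avgCoef N j * phi ((j + 1 : ℕ) * u)

lemma avgSym_neg (N : ℕ) (u : ℝ) : avgSym N (-u) = (starRingEnd ℂ) (avgSym N u) := by
  simp [avgSym, avgCoef, phi_neg, mul_neg]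

lemma one_sub_avgSym (N : ℕ) (u : ℝ) : 1 - avgSym N u =
    ∫ s, (1 - Complex.exp (-(Complex.I * (u * s : ℝ)))) ^ N ∂volume.restrict (Set.Ioc (0 : ℝ) 1) := by
  rw [← intervalIntegral.integral_of_le zero_le_one]
  have h1 : ∀ s : ℝ, (1 - Complex.exp (-(Complex.I * (u * s : ℝ)))) ^ N =
      1 - ∑ j ∈ Finset.range N, avgCoef N j *
        Complex.exp (-(Complex.I * (((j + 1 : ℕ) * u) * s : ℝ))) := fun s => by
    rw [← sub_sub_self 1 (_ ^ N), one_sub_one_sub_pow]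
    congr 1
    refine Finset.sum_congr rfl fun j _ => ?_
    rw [← Complex.exp_nat_mul]
    congr 2
    push_cast
    ring
  simp_rw [h1]
  rw [intervalIntegral.integral_sub (by simp) (Continuous.intervalIntegrable (by fun_prop) _ _),
    intervalIntegral.integral_finsetSum fun j _ => Continuous.intervalIntegrable (by fun_prop) _ _]
  simp only [intervalIntegral.integral_const_mul, avgSym, phi]
  simp

/-- The quotient of `i u * avgSym N u` by `1 - exp (-i u)`. -/
def avgQuot (N : ℕ) (u : ℝ) : ℂ := ∑ j ∈ Finset.range N, avgCoef N j * (j + 1 : ℂ)⁻¹ *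
  ∑ l ∈ Finset.range (j + 1), Complex.exp (-(Complex.I * (l * u : ℝ)))

lemma I_mul_avgSym (N : ℕ) (u : ℝ) :
    Complex.I * u * avgSym N u = (1 - Complex.exp (-(Complex.I * u))) * avgQuot N u := by
  rw [avgSym, avgQuot, Finset.mul_sum, Finset.mul_sum]
  refine Finset.sum_congr rfl fun j _ => ?_
  have hj : ((j + 1 : ℕ) : ℂ) ≠ 0 := by exact_mod_cast Nat.succ_ne_zero j
  have h1 := I_mul_phi ((j + 1 : ℕ) * u)
  have h2 : ∑ l ∈ Finset.range (j + 1), Complex.exp (-(Complex.I * (l * u : ℝ))) =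
      ∑ l ∈ Finset.range (j + 1), Complex.exp (-(Complex.I * u)) ^ l :=
    Finset.sum_congr rfl fun l _ => by
      rw [← Complex.exp_nat_mul]
      congr 1
      push_cast
      ring
  have h3 : Complex.exp (-(Complex.I * ((((j + 1 : ℕ) : ℝ) * u : ℝ) : ℂ))) =
      Complex.exp (-(Complex.I * u)) ^ (j + 1) := by
    rw [← Complex.exp_nat_mul]
    congr 1
    push_cast
    ring
  rw [h3, ← mul_neg_geom_sum] at h1
  rw [h2]
  rw [show (1 - Complex.exp (-(Complex.I * u))) * (avgCoef N j * (j + 1 : ℂ)⁻¹ *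
      ∑ l ∈ Finset.range (j + 1), Complex.exp (-(Complex.I * u)) ^ l) =
      avgCoef N j * (j + 1 : ℂ)⁻¹ * ((1 - Complex.exp (-(Complex.I * u))) *
      ∑ l ∈ Finset.range (j + 1), Complex.exp (-(Complex.I * u)) ^ l) by ring, ← h1]
  push_cast at hj ⊢
  field_simp

end Scalar

section SymbolCalculus

variable {ι E : Type*} [NormedAddCommGroup E] [NormedSpace ℂ E]
variable {e : ι → E} {f : ι → ℤ} {C : ℝ}

lemma HalfMul.isMul_low_phi (hf : HalfMul e f C) (hC : 0 ≤ C) {k G γ η : ℝ} (hk : 0 < k)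
    (hη : η = 1 ∨ η = -1) (hG : 0 ≤ G) (hb : ∀ u : ℝ, |u| ≤ 1 → ‖phi u ^ (γ : ℂ)‖ ≤ G)
    (hL : ∀ u v : ℝ, |u| ≤ 1 → |v| ≤ 1 → ‖phi u ^ (γ : ℂ) - phi v ^ (γ : ℂ)‖ ≤ G * |u - v|) :
    IsMul e (C * (3 * G)) fun i =>
      if 0 < f i ∧ k * f i ≤ 1 then phi (η * (k * f i)) ^ (γ : ℂ) else 0 := by
  have habs : |η| = 1 := by rcases hη with rfl | rfl <;> simp
  have h1 : ∀ u : ℝ, 0 ≤ u → u ≤ 1 → |η * u| ≤ 1 := fun u hu hu1 => by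
    rwa [abs_mul, habs, one_mul, abs_of_nonneg hu]
  refine hf.isMul_low hC hk hG (g := fun u => phi (η * u) ^ (γ : ℂ))
    (fun u hu hu1 => hb _ (h1 u hu hu1)) fun u v hu hu1 hv hv1 => ?_
  refine (hL _ _ (h1 u hu hu1) (h1 v hv hv1)).trans_eq ?_
  rw [← mul_sub, abs_mul, habs, one_mul]

/-- Half-line version of the estimate of a fractional difference by a fractional derivative. -/
lemma exists_half_bernstein (e : ι → E) {α : ℝ} (hα : 0 < α) (hC : 0 ≤ C) : ∃ D : ℝ, 0 ≤ D ∧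
    ∀ f : ι → ℤ, HalfMul e f C → TransMul e f → ∀ k η : ℝ, 0 < k → (η = 1 ∨ η = -1) →
      ∃ w : ι → ℂ, IsMul e D w ∧ (∀ i, f i ≤ 0 → w i = 0) ∧
        ∀ i, 0 < f i → w i * ((k * f i) ^ α : ℝ) = diffSym α (η * k) (f i) := by
  obtain ⟨G, hG, hGb, hGL⟩ := exists_bound_phi_cpow α
  refine ⟨1 * (C * (3 * G)) + C * 2 * diffBound α, by
    have := diffBound_nonneg α
    positivity, fun f hf hT k η hk hη => ⟨fun i => (Complex.I * η) ^ (α : ℂ) *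
      (if 0 < f i ∧ k * f i ≤ 1 then phi (η * (k * f i)) ^ (α : ℂ) else 0) +
      (if 0 < f i ∧ 1 < k * f i then (((k * f i) ^ (-α) : ℝ) : ℂ) else 0) *
        diffSym α (η * k) (f i), ?_, fun i hi => ?_, fun i hi => ?_⟩⟩
  · have h1 := (hf.isMul_low_phi hC hk hη hG hGb hGL).const_mul ((Complex.I * η) ^ (α : ℂ))
    rw [norm_I_mul_cpow hη] at h1
    exact h1.add ((hf.isMul_high hC hk hα.le).mul (by positivity)
      (hT.isMul_diffSym hα (η * k)))
  · simp [not_lt.2 hi]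
  · have hF : (0 : ℝ) < f i := by exact_mod_cast hi
    have hv : 0 < k * f i := by positivity
    rcases le_or_gt (k * f i) 1 with h | h
    · simp only [hi, h, not_lt.2 h, and_true, and_false, if_true, if_false, zero_mul, add_zero]
      rw [diffSym, mul_assoc η, one_sub_exp_cpow hv h hη, Complex.ofReal_cpow hv.le]
      ring
    · simp only [hi, h, not_le.2 h, and_true, and_false, if_true, if_false, mul_zero, zero_add]
      rw [mul_right_comm, ← Complex.ofReal_mul, ← Real.rpow_add hv, neg_add_cancel,
        Real.rpow_zero, Complex.ofReal_one, one_mul]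

/-- A fractional difference is bounded by the fractional derivative of the same order. -/
lemma exists_bernstein (e : ι → E) {α : ℝ} (hα : 0 < α) (hC : 0 ≤ C) : ∃ D : ℝ, 0 ≤ D ∧
    ∀ f : ι → ℤ, HalfMul e f C → HalfMul e (fun i => -f i) C → TransMul e f → ∀ h : ℝ,
      ∃ w : ι → ℂ, IsMul e D w ∧
        ∀ i, f i ≠ 0 → w i * ((|h| ^ α : ℝ) * (Complex.I * f i) ^ (α : ℂ)) = diffSym α h (f i) := by
  obtain ⟨D, hD, H⟩ := exists_half_bernstein e hα hC
  refine ⟨1 * D + 1 * D, by positivity, fun f hf hf' hT h => ?_⟩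
  rcases eq_or_ne h 0 with rfl | hh
  · refine ⟨fun _ => 0, isMul_zero.mono (by positivity), fun i _ => ?_⟩
    rw [diffSym_eq_zero_or _ _ (by simp) hα, zero_mul]
  have hk : 0 < |h| := abs_pos.2 hh
  obtain ⟨η, hη, hηh⟩ : ∃ η : ℝ, (η = 1 ∨ η = -1) ∧ η * |h| = h := by
    rcases lt_or_gt_of_ne hh with h' | h'
    · exact ⟨-1, Or.inr rfl, by rw [abs_of_neg h']; ring⟩
    · exact ⟨1, Or.inl rfl, by rw [abs_of_pos h']; ring⟩
  have hη' : -η = 1 ∨ -η = -1 := by rcases hη with rfl | rfl <;> simp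
  obtain ⟨w, hw, hw0, hw1⟩ := H f hf hT |h| η hk hη
  obtain ⟨w', hw', hw0', hw1'⟩ := H _ hf' hT.neg |h| (-η) hk hη'
  have hI : ∀ ε : ℝ, (ε = 1 ∨ ε = -1) →
      (Complex.I * ε) ^ ((-α : ℝ) : ℂ) * (Complex.I * ε) ^ (α : ℂ) = 1 := fun ε hε => by
    rw [← Complex.cpow_add _ _ (by rcases hε with rfl | rfl <;> simp)]
    simp
  have hc : ∀ ε : ℝ, (ε = 1 ∨ ε = -1) → ∀ F : ℝ, 0 < F → ∀ z : ℂ,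
      ((Complex.I * ε) ^ ((-α : ℝ) : ℂ) * z) * ((|h| ^ α : ℝ) *
        (Complex.I * (ε * F : ℝ)) ^ (α : ℂ)) = z * ((|h| * F) ^ α : ℝ) := fun ε hε F hF z => by
    rw [I_mul_cpow hF hε, Real.mul_rpow hk.le hF.le, Complex.ofReal_mul]
    linear_combination z * (|h| ^ α : ℝ) * (F ^ α : ℝ) * hI ε hε
  refine ⟨fun i => (Complex.I * (1 : ℝ)) ^ ((-α : ℝ) : ℂ) * w i +
    (Complex.I * (-1 : ℝ)) ^ ((-α : ℝ) : ℂ) * w' i, ?_, fun i hi => ?_⟩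
  · have h1 := hw.const_mul ((Complex.I * (1 : ℝ)) ^ ((-α : ℝ) : ℂ))
    have h2 := hw'.const_mul ((Complex.I * (-1 : ℝ)) ^ ((-α : ℝ) : ℂ))
    rw [norm_I_mul_cpow (Or.inl rfl)] at h1
    rw [norm_I_mul_cpow (Or.inr rfl)] at h2
    exact h1.add h2
  · beta_reduce
    rcases lt_or_gt_of_ne hi with h' | h'
    · have hF : (0 : ℝ) < -f i := by
        have : (f i : ℝ) < 0 := by exact_mod_cast h'
        linarith
      have := hc (-1) (Or.inr rfl) (-f i) hF (w' i)
      rw [hw0 i h'.le, mul_zero, zero_add]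
      have h3 := hw1' i (by omega)
      push_cast at this h3 ⊢
      simp only [neg_mul, one_mul, neg_neg, mul_neg, mul_one] at this h3 ⊢
      rw [this, h3, hηh]
      simp [diffSym]
    · have hF : (0 : ℝ) < f i := by exact_mod_cast h'
      have := hc 1 (Or.inl rfl) (f i) hF (w i)
      rw [hw0' i (by omega), mul_zero, add_zero]
      rw [one_mul, Complex.ofReal_intCast] at this
      rw [this, hw1 i h', hηh]

end SymbolCalculus

section SymbolCalculus

variable {ι E : Type*} [NormedAddCommGroup E] [NormedSpace ℂ E]
variable {e : ι → E} {f : ι → ℤ} {C : ℝ}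

/-- Bound for the multiplier norm of `avgSym` and `avgQuot`. -/
def avgBound (N : ℕ) : ℝ := ∑ j ∈ Finset.range N, ‖avgCoef N j‖

lemma avgBound_nonneg (N : ℕ) : 0 ≤ avgBound N := Finset.sum_nonneg fun _ _ => norm_nonneg _

lemma TransMul.isMul_neg_exp (hT : TransMul e f) (s : ℝ) :
    IsMul e 1 fun i => Complex.exp (-(Complex.I * (s * f i : ℝ))) :=
  (hT (-s)).congr fun i => by
    push_cast
    ring_nf

lemma TransMul.isMul_phi [CompleteSpace E] (hT : TransMul e f) (t : ℝ) :
    IsMul e 1 fun i => phi (t * f i) := by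
  have : IsProbabilityMeasure (volume.restrict (Set.Ioc (0 : ℝ) 1)) := ⟨by simp⟩
  have h : Dom e 1 (fun i => ∫ s, Complex.exp (-(Complex.I * (t * f i * s : ℝ)))
      ∂volume.restrict (Set.Ioc (0 : ℝ) 1)) {fun _ => 1} := by
    refine dom_integral (fun s => ?_) fun i =>
      ((continuous_exp_neg_I_mul (t * f i)).intervalIntegrable 0 1).1
    have h1 := ((hT.isMul_neg_exp (t * s)).congr (b := fun i =>
      Complex.exp (-(Complex.I * (t * f i * s : ℝ)))) fun i => by
        rw [mul_right_comm]).dom zero_le_one (Set.mem_singleton fun _ : ι => (1 : ℂ))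
    simpa using h1
  intro s c
  have := h s c _ fun b hb => by
    rw [Set.mem_singleton_iff.1 hb]
  simpa [phi, intervalIntegral.integral_of_le zero_le_one] using this

lemma TransMul.isMul_avgSym [CompleteSpace E] (hT : TransMul e f) (N : ℕ) (t : ℝ) :
    IsMul e (avgBound N) fun i => avgSym N (t * f i) := by
  refine (isMul_sum (Finset.range N) (D := fun j => ‖avgCoef N j‖) fun j _ => ?_).congr
    fun i => rfl
  have := ((hT.isMul_phi ((j + 1 : ℕ) * t)).const_mul (avgCoef N j))
  simpa only [mul_one, mul_assoc] using this

lemma TransMul.isMul_avgQuot (hT : TransMul e f) (N : ℕ) (t : ℝ) :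
    IsMul e (avgBound N) fun i => avgQuot N (t * f i) := by
  refine (isMul_sum (Finset.range N) (D := fun j => ‖avgCoef N j‖) fun j _ => ?_).congr
    fun i => rfl
  have h1 := (isMul_sum (Finset.range (j + 1)) (D := fun _ => 1) fun l _ =>
    hT.isMul_neg_exp (l * t)).const_mul (avgCoef N j * (j + 1 : ℂ)⁻¹)
  refine (h1.mono ?_).congr fun i => by simp only [mul_assoc]
  have h2 : ‖(j + 1 : ℂ)‖ = j + 1 := by exact_mod_cast Complex.norm_natCast (j + 1)
  have h3 : (j + 1 : ℝ) ≠ 0 := by positivity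
  simp [h2, h3]

/-- The symbols of the differences with nonnegative steps up to `t`. -/
def diffFamily (f : ι → ℤ) (α t : ℝ) : Set (ι → ℂ) :=
  {b | ∃ h ∈ Set.Icc 0 t, b = fun i => diffSym α h (f i)}

lemma diffFamily_nonempty (f : ι → ℤ) (α : ℝ) {t : ℝ} (ht : 0 ≤ t) :
    (diffFamily f α t).Nonempty := ⟨_, t, ⟨ht, le_rfl⟩, rfl⟩

lemma TransMul.dom_one_sub_avgSym [CompleteSpace E] (hT : TransMul e f) {α : ℝ} (hα : 0 < α)
    {N : ℕ} (hN : α < N) {t : ℝ} (ht : 0 < t) :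
    Dom e (diffBound (N - α)) (fun i => 1 - avgSym N (t * f i)) (diffFamily f α t) := by
  have : IsProbabilityMeasure (volume.restrict (Set.Ioc (0 : ℝ) 1)) := ⟨by simp⟩
  simp only [one_sub_avgSym]
  have hmem : ∀ᵐ s ∂volume.restrict (Set.Ioc (0 : ℝ) 1), s ∈ Set.Ioc (0 : ℝ) 1 :=
    ae_restrict_mem measurableSet_Ioc
  have hcongr : ∀ i, ∫ s, (1 - Complex.exp (-(Complex.I * (t * f i * s : ℝ)))) ^ N
      ∂volume.restrict (Set.Ioc (0 : ℝ) 1) =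
      ∫ s, (Set.Ioc (0 : ℝ) 1).indicator (fun s => (1 - Complex.exp (-(Complex.I *
        (t * f i * s : ℝ)))) ^ N) s ∂volume.restrict (Set.Ioc (0 : ℝ) 1) := fun i => by
    refine integral_congr_ae ?_
    filter_upwards [hmem] with s hs
    rw [Set.indicator_of_mem hs]
  simp only [hcongr]
  refine dom_integral (fun s => ?_) fun i => ?_
  · by_cases hs : s ∈ Set.Ioc (0 : ℝ) 1
    · simp only [Set.indicator_of_mem hs]
      have h1 := (hT.isMul_diffSym (sub_pos.2 hN) (t * s)).dom (diffBound_nonneg _)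
        (b := fun i => diffSym α (t * s) (f i)) (B := diffFamily f α t)
        ⟨t * s, ⟨mul_nonneg ht.le hs.1.le, mul_le_of_le_one_right ht.le hs.2⟩, rfl⟩
      convert h1 using 2 with i
      rw [diffSym_mul (sub_pos.2 hN) hα, sub_add_cancel, diffSym_natCast, mul_right_comm]
    · simp only [Set.indicator_of_notMem hs]
      have h1 := (isMul_zero (e := e)).dom le_rfl (b := fun i => diffSym α t (f i))
        (B := diffFamily f α t) ⟨t, ⟨ht.le, le_rfl⟩, rfl⟩
      simp only [zero_mul] at h1
      exact h1.mono (diffFamily_nonempty f α ht.le) (diffBound_nonneg _)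
  · refine IntegrableOn.indicator ?_ measurableSet_Ioc
    exact ((Continuous.intervalIntegrable (by fun_prop) 0 1).1 :
      IntegrableOn (fun s : ℝ => (1 - Complex.exp (-(Complex.I * (t * f i * s : ℝ)))) ^ N)
        (Set.Ioc 0 1) volume)

lemma dom_one_sub_pow {a : ι → ℂ} {B : Set (ι → ℂ)} {D K : ℝ} (hK : 0 ≤ K) (ha : IsMul e K a)
    (h : Dom e D (fun i => 1 - a i) B) (N : ℕ) :
    Dom e ((∑ j ∈ Finset.range N, K ^ j) * D) (fun i => 1 - a i ^ N) B := by
  have := Dom.isMul_mul (Finset.sum_nonneg fun j _ => pow_nonneg hK j)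
    (isMul_sum (Finset.range N) fun j _ => ha.pow hK j) h
  convert this using 2 with i
  rw [← geom_sum_mul_neg]

/-- Half-line factorization of the fractional derivative of the regularization through a
fractional difference. -/
lemma exists_half_jackson [CompleteSpace E] (e : ι → E) {α : ℝ} (hα : 0 < α) (hC : 0 ≤ C)
    {N : ℕ} (hN : α < N) : ∃ D : ℝ, 0 ≤ D ∧
    ∀ f : ι → ℤ, HalfMul e f C → TransMul e f → ∀ t η : ℝ, 0 < t → (η = 1 ∨ η = -1) →
      ∃ w : ι → ℂ, IsMul e D w ∧ (∀ i, f i ≤ 0 → w i = 0) ∧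
        ∀ i, 0 < f i → w i * diffSym α (η * t) (f i) =
          (t ^ α : ℝ) * (Complex.I * (η * f i : ℝ)) ^ (α : ℂ) * avgSym N (η * t * f i) ^ N := by
  obtain ⟨G, hG, hGb, hGL⟩ := exists_bound_phi_cpow (-α)
  refine ⟨C * (3 * G) * avgBound N ^ N +
    1 * (C * 2 * (avgBound N ^ N * diffBound (N - α))), by
      have := diffBound_nonneg (N - α)
      have := avgBound_nonneg N
      positivity, fun f hf hT t η ht hη => ⟨fun i =>
      (if 0 < f i ∧ t * f i ≤ 1 then phi (η * (t * f i)) ^ ((-α : ℝ) : ℂ) else 0) *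
        avgSym N (η * t * f i) ^ N +
      ((Complex.I * η) ^ ((α - N : ℝ) : ℂ)) *
      ((if 0 < f i ∧ 1 < t * f i then (((t * f i) ^ (-(N - α)) : ℝ) : ℂ) else 0) *
        (avgQuot N (η * t * f i) ^ N * diffSym (N - α) (η * t) (f i))), ?_, fun i hi => ?_,
        fun i hi => ?_⟩⟩
  · have hA := (hT.isMul_avgSym N (η * t)).pow (avgBound_nonneg N) N
    have hQ := (hT.isMul_avgQuot N (η * t)).pow (avgBound_nonneg N) N
    have h1 := (hf.isMul_low_phi hC ht hη hG hGb hGL).mul (by positivity) hA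
    have h2 := ((hf.isMul_high hC ht (sub_pos.2 hN).le).mul (by positivity)
      (hQ.mul (pow_nonneg (avgBound_nonneg N) N) (hT.isMul_diffSym (sub_pos.2 hN)
        (η * t)))).const_mul ((Complex.I * η) ^ ((α - N : ℝ) : ℂ))
    rw [norm_I_mul_cpow hη] at h2
    exact h1.add h2
  · simp [not_lt.2 hi]
  · have hF : (0 : ℝ) < f i := by exact_mod_cast hi
    have hv : 0 < t * f i := by positivity
    have hIη : Complex.I * (η : ℂ) ≠ 0 := by rcases hη with rfl | rfl <;> simp
    have hL : ((t ^ α : ℝ) : ℂ) * (Complex.I * (η * f i : ℝ)) ^ (α : ℂ) =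
        ((t * f i) ^ α : ℝ) * (Complex.I * η) ^ (α : ℂ) := by
      rw [I_mul_cpow hF hη, Real.mul_rpow ht.le hF.le, Complex.ofReal_mul, mul_assoc]
    rw [hL]
    rcases le_or_gt (t * f i) 1 with h | h
    · simp only [hi, h, not_lt.2 h, and_true, and_false, if_true, if_false, zero_mul, mul_zero,
        add_zero]
      have habs : |η * (t * f i)| ≤ 1 := by
        rcases hη with rfl | rfl <;> simp [abs_of_pos hv, h]
      have hphi : phi (η * (t * f i)) ≠ 0 := fun h0 => by
        have := half_le_re_phi habs
        rw [h0] at this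
        norm_num at this
      have hinv : phi (η * (t * f i)) ^ ((-α : ℝ) : ℂ) * phi (η * (t * f i)) ^ (α : ℂ) = 1 := by
        rw [← Complex.cpow_add _ _ hphi]
        simp
      rw [diffSym, mul_assoc η, one_sub_exp_cpow hv h hη, Complex.ofReal_cpow hv.le]
      linear_combination avgSym N (η * (t * f i)) ^ N * ((t * f i : ℝ) : ℂ) ^ (α : ℂ) *
        (Complex.I * η) ^ (α : ℂ) * hinv
    · simp only [hi, h, not_le.2 h, and_true, and_false, if_true, if_false, zero_mul, zero_add]
      have h1 : diffSym (N - α) (η * t) (f i) * diffSym α (η * t) (f i) =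
          (1 - Complex.exp (-(Complex.I * (η * t * f i : ℝ)))) ^ N := by
        rw [diffSym_mul (sub_pos.2 hN) hα, sub_add_cancel, diffSym_natCast]
      have h2 : (1 - Complex.exp (-(Complex.I * (η * t * f i : ℝ)))) ^ N *
          avgQuot N (η * t * f i) ^ N = (Complex.I * η) ^ N * ((t * f i : ℝ) : ℂ) ^ N *
            avgSym N (η * t * f i) ^ N := by
        rw [← mul_pow, ← I_mul_avgSym, ← mul_pow, ← mul_pow]
        push_cast
        ring
      have h3 : (Complex.I * (η : ℂ)) ^ ((α - N : ℝ) : ℂ) * (Complex.I * η) ^ N =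
          (Complex.I * η) ^ (α : ℂ) := by
        rw [← Complex.cpow_natCast, ← Complex.cpow_add _ _ hIη]
        push_cast
        rw [sub_add_cancel]
      have h4 : (((t * f i) ^ (-(N - α)) : ℝ) : ℂ) * ((t * f i : ℝ) : ℂ) ^ N =
          ((t * f i) ^ α : ℝ) := by
        rw [← Complex.ofReal_pow, ← Complex.ofReal_mul, ← Real.rpow_natCast, ← Real.rpow_add hv]
        ring_nf
      rw [← h3, ← h4]
      linear_combination (Complex.I * (η : ℂ)) ^ ((α - N : ℝ) : ℂ) *
        (((t * f i) ^ (-(N - α)) : ℝ) : ℂ) * (avgQuot N (η * t * f i) ^ N * h1 + h2)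

/-- A regularization whose error and fractional derivative are controlled by fractional
differences with steps up to `t`. -/
lemma exists_jackson [CompleteSpace E] (e : ι → E) {α : ℝ} (hα : 0 < α) (hC : 0 ≤ C) :
    ∃ D : ℝ, 0 ≤ D ∧ ∀ f : ι → ℤ, HalfMul e f C → HalfMul e (fun i => -f i) C → TransMul e f →
      ∀ t : ℝ, 0 < t → ∃ a : ℤ → ℂ, (∀ m, a (-m) = (starRingEnd ℂ) (a m)) ∧
        IsMul e D (fun i => a (f i)) ∧
        IsMul e D (fun i => (t ^ α : ℝ) * (Complex.I * f i) ^ (α : ℂ) * a (f i)) ∧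
        Dom e D (fun i => 1 - a (f i)) (diffFamily f α t) ∧
        Dom e D (fun i => (t ^ α : ℝ) * (Complex.I * f i) ^ (α : ℂ) * a (f i))
          (diffFamily f α t) := by
  obtain ⟨N, hN⟩ := exists_nat_gt α
  obtain ⟨D, hD, H⟩ := exists_half_jackson e hα hC hN
  have hA0 := avgBound_nonneg N
  have hd0 := diffBound_nonneg α
  have hd1 := diffBound_nonneg (N - α)
  set D₁ := avgBound N ^ N
  set D₂ := (∑ j ∈ Finset.range N, avgBound N ^ j) * diffBound (N - α)
  have hD₁ : 0 ≤ D₁ := pow_nonneg hA0 N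
  have hD₂ : 0 ≤ D₂ := mul_nonneg (Finset.sum_nonneg fun j _ => pow_nonneg hA0 j) hd1
  have hd2 := mul_nonneg (add_nonneg hD hD) hd0
  refine ⟨D₁ + D₂ + (D + D) * diffBound α + (D + D), by positivity, fun f hf hf' hT t ht =>
    ⟨fun m => avgSym N (t * m) ^ N, fun m => ?_, ?_, ?_⟩⟩
  · rw [map_pow, ← avgSym_neg]
    push_cast
    rw [mul_neg]
  · exact ((hT.isMul_avgSym N t).pow hA0 N).mono (by linarith)
  obtain ⟨w, hw, hw0, hwe⟩ := H f hf hT t 1 ht (Or.inl rfl)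
  obtain ⟨v, hv, hv0, hve⟩ := H _ hf' hT.neg t (-1) ht (Or.inr rfl)
  have key : ∀ i, (t ^ α : ℝ) * (Complex.I * f i) ^ (α : ℂ) * avgSym N (t * f i) ^ N =
      (w i + v i) * diffSym α t (f i) := fun i => by
    rcases lt_trichotomy (f i) 0 with h | h | h
    · have := hve i (by omega)
      rw [hw0 i h.le, zero_add]
      simp only [diffSym] at this ⊢
      push_cast at this ⊢
      simp only [one_mul, neg_mul, mul_neg, neg_neg] at this ⊢
      exact this.symm
    · have hα' : (α : ℂ) ≠ 0 := by exact_mod_cast hα.ne'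
      rw [hw0 i h.le, hv0 i (by omega), h]
      simp [Complex.zero_cpow hα']
    · have := hwe i h
      rw [hv0 i (by omega), add_zero]
      simp only [one_mul] at this
      push_cast at this ⊢
      exact this.symm
  have hwv := hw.add hv
  simp only [key]
  refine ⟨(hwv.mul (add_nonneg hD hD) (hT.isMul_diffSym hα t)).mono (by linarith), ?_,
    (hwv.dom (add_nonneg hD hD) (B := diffFamily f α t) ⟨t, ⟨ht.le, le_rfl⟩, rfl⟩).mono
      (diffFamily_nonempty f α ht.le) (by linarith)⟩
  exact (dom_one_sub_pow hA0 (hT.isMul_avgSym N t) (hT.dom_one_sub_avgSym hα hN ht) N).mono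
    (diffFamily_nonempty f α ht.le) (by linarith)

end SymbolCalculus

section Riesz

open AddCircle Metric Polynomial

instance fact_two_pi_pos : Fact (0 < 2 * π) := ⟨Real.two_pi_pos⟩

/-- The circle of length `2π`. -/
abbrev Circ := AddCircle (2 * π)

/-- The normalized Haar measure of the circle. -/
abbrev circHaar : Measure Circ := haarAddCircle

/-- A point of the circle as a complex number of modulus one. -/
def bd (x : Circ) : ℂ := fourier 1 x

lemma fourier_natCast (n : ℕ) (x : Circ) : fourier (n : ℤ) x = bd x ^ n := by
  induction n with
  | zero => simp
  | succ n ih => rw [Nat.cast_succ, fourier_add, ih, pow_succ, bd]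

lemma fourier_neg_natCast (n : ℕ) (x : Circ) :
    fourier (-n : ℤ) x = (starRingEnd ℂ) (bd x ^ n) := by
  rw [fourier_neg, fourier_natCast]

lemma fourier_coe (n : ℤ) (t : ℝ) :
    fourier n (t : Circ) = Complex.exp (Complex.I * (n * t : ℝ)) := by
  rw [fourier_coe_apply]
  congr 1
  have : (π : ℂ) ≠ 0 := by exact_mod_cast Real.pi_ne_zero
  push_cast
  field_simp

lemma bd_coe (t : ℝ) : bd (t : Circ) = Complex.exp (t * Complex.I) := by
  rw [bd, fourier_coe]
  simp [mul_comm]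

lemma exists_bd_eq {z : ℂ} (hz : ‖z‖ = 1) : ∃ x, bd x = z := by
  refine ⟨(z.arg : ℝ), ?_⟩
  rw [bd_coe]
  simpa [hz] using Complex.norm_mul_exp_arg_mul_I z

lemma integral_bd {G : ℂ → ℂ} (hG : DiffContOnCl ℂ G (ball 0 1)) :
    ∫ x : Circ, G (bd x) ∂circHaar = G 0 := by
  have h := DiffContOnCl.circleAverage (c := 0) (R := 1) (f := G) (by simpa using hG)
  rw [← h, integral_haarAddCircle, ← AddCircle.intervalIntegral_preimage (2 * π) 0, zero_add,
    Real.circleAverage_def]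
  congr 1
  refine intervalIntegral.integral_congr fun t _ => ?_
  simp [bd_coe, circleMap]

lemma exists_norm_rpow_le {p : ℝ} (hp1 : 1 < p) (hp2 : p ≤ 2) : ∃ A B : ℝ, 0 ≤ A ∧ 0 ≤ B ∧
    ∀ z : ℂ, 0 < z.re → ‖z‖ ^ p ≤ A * z.re ^ p - B * (z ^ (p : ℂ)).re := by
  have hpi := Real.pi_pos
  have hp0 : 0 < p := by linarith
  set φ₀ := π * (p + 1) / (4 * p) with hφ₀
  have hpφ : p * φ₀ = π * (p + 1) / 4 := by rw [hφ₀]; field_simp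
  have hφpos : 0 < φ₀ := by positivity
  have hφlt : φ₀ < π / 2 := by
    rw [hφ₀, div_lt_div_iff₀ (by positivity) (by positivity)]
    nlinarith
  have hκ : cos (p * φ₀) < 0 := by
    apply cos_neg_of_pi_div_two_lt_of_lt <;> rw [hpφ] <;> nlinarith
  set κ := -cos (p * φ₀) with hκd
  have hκ0 : 0 < κ := by linarith
  have hc0 : 0 < cos φ₀ := cos_pos_of_mem_Ioo ⟨by linarith, hφlt⟩
  refine ⟨(1 + κ⁻¹) / cos φ₀ ^ p, κ⁻¹, by positivity, by positivity, fun z hz => ?_⟩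
  have hz0 : z ≠ 0 := fun h => by simp [h] at hz
  have hn : 0 < ‖z‖ := norm_pos_iff.2 hz0
  have hre : z.re = ‖z‖ * cos z.arg := by
    rw [Complex.norm_mul_cos_arg]
  have hpow : (z ^ (p : ℂ)).re = ‖z‖ ^ p * cos (p * |z.arg|) := by
    rw [Complex.cpow_ofReal_re, mul_comm z.arg]
    congr 1
    rw [← Real.cos_abs (p * z.arg), abs_mul, abs_of_pos hp0]
  have harg : |z.arg| < π / 2 := Complex.abs_arg_lt_pi_div_two_iff.2 (Or.inl hz)
  have hcpos : 0 < cos |z.arg| := cos_pos_of_mem_Ioo ⟨by linarith [abs_nonneg z.arg], harg⟩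
  have hre' : z.re ^ p = ‖z‖ ^ p * cos |z.arg| ^ p := by
    rw [hre, ← Real.cos_abs z.arg, Real.mul_rpow hn.le hcpos.le]
  rw [hre', hpow]
  suffices h : 1 ≤ (1 + κ⁻¹) / cos φ₀ ^ p * cos |z.arg| ^ p - κ⁻¹ * cos (p * |z.arg|) by
    have := mul_le_mul_of_nonneg_left h (Real.rpow_nonneg hn.le p)
    linarith
  rcases le_or_gt |z.arg| φ₀ with h | h
  · have h1 : cos φ₀ ≤ cos |z.arg| :=
      cos_le_cos_of_nonneg_of_le_pi (abs_nonneg _) (by linarith) h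
    have h2 := Real.rpow_le_rpow hc0.le h1 hp0.le
    have h3 : 0 < cos φ₀ ^ p := Real.rpow_pos_of_pos hc0 p
    have h4 : 1 + κ⁻¹ ≤ (1 + κ⁻¹) / cos φ₀ ^ p * cos |z.arg| ^ p := by
      rw [div_mul_eq_mul_div, le_div_iff₀ h3]
      gcongr
    have h5 : κ⁻¹ * cos (p * |z.arg|) ≤ κ⁻¹ * 1 := by
      gcongr
      exact cos_le_one _
    linarith
  · have h1 : cos (p * |z.arg|) ≤ cos (p * φ₀) :=
      cos_le_cos_of_nonneg_of_le_pi (by positivity) (by nlinarith) (by gcongr)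
    have h2 : κ⁻¹ * cos (p * |z.arg|) ≤ κ⁻¹ * (-κ) := by
      gcongr
      linarith
    rw [mul_neg, inv_mul_cancel₀ hκ0.ne'] at h2
    have h3 : 0 ≤ (1 + κ⁻¹) / cos φ₀ ^ p * cos |z.arg| ^ p := by positivity
    linarith

lemma continuous_eval_bd (F : ℂ[X]) : Continuous fun x => F.eval (bd x) :=
  F.continuous.comp (map_continuous (fourier 1))

lemma integrable_of_continuous {V : Type*} [NormedAddCommGroup V] {g : Circ → V}
    (hg : Continuous g) : Integrable g circHaar :=
  hg.integrable_of_hasCompactSupport (HasCompactSupport.of_compactSpace _)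

lemma re_eval_pos {F : ℂ[X]} (hF : ∀ x, 0 < (F.eval (bd x)).re) {z : ℂ} (hz : ‖z‖ ≤ 1) :
    0 < (F.eval z).re := by
  have hc : Continuous fun x => (F.eval (bd x)).re :=
    Complex.continuous_re.comp (continuous_eval_bd F)
  obtain ⟨x₀, -, hx₀⟩ := isCompact_univ.exists_isMinOn Set.univ_nonempty hc.continuousOn
  have hd : Differentiable ℂ fun z => Complex.exp (-F.eval z) := by
    have := F.differentiable
    fun_prop
  have h := Complex.norm_le_of_forall_mem_frontier_norm_le (isBounded_ball (x := (0 : ℂ)) (r := 1))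
    hd.diffContOnCl (C := Real.exp (-(F.eval (bd x₀)).re)) (z := z) (fun w hw => ?_) ?_
  · rw [Complex.norm_exp, Real.exp_le_exp, Complex.neg_re, neg_le_neg_iff] at h
    exact (hF x₀).trans_le h
  · rw [frontier_ball _ one_ne_zero, mem_sphere_zero_iff_norm] at hw
    obtain ⟨x, rfl⟩ := exists_bd_eq hw
    rw [Complex.norm_exp, Real.exp_le_exp, Complex.neg_re, neg_le_neg_iff]
    exact hx₀ (Set.mem_univ x)
  · rw [closure_ball _ one_ne_zero]
    simpa using hz

lemma integral_norm_rpow_le {p A B : ℝ} (hB : 0 ≤ B) (hp : 0 < p)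
    (h : ∀ z : ℂ, 0 < z.re → ‖z‖ ^ p ≤ A * z.re ^ p - B * (z ^ (p : ℂ)).re) {F : ℂ[X]}
    (hF0 : (F.eval 0).im = 0) (hF : ∀ x, 0 < (F.eval (bd x)).re) :
    ∫ x, ‖F.eval (bd x)‖ ^ p ∂circHaar ≤ A * ∫ x, (F.eval (bd x)).re ^ p ∂circHaar := by
  have hFc := continuous_eval_bd F
  have hre : Continuous fun x => (F.eval (bd x)).re := Complex.continuous_re.comp hFc
  have hd : DiffContOnCl ℂ (fun z => (F.eval z) ^ (p : ℂ)) (ball 0 1) := by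
    refine DifferentiableOn.diffContOnCl ?_
    rw [closure_ball _ one_ne_zero]
    intro z hz
    exact (F.differentiable.differentiableAt.cpow_const
      (Or.inl (re_eval_pos hF (by simpa using hz)))).differentiableWithinAt
  have hmean := integral_bd hd
  have hcp : Continuous fun x => (F.eval (bd x)) ^ (p : ℂ) :=
    hFc.cpow continuous_const fun x => Or.inl (hF x)
  have h0 : 0 ≤ ((F.eval 0) ^ (p : ℂ)).re := by
    have h1 := re_eval_pos hF (z := 0) (by simp)
    have h2 : F.eval 0 = ((F.eval 0).re : ℂ) := Complex.ext (by simp) (by simpa using hF0)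
    rw [h2, ← Complex.ofReal_cpow h1.le, Complex.ofReal_re]
    positivity
  have hint : ∫ x, ((F.eval (bd x)) ^ (p : ℂ)).re ∂circHaar = ((F.eval 0) ^ (p : ℂ)).re := by
    rw [← hmean]
    exact (integral_re (integrable_of_continuous hcp))
  have hi1 : Integrable (fun x => A * (F.eval (bd x)).re ^ p) circHaar :=
    (integrable_of_continuous (hre.rpow_const fun x => Or.inr hp.le)).const_mul A
  have hi2 : Integrable (fun x => B * ((F.eval (bd x)) ^ (p : ℂ)).re) circHaar :=
    (integrable_of_continuous (Complex.continuous_re.comp hcp)).const_mul B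
  calc ∫ x, ‖F.eval (bd x)‖ ^ p ∂circHaar
      ≤ ∫ x, (A * (F.eval (bd x)).re ^ p - B * ((F.eval (bd x)) ^ (p : ℂ)).re) ∂circHaar :=
        integral_mono (integrable_of_continuous (hFc.norm.rpow_const fun x => Or.inr hp.le))
          (hi1.sub hi2) fun x => h _ (hF x)
    _ ≤ _ := by
      rw [integral_sub hi1 hi2, integral_const_mul, integral_const_mul, hint]
      linarith [mul_nonneg hB h0]

lemma integral_norm_sq_le {F : ℂ[X]} (hF0 : (F.eval 0).im = 0) :
    ∫ x, ‖F.eval (bd x)‖ ^ 2 ∂circHaar ≤ 2 * ∫ x, (F.eval (bd x)).re ^ 2 ∂circHaar := by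
  have hFc := continuous_eval_bd F
  have hre : Continuous fun x => (F.eval (bd x)).re := Complex.continuous_re.comp hFc
  have hmean := integral_bd ((F ^ 2).differentiable.diffContOnCl (s := ball 0 1))
  have hint : ∫ x, ((F ^ 2).eval (bd x)).re ∂circHaar = ((F ^ 2).eval 0).re := by
    rw [← hmean]
    exact integral_re (integrable_of_continuous (continuous_eval_bd _))
  have hi : Integrable (fun x => 2 * (F.eval (bd x)).re ^ 2) circHaar :=
    (integrable_of_continuous (hre.pow 2)).const_mul 2
  have heq : ∀ x, ‖F.eval (bd x)‖ ^ 2 =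
      2 * (F.eval (bd x)).re ^ 2 - ((F ^ 2).eval (bd x)).re := fun x => by
    rw [← Complex.normSq_eq_norm_sq, Complex.normSq_apply, eval_pow, pow_two (eval _ _),
      Complex.mul_re]
    ring
  simp only [heq]
  have hi' : Integrable (fun x => ((F ^ 2).eval (bd x)).re) circHaar :=
    integrable_of_continuous (Complex.continuous_re.comp (continuous_eval_bd _))
  rw [integral_sub hi hi', integral_const_mul, hint, eval_pow, pow_two (eval _ _),
    Complex.mul_re, hF0]
  linarith [mul_self_nonneg (F.eval 0).re]

lemma exists_polynomial_re_eq {v : C(Circ, ℂ)}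
    (hv : v ∈ Submodule.span ℂ (Set.range (fourier (T := 2 * π)))) (c : ℂ) :
    ∃ F : ℂ[X], (F.eval 0).im = 0 ∧ ∀ x, (F.eval (bd x)).re = (c * v x).re := by
  induction hv using Submodule.span_induction generalizing c with
  | mem v hv =>
    obtain ⟨n, rfl⟩ := hv
    obtain ⟨k, rfl | rfl⟩ := n.eq_nat_or_neg
    · rcases Nat.eq_zero_or_pos k with rfl | hk
      · exact ⟨C (c.re : ℂ), by simp, by simp⟩
      · exact ⟨C c * X ^ k, by simp [hk.ne'], fun x => by rw [fourier_natCast]; simp⟩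
    · rcases Nat.eq_zero_or_pos k with rfl | hk
      · exact ⟨C (c.re : ℂ), by simp, by simp⟩
      · refine ⟨C ((starRingEnd ℂ) c) * X ^ k, by simp [hk.ne'], fun x => ?_⟩
        rw [fourier_neg_natCast, ← Complex.conj_re (c * _)]
        simp
  | zero => exact ⟨0, by simp, by simp⟩
  | add u v _ _ hu hv =>
    obtain ⟨F, hF0, hF⟩ := hu c
    obtain ⟨G, hG0, hG⟩ := hv c
    exact ⟨F + G, by simp [hF0, hG0], fun x => by
      rw [eval_add, Complex.add_re, hF, hG, ContinuousMap.add_apply, mul_add, Complex.add_re]⟩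
  | smul a v _ hv =>
    obtain ⟨F, hF0, hF⟩ := hv (c * a)
    exact ⟨F, hF0, fun x => by rw [hF, ContinuousMap.smul_apply, smul_eq_mul, mul_assoc]⟩

lemma exists_polynomial_near {φ : Circ → ℝ} (hφ : Continuous φ) {δ : ℝ} (hδ : 0 < δ) :
    ∃ F : ℂ[X], (F.eval 0).im = 0 ∧ ∀ x, |(F.eval (bd x)).re - φ x| < δ := by
  let ψ : C(Circ, ℂ) := ⟨fun x => (φ x : ℂ), by fun_prop⟩
  have hψ : ψ ∈ (Submodule.span ℂ (Set.range (fourier (T := 2 * π)))).topologicalClosure := by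
    rw [span_fourier_closure_eq_top]
    trivial
  obtain ⟨v, hv, hvδ⟩ := Metric.mem_closure_iff.1 hψ δ hδ
  obtain ⟨F, hF0, hF⟩ := exists_polynomial_re_eq hv 1
  refine ⟨F, hF0, fun x => ?_⟩
  rw [hF, one_mul]
  rw [dist_comm, dist_eq_norm] at hvδ
  have h1 := (v - ψ).norm_coe_le_norm x
  have h2 := Complex.abs_re_le_norm ((v - ψ) x)
  refine lt_of_le_of_lt ?_ ((h2.trans h1).trans_lt hvδ)
  simp [ψ]

end Riesz

section RieszBound

open AddCircle Metric Polynomial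
open scoped NNReal

lemma eLpNorm_circle_eq {q : ℝ} (hq : 0 < q) {V : Type*} [NormedAddCommGroup V] {g : Circ → V}
    (hg : Continuous g) : eLpNorm g (ENNReal.ofReal q) circHaar =
      ENNReal.ofReal ((∫ x, ‖g x‖ ^ q ∂circHaar) ^ q⁻¹) := by
  have hm : MemLp g (ENNReal.ofReal q) circHaar :=
    hg.memLp_of_hasCompactSupport (HasCompactSupport.of_compactSpace _)
  rw [hm.eLpNorm_eq_integral_rpow_norm (by simpa using hq) ENNReal.ofReal_ne_top,
    ENNReal.toReal_ofReal hq.le]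

lemma eLpNorm_le_of_integral_le {q A : ℝ} (hq : 0 < q) (hA : 0 ≤ A) {F : Circ → ℂ} {u : Circ → ℝ}
    (hF : Continuous F) (hu : Continuous u)
    (h : ∫ x, ‖F x‖ ^ q ∂circHaar ≤ A * ∫ x, ‖u x‖ ^ q ∂circHaar) :
    eLpNorm F (ENNReal.ofReal q) circHaar ≤
      (A ^ q⁻¹).toNNReal * eLpNorm u (ENNReal.ofReal q) circHaar := by
  rw [eLpNorm_circle_eq hq hF, eLpNorm_circle_eq hq hu, ← ENNReal.ofReal,
    ← ENNReal.ofReal_mul (by positivity), ← Real.mul_rpow hA (by positivity)]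
  gcongr

lemma eLpNorm_le_of_bound {q : ℝ} (hq : 1 ≤ q) {u v : Circ → ℝ} (hv : Continuous v) {δ : ℝ}
    (hδ : 0 ≤ δ) (h : ∀ x, |u x| ≤ |v x| + δ) :
    eLpNorm u (ENNReal.ofReal q) circHaar ≤
      eLpNorm v (ENNReal.ofReal q) circHaar + ENNReal.ofReal δ := by
  have hq0 : ENNReal.ofReal q ≠ 0 := by simpa using hq.trans_lt' one_pos
  calc eLpNorm u (ENNReal.ofReal q) circHaar
      ≤ eLpNorm ((fun x => ‖v x‖) + fun _ => δ) (ENNReal.ofReal q) circHaar :=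
        eLpNorm_mono_real h
    _ ≤ eLpNorm (fun x => ‖v x‖) (ENNReal.ofReal q) circHaar +
        eLpNorm (fun _ => δ) (ENNReal.ofReal q) circHaar :=
      eLpNorm_add_le hv.norm.aestronglyMeasurable aestronglyMeasurable_const (by simpa using hq)
    _ = _ := by
      rw [eLpNorm_norm, eLpNorm_const δ hq0 (NeZero.ne _)]
      simp [Real.enorm_of_nonneg hδ]

lemma exists_riesz_completion {p : ℝ} (hp1 : 1 < p) (hp2 : p ≤ 2) : ∃ K : ℝ≥0, ∀ F : ℂ[X],
    (F.eval 0).im = 0 → eLpNorm (fun x => F.eval (bd x)) (ENNReal.ofReal p) circHaar ≤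
      K * eLpNorm (fun x => (F.eval (bd x)).re) (ENNReal.ofReal p) circHaar := by
  have hp0 : 0 < p := by linarith
  obtain ⟨A, B, hA, hB, hAB⟩ := exists_norm_rpow_le hp1 hp2
  set K₁ : ℝ≥0 := (A ^ p⁻¹).toNNReal
  set K₂ : ℝ≥0 := ((2 : ℝ) ^ (2 : ℝ)⁻¹).toNNReal
  have hre : ∀ F : ℂ[X], Continuous fun x => (F.eval (bd x)).re := fun F =>
    Complex.continuous_re.comp (continuous_eval_bd F)
  have hpos : ∀ F : ℂ[X], (F.eval 0).im = 0 → (∀ x, 0 < (F.eval (bd x)).re) →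
      eLpNorm (fun x => F.eval (bd x)) (ENNReal.ofReal p) circHaar ≤
      K₁ * eLpNorm (fun x => (F.eval (bd x)).re) (ENNReal.ofReal p) circHaar := fun F hF0 hF => by
    refine eLpNorm_le_of_integral_le hp0 hA (continuous_eval_bd F) (hre F) ?_
    convert integral_norm_rpow_le hB hp0 hAB hF0 hF using 5 with x
    rw [Real.norm_of_nonneg (hF x).le]
  have hsq : ∀ F : ℂ[X], (F.eval 0).im = 0 →
      eLpNorm (fun x => F.eval (bd x)) (ENNReal.ofReal 2) circHaar ≤
      K₂ * eLpNorm (fun x => (F.eval (bd x)).re) (ENNReal.ofReal 2) circHaar := fun F hF0 => by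
    refine eLpNorm_le_of_integral_le two_pos two_pos.le (continuous_eval_bd F) (hre F) ?_
    simpa using integral_norm_sq_le hF0
  refine ⟨2 * K₁, fun F hF0 => ENNReal.le_of_forall_pos_le_add fun ε hε _ => ?_⟩
  set δ : ℝ := ε / (2 * (2 * K₁ + K₂) + 1) with hδd
  have hδ : 0 < δ := by positivity
  obtain ⟨F₁, hF₁0, hF₁⟩ := exists_polynomial_near (φ := fun x => max (F.eval (bd x)).re 0 + δ)
    (((hre F).max continuous_const).add continuous_const) hδ
  obtain ⟨F₂, hF₂0, hF₂⟩ := exists_polynomial_near (φ := fun x => max (-(F.eval (bd x)).re) 0 + δ)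
    (((hre F).neg.max continuous_const).add continuous_const) hδ
  have hm : ∀ r : ℝ, 0 ≤ max r 0 ∧ 0 ≤ max (-r) 0 ∧ max r 0 ≤ |r| ∧ max (-r) 0 ≤ |r| ∧
      max r 0 - max (-r) 0 = r := fun r => by
    rcases le_total 0 r with h | h
    · simp [h, abs_of_nonneg h]
    · simp [h, abs_of_nonpos h]
  have hp1' : 1 ≤ p := hp1.le
  have h1 : eLpNorm (fun x => F₁.eval (bd x)) (ENNReal.ofReal p) circHaar ≤
      K₁ * (eLpNorm (fun x => (F.eval (bd x)).re) (ENNReal.ofReal p) circHaar +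
        ENNReal.ofReal (2 * δ)) := by
    refine (hpos F₁ hF₁0 fun x => ?_).trans (mul_le_mul_right
      (eLpNorm_le_of_bound hp1' (hre F) (by positivity) fun x => ?_) _) <;>
    have := abs_lt.1 (hF₁ x) <;> have := hm (F.eval (bd x)).re
    · linarith
    · rw [abs_of_nonneg] <;> linarith
  have h2 : eLpNorm (fun x => F₂.eval (bd x)) (ENNReal.ofReal p) circHaar ≤
      K₁ * (eLpNorm (fun x => (F.eval (bd x)).re) (ENNReal.ofReal p) circHaar +
        ENNReal.ofReal (2 * δ)) := by
    refine (hpos F₂ hF₂0 fun x => ?_).trans (mul_le_mul_right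
      (eLpNorm_le_of_bound hp1' (hre F) (by positivity) fun x => ?_) _) <;>
    have := abs_lt.1 (hF₂ x) <;> have := hm (F.eval (bd x)).re
    · linarith
    · rw [abs_of_nonneg] <;> linarith
  have h3 : eLpNorm (fun x => (F - F₁ + F₂).eval (bd x)) (ENNReal.ofReal p) circHaar ≤
      K₂ * ENNReal.ofReal (2 * δ) := by
    refine (eLpNorm_le_eLpNorm_of_exponent_le (ENNReal.ofReal_le_ofReal hp2)
      (continuous_eval_bd _).aestronglyMeasurable).trans ((hsq _ (by
        simp [hF0, hF₁0, hF₂0])).trans (mul_le_mul_right ((eLpNorm_le_of_bound one_le_two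
          continuous_const (v := fun _ => 0) (δ := 2 * δ) (by positivity) fun x => ?_).trans
            (by simp)) _))
    have := abs_lt.1 (hF₁ x)
    have := abs_lt.1 (hF₂ x)
    have := hm (F.eval (bd x)).re
    rw [abs_zero, zero_add, eval_add, eval_sub, Complex.add_re, Complex.sub_re, abs_le]
    constructor <;> linarith
  have hsum : (fun x => F.eval (bd x)) = (fun x => F₁.eval (bd x)) - (fun x => F₂.eval (bd x)) +
      fun x => (F - F₁ + F₂).eval (bd x) := by
    ext x
    simp
  have hone : 1 ≤ ENNReal.ofReal p := by simpa using hp1'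
  have hcm : ∀ F : ℂ[X], AEStronglyMeasurable (fun x => F.eval (bd x)) circHaar := fun F =>
    (continuous_eval_bd F).aestronglyMeasurable
  rw [hsum]
  refine (eLpNorm_add_le ((hcm _).sub (hcm _)) (hcm _) hone).trans
    ((add_le_add ((eLpNorm_sub_le (hcm _) (hcm _) hone).trans (add_le_add h1 h2)) h3).trans ?_)
  have hε' : (2 * K₁ + K₂ : ℝ≥0∞) * ENNReal.ofReal (2 * δ) ≤ ε := by
    rw [← ENNReal.ofReal_coe_nnreal (p := ε), ← ENNReal.ofReal_coe_nnreal (p := K₁),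
      ← ENNReal.ofReal_coe_nnreal (p := K₂), ← ENNReal.ofReal_ofNat, ← ENNReal.ofReal_mul (by simp),
      ← ENNReal.ofReal_add (by positivity) (by positivity), ← ENNReal.ofReal_mul (by positivity)]
    refine ENNReal.ofReal_le_ofReal ?_
    rw [hδd, ← mul_assoc, mul_div_assoc', div_le_iff₀ (by positivity)]
    nlinarith [ε.2, K₁.2, K₂.2, hε]
  calc _ = (2 * K₁ : ℝ≥0∞) * eLpNorm (fun x => (F.eval (bd x)).re) (ENNReal.ofReal p) circHaar +
        (2 * K₁ + K₂ : ℝ≥0∞) * ENNReal.ofReal (2 * δ) := by ring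
    _ ≤ _ := by
      push_cast
      gcongr

end RieszBound

section RieszSign

open AddCircle Metric Polynomial
open scoped NNReal

/-- The symbol of the conjugation operator, up to a constant factor. -/
def sg (m : ℤ) : ℂ := if 0 ≤ m then 1 else -1

/-- The M. Riesz inequality with exponent `q` and constant `C`. -/
def RieszBd (q : ℝ) (C : ℝ≥0) : Prop := ∀ (s : Finset ℤ) (c : ℤ → ℂ),
  eLpNorm (fun x : Circ => ∑ m ∈ s, c m * sg m * fourier m x) (ENNReal.ofReal q) circHaar ≤
    C * eLpNorm (fun x : Circ => ∑ m ∈ s, c m * fourier m x) (ENNReal.ofReal q) circHaar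

lemma enorm_eval_zero_le {q : ℝ} (hq : 1 ≤ q) (F : ℂ[X]) :
    ‖F.eval 0‖ₑ ≤ eLpNorm (fun x => F.eval (bd x)) (ENNReal.ofReal q) circHaar := by
  have h := integral_bd (F.differentiable.diffContOnCl (s := ball 0 1))
  rw [← h]
  refine (enorm_integral_le_lintegral_enorm _).trans ?_
  rw [← eLpNorm_one_eq_lintegral_enorm]
  exact eLpNorm_le_eLpNorm_of_exponent_le (by simpa using hq)
    (continuous_eval_bd F).aestronglyMeasurable

/-- The polynomial whose real part on the circle is that of `c * fourier m`. -/
def completion (m : ℤ) (c : ℂ) : ℂ[X] :=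
  if m = 0 then C (c.re : ℂ) else C (if 0 ≤ m then c else (starRingEnd ℂ) c) * X ^ m.natAbs

lemma completion_zero_im (m : ℤ) (c : ℂ) : ((completion m c).eval 0).im = 0 := by
  unfold completion
  split_ifs with h <;> simp [h]

lemma completion_re (m : ℤ) (c : ℂ) (x : Circ) :
    ((completion m c).eval (bd x)).re = (c * fourier m x).re := by
  unfold completion
  obtain ⟨k, rfl | rfl⟩ := m.eq_nat_or_neg
  · rw [fourier_natCast]
    split_ifs with h <;> simp_all
  · rw [fourier_neg_natCast]
    rcases Nat.eq_zero_or_pos k with rfl | hk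
    · simp
    · rw [← Complex.conj_re (c * _)]
      simp [hk.ne']

lemma completion_sg (m : ℤ) (c : ℂ) (x : Circ) :
    ((completion m c - C Complex.I * completion m (Complex.I * c)).eval (bd x)) +
      ((completion m c - C Complex.I * completion m (Complex.I * c)).eval 0) -
      c * fourier m x = c * sg m * fourier m x := by
  unfold completion sg
  obtain ⟨k, rfl | rfl⟩ := m.eq_nat_or_neg
  · rw [fourier_natCast]
    rcases Nat.eq_zero_or_pos k with rfl | hk
    · simp
      have := Complex.re_add_im c
      linear_combination 2 * this
    · have hk' := hk.ne'
      simp [hk']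
      linear_combination -c * bd x ^ k * Complex.I_sq
  · rw [fourier_neg_natCast]
    rcases Nat.eq_zero_or_pos k with rfl | hk
    · simp
      have := Complex.re_add_im c
      linear_combination 2 * this
    · have hk' := hk.ne'
      simp [hk']
      linear_combination (starRingEnd ℂ) c * bd x ^ k * Complex.I_sq

lemma continuous_trig (s : Finset ℤ) (c : ℤ → ℂ) :
    Continuous fun x : Circ => ∑ m ∈ s, c m * fourier m x := by
  fun_prop

lemma exists_rieszBd_of_le_two {p : ℝ} (hp1 : 1 < p) (hp2 : p ≤ 2) : ∃ K, RieszBd p K := by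
  obtain ⟨K, hK⟩ := exists_riesz_completion hp1 hp2
  have hone : 1 ≤ ENNReal.ofReal p := by simpa using hp1.le
  refine ⟨K + K + (K + K) + 1, fun s c => ?_⟩
  set u : Circ → ℂ := fun x => ∑ m ∈ s, c m * fourier m x with hu
  have huc : Continuous u := continuous_trig s c
  have hcm : ∀ F : ℂ[X], AEStronglyMeasurable (fun x => F.eval (bd x)) circHaar := fun F =>
    (continuous_eval_bd F).aestronglyMeasurable
  have hb : ∀ z : ℂ, ‖z‖ = 1 → eLpNorm (fun x => (∑ m ∈ s, completion m (z * c m)).eval (bd x))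
      (ENNReal.ofReal p) circHaar ≤ K * eLpNorm u (ENNReal.ofReal p) circHaar := fun z hz => by
    refine (hK _ ?_).trans ?_
    · simp [eval_finsetSum, completion_zero_im]
    · gcongr
      refine eLpNorm_mono fun x => ?_
      have : ((∑ m ∈ s, completion m (z * c m)).eval (bd x)).re = (z * u x).re := by
        simp only [eval_finsetSum, Complex.re_sum, completion_re, hu, Finset.mul_sum, mul_assoc]
      rw [this]
      exact (Complex.abs_re_le_norm _).trans (by simp [hz])
  set H : ℂ[X] := (∑ m ∈ s, completion m (c m)) -
    C Complex.I * ∑ m ∈ s, completion m (Complex.I * c m) with hH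
  have hHb : eLpNorm (fun x => H.eval (bd x)) (ENNReal.ofReal p) circHaar ≤
      K * eLpNorm u (ENNReal.ofReal p) circHaar + K * eLpNorm u (ENNReal.ofReal p) circHaar := by
    have h1 := hb 1 (by simp)
    have h2 := hb Complex.I (by simp)
    simp only [one_mul] at h1
    have : (fun x => H.eval (bd x)) = (fun x => (∑ m ∈ s, completion m (c m)).eval (bd x)) -
        Complex.I • fun x => (∑ m ∈ s, completion m (Complex.I * c m)).eval (bd x) := by
      ext x
      simp [hH]
    rw [this]
    refine (eLpNorm_sub_le (hcm _) ((hcm _).const_smul _) hone).trans (add_le_add h1 ?_)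
    rw [eLpNorm_const_smul]
    simpa [enorm_eq_nnnorm] using h2
  have hsum : (fun x : Circ => ∑ m ∈ s, c m * sg m * fourier m x) =
      (fun x => H.eval (bd x)) + (fun _ => H.eval 0) - u := by
    ext x
    simp only [← completion_sg, Finset.sum_sub_distrib, Finset.sum_add_distrib, Pi.sub_apply,
      Pi.add_apply, hu, hH, eval_sub, eval_mul, eval_C, eval_finsetSum, Finset.mul_sum]
  rw [hsum]
  refine (eLpNorm_sub_le ((hcm _).add aestronglyMeasurable_const) huc.aestronglyMeasurable
    hone).trans ((add_le_add_left ((eLpNorm_add_le (hcm _) aestronglyMeasurable_const hone).trans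
      (add_le_add hHb ((?_ : _ ≤ _).trans hHb))) _).trans_eq ?_)
  · rw [eLpNorm_const _ (by simpa using hp1.trans' one_pos) (NeZero.ne _)]
    simpa using enorm_eval_zero_le hp1.le H
  · push_cast
    ring

lemma sg_mul_sg (m n : ℤ) : sg (m + n) * (sg m + sg n) = sg m * sg n + 1 := by
  unfold sg
  split_ifs <;> first | omega | norm_num

lemma cotlar_identity (s : Finset ℤ) (c : ℤ → ℂ) (x : Circ) :
    (∑ m ∈ s, c m * sg m * fourier m x) * (∑ m ∈ s, c m * sg m * fourier m x) =
      (2 : ℂ) * (∑ k ∈ s ×ˢ s, c k.1 * (c k.2 * sg k.2) * sg (k.1 + k.2) * fourier (k.1 + k.2) x) -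
      (∑ m ∈ s, c m * fourier m x) * (∑ m ∈ s, c m * fourier m x) := by
  have hsw : (2 : ℂ) * (∑ k ∈ s ×ˢ s,
      c k.1 * (c k.2 * sg k.2) * sg (k.1 + k.2) * fourier (k.1 + k.2) x) =
      ∑ k ∈ s ×ˢ s, c k.1 * c k.2 * (sg k.1 + sg k.2) * sg (k.1 + k.2) *
        fourier (k.1 + k.2) x := by
    rw [two_mul]
    nth_rewrite 1 [Finset.sum_product_right]
    rw [← Finset.sum_product', ← Finset.sum_add_distrib]
    refine Finset.sum_congr rfl fun k _ => ?_
    rw [add_comm k.2 k.1]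
    ring
  rw [hsw, Finset.sum_mul_sum, Finset.sum_mul_sum, ← Finset.sum_product', ← Finset.sum_product',
    ← Finset.sum_sub_distrib]
  refine Finset.sum_congr rfl fun k _ => ?_
  rw [fourier_add]
  linear_combination -c k.1 * c k.2 * fourier k.1 x * fourier k.2 x * sg_mul_sg k.1 k.2

lemma RieszBd.prod {q : ℝ} {C : ℝ≥0} (h : RieszBd q C) (s : Finset ℤ) (c d : ℤ → ℂ) :
    eLpNorm (fun x : Circ => ∑ k ∈ s ×ˢ s, c k.1 * d k.2 * sg (k.1 + k.2) * fourier (k.1 + k.2) x)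
      (ENNReal.ofReal q) circHaar ≤ C * eLpNorm (fun x : Circ => (∑ m ∈ s, c m * fourier m x) *
        ∑ m ∈ s, d m * fourier m x) (ENNReal.ofReal q) circHaar := by
  classical
  have h1 := h ((s ×ˢ s).image fun k => k.1 + k.2)
    fun l => ∑ k ∈ s ×ˢ s with k.1 + k.2 = l, c k.1 * d k.2
  have hg : ∀ g : ℤ → ℂ, ∑ l ∈ (s ×ˢ s).image fun k => k.1 + k.2,
      (∑ k ∈ s ×ˢ s with k.1 + k.2 = l, c k.1 * d k.2) * g l =
      ∑ k ∈ s ×ˢ s, c k.1 * d k.2 * g (k.1 + k.2) := fun g => by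
    rw [← Finset.sum_fiberwise_of_maps_to (g := fun k : ℤ × ℤ => k.1 + k.2)
      (t := (s ×ˢ s).image fun k => k.1 + k.2) fun k hk => Finset.mem_image_of_mem _ hk]
    refine Finset.sum_congr rfl fun l _ => ?_
    rw [Finset.sum_mul]
    refine Finset.sum_congr rfl fun k hk => ?_
    rw [(Finset.mem_filter.1 hk).2]
  simp only [mul_assoc _ (sg _), hg] at h1
  simp only [mul_assoc _ (sg _)]
  refine h1.trans_eq ?_
  congr 2
  ext x
  rw [Finset.sum_mul_sum, ← Finset.sum_product']
  refine Finset.sum_congr rfl fun k _ => ?_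
  rw [fourier_add]
  ring

lemma eLpNorm_mul_self {q : ℝ} (hq : 0 < q) (f : Circ → ℂ) :
    eLpNorm (fun x => f x * f x) (ENNReal.ofReal q) circHaar =
      eLpNorm f (ENNReal.ofReal (2 * q)) circHaar ^ 2 := by
  have := eLpNorm_norm_rpow (p := ENNReal.ofReal q) (μ := circHaar) f (q := 2) two_pos
  rw [← ENNReal.ofReal_mul hq.le, mul_comm q] at this
  rw [← ENNReal.rpow_two, ← this]
  refine eLpNorm_congr_norm_ae (Filter.Eventually.of_forall fun x => ?_)
  simp [sq]

lemma eLpNorm_mul_le {q : ℝ} (hq : 0 < q) {u v : Circ → ℂ} (hu : Continuous u)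
    (hv : Continuous v) : eLpNorm (fun x => u x * v x) (ENNReal.ofReal q) circHaar ≤
      eLpNorm u (ENNReal.ofReal (2 * q)) circHaar *
        eLpNorm v (ENNReal.ofReal (2 * q)) circHaar := by
  have : ENNReal.HolderTriple (ENNReal.ofReal (2 * q)) (ENNReal.ofReal (2 * q))
      (ENNReal.ofReal q) := ⟨by
    rw [← ENNReal.ofReal_inv_of_pos (by positivity), ← ENNReal.ofReal_inv_of_pos hq,
      ← ENNReal.ofReal_add (by positivity) (by positivity)]
    congr 1
    field_simp
    norm_num⟩
  have h := eLpNorm_smul_le_mul_eLpNorm (p := ENNReal.ofReal (2 * q))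
    (q := ENNReal.ofReal (2 * q)) (r := ENNReal.ofReal q) (μ := circHaar)
    hv.aestronglyMeasurable hu.aestronglyMeasurable
  exact h

lemma RieszBd.two_mul {q : ℝ} (hq : 1 ≤ q) {C : ℝ≥0} (h : RieszBd q C) :
    RieszBd (2 * q) (2 * C + 1) := by
  intro s c
  have hq0 : 0 < q := by linarith
  set u : Circ → ℂ := fun x => ∑ m ∈ s, c m * fourier m x with hu
  set v : Circ → ℂ := fun x => ∑ m ∈ s, c m * sg m * fourier m x with hv
  have huc : Continuous u := continuous_trig s c
  have hvc : Continuous v := continuous_trig s fun m => c m * sg m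
  have hfin : ∀ g : Circ → ℂ, Continuous g →
      eLpNorm g (ENNReal.ofReal (2 * q)) circHaar ≠ ⊤ := fun g hg =>
    (hg.memLp_of_hasCompactSupport (HasCompactSupport.of_compactSpace _)).2.ne
  have hone : 1 ≤ ENNReal.ofReal q := by simpa using hq
  have hprod : eLpNorm (fun x => u x * v x) (ENNReal.ofReal q) circHaar ≤
      eLpNorm u (ENNReal.ofReal (2 * q)) circHaar *
        eLpNorm v (ENNReal.ofReal (2 * q)) circHaar :=
    eLpNorm_mul_le hq0 huc hvc
  have hJ := h.prod s c fun m => c m * sg m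
  set w : Circ → ℂ := fun x => ∑ k ∈ s ×ˢ s,
    c k.1 * (c k.2 * sg k.2) * sg (k.1 + k.2) * fourier (k.1 + k.2) x with hw
  have hwc : Continuous w := by fun_prop
  have hid : (fun x => v x * v x) = (2 : ℂ) • w - fun x => u x * u x := by
    ext x
    exact cotlar_identity s c x
  have h2 : ‖(2 : ℂ)‖ₑ = 2 := by simp [enorm_eq_nnnorm]
  have hmain : eLpNorm v (ENNReal.ofReal (2 * q)) circHaar ^ 2 ≤
      2 * (C * (eLpNorm u (ENNReal.ofReal (2 * q)) circHaar *
        eLpNorm v (ENNReal.ofReal (2 * q)) circHaar)) +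
      eLpNorm u (ENNReal.ofReal (2 * q)) circHaar ^ 2 := by
    calc eLpNorm v (ENNReal.ofReal (2 * q)) circHaar ^ 2
        = eLpNorm ((2 : ℂ) • w - fun x => u x * u x) (ENNReal.ofReal q) circHaar := by
          rw [← hid, eLpNorm_mul_self hq0]
      _ ≤ eLpNorm ((2 : ℂ) • w) (ENNReal.ofReal q) circHaar +
          eLpNorm (fun x => u x * u x) (ENNReal.ofReal q) circHaar :=
        eLpNorm_sub_le (hwc.const_smul _).aestronglyMeasurable
          (huc.mul huc).aestronglyMeasurable hone
      _ ≤ _ := by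
        rw [eLpNorm_mul_self hq0, eLpNorm_const_smul, h2]
        gcongr
        exact hJ.trans (by gcongr)
  obtain ⟨a, ha⟩ : ∃ a : ℝ≥0, (a : ℝ≥0∞) = eLpNorm u (ENNReal.ofReal (2 * q)) circHaar :=
    ⟨_, ENNReal.coe_toNNReal (hfin u huc)⟩
  obtain ⟨b, hb⟩ : ∃ b : ℝ≥0, (b : ℝ≥0∞) = eLpNorm v (ENNReal.ofReal (2 * q)) circHaar :=
    ⟨_, ENNReal.coe_toNNReal (hfin v hvc)⟩
  rw [← ha, ← hb] at hmain ⊢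
  norm_cast at hmain ⊢
  have hm : (b : ℝ) ^ 2 ≤ 2 * (C * (a * b)) + a ^ 2 := by exact_mod_cast hmain
  suffices (b : ℝ) ≤ (2 * C + 1) * a by exact_mod_cast this
  by_contra! hlt
  have hCa : 0 ≤ (C : ℝ) * a := by positivity
  have ha0 : 0 ≤ (a : ℝ) := a.2
  nlinarith [mul_nonneg hCa ha0, mul_nonneg hCa b.2, mul_nonneg ha0 b.2]

/-- The M. Riesz theorem. -/
lemma exists_rieszBd {p : ℝ} (hp : 1 < p) : ∃ K, RieszBd p K := by
  obtain ⟨n, hn⟩ := pow_unbounded_of_one_lt p one_lt_two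
  induction n generalizing p with
  | zero => exact absurd hn (by simpa using hp.le)
  | succ n ih =>
    rcases le_or_gt p 2 with h | h
    · exact exists_rieszBd_of_le_two hp h
    · obtain ⟨K, hK⟩ := ih (p := p / 2) (by linarith) (by rw [pow_succ] at hn; linarith)
      have := hK.two_mul (by linarith)
      rw [mul_div_cancel₀ p two_ne_zero] at this
      exact ⟨_, this⟩

end RieszSign

section Expansions

open Filter
open scoped Topology

variable {ι E : Type*} [NormedAddCommGroup E] [NormedSpace ℂ E]

/-- The vectors `e i` have dense span, the functionals `φ i` are biorthogonal to them, and the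
partial sums of the expansions along the increasing and exhausting sets `box N` are bounded
by `C`. -/
structure Expansion (e : ι → E) (φ : ι → E →L[ℂ] ℂ) (box : ℕ → Finset ι) (C : ℝ) : Prop where
  dense : Dense (Submodule.span ℂ (Set.range e) : Set E)
  biorth_self : ∀ i, φ i (e i) = 1
  biorth_ne : ∀ i j, i ≠ j → φ i (e j) = 0
  box_mono : Monotone box
  box_exhaust : ∀ i, ∃ N, i ∈ box N
  nonneg : 0 ≤ C
  bound : ∀ N, IsMul e C fun i => (box N : Set ι).indicator 1 i

variable {e : ι → E} {φ : ι → E →L[ℂ] ℂ} {box : ℕ → Finset ι} {C D : ℝ} {a : ι → ℂ}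

lemma exists_eq_sum_of_mem_span {v : E} (hv : v ∈ Submodule.span ℂ (Set.range e)) :
    ∃ (s : Finset ι) (c : ι → ℂ), v = ∑ i ∈ s, c i • e i := by
  obtain ⟨c, rfl⟩ := (Finsupp.mem_span_range_iff_exists_finsupp).1 hv
  exact ⟨c.support, c, rfl⟩

namespace Expansion

lemma apply_sum [DecidableEq ι] (h : Expansion e φ box C) (s : Finset ι) (c : ι → ℂ) (i : ι) :
    φ i (∑ j ∈ s, c j • e j) = if i ∈ s then c i else 0 := by
  have key : ∀ j, φ i (e j) = if j = i then 1 else 0 := fun j => by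
    split_ifs with hj
    · exact hj ▸ h.biorth_self j
    · exact h.biorth_ne i j (Ne.symm hj)
  simp [key]

/-- The partial sums of the expansion of a vector. -/
def partialSum (e : ι → E) (φ : ι → E →L[ℂ] ℂ) (box : ℕ → Finset ι) (N : ℕ) (v : E) : E :=
  ∑ i ∈ box N, φ i v • e i

lemma partialSum_sum (h : Expansion e φ box C) (s : Finset ι) (c : ι → ℂ) (N : ℕ) :
    partialSum e φ box N (∑ j ∈ s, c j • e j) =
      ∑ i ∈ s, (c i * (box N : Set ι).indicator 1 i) • e i := by
  classical
  unfold partialSum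
  simp only [h.apply_sum, Set.indicator_apply, Finset.mem_coe, mul_ite, Pi.one_apply, mul_one,
    mul_zero, ite_smul, zero_smul, Finset.sum_ite_mem]
  rw [Finset.inter_comm]

lemma continuous_partialSum (N : ℕ) : Continuous (partialSum e φ box N) := by
  unfold partialSum
  fun_prop

lemma norm_partialSum_le (h : Expansion e φ box C) (N : ℕ) (v : E) :
    ‖partialSum e φ box N v‖ ≤ C * ‖v‖ := by
  refine isClosed_property (p := fun v => ‖partialSum e φ box N v‖ ≤ C * ‖v‖)
    (e := ((↑) : Submodule.span ℂ (Set.range e) → E)) h.dense.denseRange_val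
    (isClosed_le (continuous_partialSum N).norm (by fun_prop)) ?_ v
  rintro ⟨v, hv⟩
  obtain ⟨s, c, rfl⟩ := exists_eq_sum_of_mem_span hv
  simp only [h.partialSum_sum]
  exact h.bound N s c

lemma partialSum_eq_self (h : Expansion e φ box C) {v : E}
    (hv : v ∈ Submodule.span ℂ (Set.range e)) : ∀ᶠ N in atTop, partialSum e φ box N v = v := by
  obtain ⟨s, c, rfl⟩ := exists_eq_sum_of_mem_span hv
  have : ∀ i ∈ s, ∀ᶠ N in atTop, i ∈ box N := fun i _ => by
    obtain ⟨N, hN⟩ := h.box_exhaust i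
    filter_upwards [eventually_ge_atTop N] with M hM using h.box_mono hM hN
  filter_upwards [(Filter.eventually_all_finset s).2 this] with N hN
  rw [h.partialSum_sum]
  exact Finset.sum_congr rfl fun i hi => by simp [hN i hi]

lemma tendsto_partialSum (h : Expansion e φ box C) (v : E) :
    Tendsto (fun N => partialSum e φ box N v) atTop (𝓝 v) := by
  rw [Metric.tendsto_nhds]
  intro ε hε
  have hC := h.nonneg
  obtain ⟨w, hw, hvw⟩ := Metric.dense_iff.1 h.dense v (ε / (C + 1)) (by positivity)
  rw [Metric.mem_ball, dist_comm, dist_eq_norm, lt_div_iff₀ (by positivity)] at hw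
  filter_upwards [h.partialSum_eq_self hvw] with N hN
  have h1 : partialSum e φ box N v - v = partialSum e φ box N (v - w) - (v - w) := by
    have : partialSum e φ box N (v - w) = partialSum e φ box N v - partialSum e φ box N w := by
      simp [partialSum, sub_smul]
    rw [this, hN]
    abel
  rw [dist_eq_norm, h1]
  have h2 := norm_sub_le (partialSum e φ box N (v - w)) (v - w)
  have h3 := h.norm_partialSum_le N (v - w)
  linarith

lemma ext (h : Expansion e φ box C) {v w : E} (hvw : ∀ i, φ i v = φ i w) : v = w := by
  refine tendsto_nhds_unique (h.tendsto_partialSum v) ?_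
  simpa [partialSum, hvw] using h.tendsto_partialSum w

lemma norm_le_of_dom (h : Expansion e φ box C) {B : Set (ι → ℂ)} (ha : Dom e D a B)
    {v w : E} (hw : ∀ i, φ i w = a i * φ i v) {M : ℝ}
    (hM : ∀ b ∈ B, ∃ u, (∀ i, φ i u = b i * φ i v) ∧ ‖u‖ ≤ M) : ‖w‖ ≤ D * C * M := by
  refine le_of_tendsto' (h.tendsto_partialSum w).norm fun N => ?_
  rw [partialSum]
  simp only [hw, mul_comm (a _)]
  rw [mul_assoc]
  refine ha _ _ _ fun b hb => ?_
  obtain ⟨u, hu, huM⟩ := hM b hb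
  simp only [mul_comm _ (b _), ← hu]
  exact (h.norm_partialSum_le N u).trans (mul_le_mul_of_nonneg_left huM h.nonneg)

lemma exists_apply [CompleteSpace E] (h : Expansion e φ box C) (ha : IsMul e D a) (hD : 0 ≤ D)
    (v : E) : ∃ w, (∀ i, φ i w = a i * φ i v) ∧ ‖w‖ ≤ D * ‖v‖ := by
  classical
  set u : ℕ → E := fun N => ∑ i ∈ box N, (φ i v * a i) • e i with hu
  have hdist : ∀ N M, N ≤ M → ‖u M - u N‖ ≤
      D * ‖partialSum e φ box M v - partialSum e φ box N v‖ := fun N M hNM => by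
    simp only [hu, partialSum]
    rw [← Finset.sum_sdiff (h.box_mono hNM), ← Finset.sum_sdiff (h.box_mono hNM),
      add_sub_cancel_right, add_sub_cancel_right]
    exact ha _ _
  have hcau : CauchySeq u := by
    rw [Metric.cauchySeq_iff']
    intro ε hε
    obtain ⟨N, hN⟩ := Metric.cauchySeq_iff'.1 (h.tendsto_partialSum v).cauchySeq (ε / (D + 1))
      (by positivity)
    refine ⟨N, fun M hM => ?_⟩
    have h1 := hN M hM
    rw [dist_eq_norm, lt_div_iff₀ (by positivity)] at h1
    rw [dist_eq_norm]
    have h2 := hdist N M hM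
    nlinarith [norm_nonneg (partialSum e φ box M v - partialSum e φ box N v)]
  obtain ⟨w, hw⟩ := cauchySeq_tendsto_of_complete hcau
  refine ⟨w, fun i => ?_, ?_⟩
  · refine tendsto_nhds_unique (((φ i).continuous.tendsto w).comp hw) ?_
    refine tendsto_const_nhds.congr' ?_
    obtain ⟨N, hN⟩ := h.box_exhaust i
    filter_upwards [eventually_ge_atTop N] with M hM
    simp only [Function.comp, hu]
    rw [h.apply_sum, if_pos (h.box_mono hM hN), mul_comm]
  · exact le_of_tendsto_of_tendsto' hw.norm ((h.tendsto_partialSum v).norm.const_mul D)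
      fun N => ha _ _

end Expansion

end Expansions

section DoubleExpansions

variable {E : Type*} [NormedAddCommGroup E] [NormedSpace ℂ E]

/-- A double trigonometric expansion with bounded half-plane projections and contractive
translations. -/
structure TrigExpansion (e : ℤ × ℤ → E) (φ : ℤ × ℤ → E →L[ℂ] ℂ) (box : ℕ → Finset (ℤ × ℤ))
    (C : ℝ) : Prop extends Expansion e φ box C where
  half_fst : HalfMul e Prod.fst C
  half_fst_neg : HalfMul e (fun i => -i.1) C
  half_snd : HalfMul e Prod.snd C
  half_snd_neg : HalfMul e (fun i => -i.2) C
  trans_fst : TransMul e Prod.fst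
  trans_snd : TransMul e Prod.snd

variable {e : ℤ × ℤ → E} {φ : ℤ × ℤ → E →L[ℂ] ℂ} {box : ℕ → Finset (ℤ × ℤ)} {C : ℝ}

/-- The symbol of the Weyl derivative of order `α`. -/
def weylSym (α : ℝ) (m : ℤ) : ℂ := (Complex.I * m) ^ (α : ℂ)

lemma weylSym_neg (α : ℝ) (m : ℤ) : weylSym α (-m) = (starRingEnd ℂ) (weylSym α m) := by
  unfold weylSym
  rcases eq_or_ne m 0 with rfl | hm
  · rcases eq_or_ne α 0 with rfl | hα
    · simp
    · simp [hα]
  · have hc : Complex.I * ((-m : ℤ) : ℂ) = (starRingEnd ℂ) (Complex.I * m) := by simp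
    have ha : (Complex.I * (m : ℂ)).arg ≠ π := fun h => by
      have := (Complex.arg_eq_pi_iff.1 h).1
      simp at this
    rw [hc, Complex.conj_cpow _ _ ha, Complex.conj_ofReal]

/-- The coefficients of `v` vanish on both axes. -/
def ZeroMean (φ : ℤ × ℤ → E →L[ℂ] ℂ) (v : E) : Prop := ∀ i : ℤ × ℤ, i.1 = 0 ∨ i.2 = 0 → φ i v = 0

/-- The coefficients of `v` arise from those of `u` by multiplication with a symbol that preserves
real functions. -/
def RealImage (φ : ℤ × ℤ → E →L[ℂ] ℂ) (u v : E) : Prop :=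
  ∃ b : ℤ × ℤ → ℂ, (∀ i, b (-i) = (starRingEnd ℂ) (b i)) ∧ ∀ i, φ i v = b i * φ i u

lemma ZeroMean.of_realImage {u v : E} (hu : ZeroMean φ u) (h : RealImage φ u v) :
    ZeroMean φ v := fun i hi => by
  obtain ⟨b, -, hb⟩ := h
  rw [hb, hu i hi, mul_zero]

lemma RealImage.conj {u v : E} (h : RealImage φ u v)
    (hu : ∀ i, φ (-i) u = (starRingEnd ℂ) (φ i u)) (i : ℤ × ℤ) :
    φ (-i) v = (starRingEnd ℂ) (φ i v) := by
  obtain ⟨b, hb, hv⟩ := h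
  rw [hv, hv, hu, hb, map_mul]

namespace TrigExpansion

lemma exists_norm_diff_le [CompleteSpace E] (H : TrigExpansion e φ box C) {α₁ α₂ : ℝ}
    (hα₁ : 0 < α₁) (hα₂ : 0 < α₂) : ∃ D : ℝ, 0 ≤ D ∧ ∀ (h₁ h₂ : ℝ) (r g₁ d₁ g₂ d₂ g d w : E),
      ZeroMean φ g₁ → ZeroMean φ g₂ → ZeroMean φ g →
      (∀ i, φ i d₁ = weylSym α₁ i.1 * φ i g₁) → (∀ i, φ i d₂ = weylSym α₂ i.2 * φ i g₂) →
      (∀ i, φ i d = weylSym α₁ i.1 * weylSym α₂ i.2 * φ i g) →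
      (∀ i, φ i w = diffSym α₁ h₁ i.1 * diffSym α₂ h₂ i.2 * φ i (r + g₁ + g₂ + g)) →
      ‖w‖ ≤ D * (‖r‖ + |h₁| ^ α₁ * ‖d₁‖ + |h₂| ^ α₂ * ‖d₂‖ + |h₁| ^ α₁ * |h₂| ^ α₂ * ‖d‖) := by
  obtain ⟨D₁, hD₁, hB₁⟩ := exists_bernstein e hα₁ H.nonneg
  obtain ⟨D₂, hD₂, hB₂⟩ := exists_bernstein e hα₂ H.nonneg
  have hE₁ := diffBound_nonneg α₁
  have hE₂ := diffBound_nonneg α₂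
  refine ⟨(diffBound α₁ + D₁) * (diffBound α₂ + D₂), by positivity, ?_⟩
  intro h₁ h₂ r g₁ d₁ g₂ d₂ g d w z₁ z₂ z e₁ e₂ e₃ hw
  obtain ⟨w₁, hw₁, hs₁⟩ := hB₁ _ H.half_fst H.half_fst_neg H.trans_fst h₁
  obtain ⟨w₂, hw₂, hs₂⟩ := hB₂ _ H.half_snd H.half_snd_neg H.trans_snd h₂
  have hd₁ := H.trans_fst.isMul_diffSym hα₁ h₁
  have hd₂ := H.trans_snd.isMul_diffSym hα₂ h₂
  have m₀₀ := hd₁.mul hE₁ hd₂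
  have m₁₀ := hw₁.mul hD₁ hd₂
  have m₀₁ := hd₁.mul hE₁ hw₂
  have m₁₁ := hw₁.mul hD₁ hw₂
  have hX := H.toExpansion
  obtain ⟨v₀, hv₀, n₀⟩ := hX.exists_apply m₀₀ (by positivity) r
  obtain ⟨v₁, hv₁, n₁⟩ := hX.exists_apply m₁₀ (by positivity) (((|h₁| ^ α₁ : ℝ) : ℂ) • d₁)
  obtain ⟨v₂, hv₂, n₂⟩ := hX.exists_apply m₀₁ (by positivity) (((|h₂| ^ α₂ : ℝ) : ℂ) • d₂)
  obtain ⟨v₃, hv₃, n₃⟩ := hX.exists_apply m₁₁ (by positivity)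
    (((|h₁| ^ α₁ * |h₂| ^ α₂ : ℝ) : ℂ) • d)
  have key : w = v₀ + v₁ + v₂ + v₃ := by
    refine hX.ext fun i => ?_
    rw [hw]
    simp only [map_add, hv₀, hv₁, hv₂, hv₃, map_smul, smul_eq_mul, e₁, e₂, e₃]
    rcases eq_or_ne i.1 0 with hi | hi
    · simp [z₁ i (.inl hi), z₂ i (.inl hi), z i (.inl hi)]
    rcases eq_or_ne i.2 0 with hj | hj
    · simp [z₁ i (.inr hj), z₂ i (.inr hj), z i (.inr hj)]
    have k₁ := hs₁ i hi
    have k₂ := hs₂ i hj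
    rw [← weylSym] at k₁ k₂
    rw [← k₁, ← k₂]
    push_cast
    ring
  rw [norm_smul, Complex.norm_real, Real.norm_of_nonneg (by positivity)] at n₁ n₂ n₃
  set x₁ := |h₁| ^ α₁ * ‖d₁‖
  set x₂ := |h₂| ^ α₂ * ‖d₂‖
  set x₃ := |h₁| ^ α₁ * |h₂| ^ α₂ * ‖d‖
  have p₁ : 0 ≤ x₁ := by positivity
  have p₂ : 0 ≤ x₂ := by positivity
  have p₃ : 0 ≤ x₃ := by positivity
  have p₀ := norm_nonneg r
  set K := (diffBound α₁ + D₁) * (diffBound α₂ + D₂)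
  have b₀ : diffBound α₁ * diffBound α₂ ≤ K :=
    mul_le_mul (by linarith) (by linarith) (by positivity) (by positivity)
  have b₁ : D₁ * diffBound α₂ ≤ K :=
    mul_le_mul (by linarith) (by linarith) (by positivity) (by positivity)
  have b₂ : diffBound α₁ * D₂ ≤ K :=
    mul_le_mul (by linarith) (by linarith) (by positivity) (by positivity)
  have b₃ : D₁ * D₂ ≤ K :=
    mul_le_mul (by linarith) (by linarith) (by positivity) (by positivity)
  have t := norm_add₄_le (a := v₀) (b := v₁) (c := v₂) (d := v₃)
  rw [key]
  have := mul_le_mul_of_nonneg_right b₀ p₀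
  have := mul_le_mul_of_nonneg_right b₁ p₁
  have := mul_le_mul_of_nonneg_right b₂ p₂
  have := mul_le_mul_of_nonneg_right b₃ p₃
  linarith

lemma exists_realization [CompleteSpace E] (H : TrigExpansion e φ box C) {α₁ α₂ : ℝ}
    (hα₁ : 0 < α₁) (hα₂ : 0 < α₂) : ∃ D : ℝ, 0 ≤ D ∧ ∀ (f : E) (t₁ t₂ M : ℝ), 0 < t₁ → 0 < t₂ →
      (∀ h₁ ∈ Set.Icc 0 t₁, ∀ h₂ ∈ Set.Icc 0 t₂, ∃ u,
        (∀ i, φ i u = diffSym α₁ h₁ i.1 * diffSym α₂ h₂ i.2 * φ i f) ∧ ‖u‖ ≤ M) →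
      ∃ g₁ d₁ g₂ d₂ g d : E, RealImage φ f g₁ ∧ RealImage φ f d₁ ∧ RealImage φ f g₂ ∧
        RealImage φ f d₂ ∧ RealImage φ f g ∧ RealImage φ f d ∧
        (∀ i, φ i d₁ = weylSym α₁ i.1 * φ i g₁) ∧ (∀ i, φ i d₂ = weylSym α₂ i.2 * φ i g₂) ∧
        (∀ i, φ i d = weylSym α₁ i.1 * weylSym α₂ i.2 * φ i g) ∧
        ‖f - g₁ - g₂ - g‖ ≤ D * M ∧ t₁ ^ α₁ * ‖d₁‖ ≤ D * M ∧ t₂ ^ α₂ * ‖d₂‖ ≤ D * M ∧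
        t₁ ^ α₁ * t₂ ^ α₂ * ‖d‖ ≤ D * M := by
  obtain ⟨D₁, hD₁, hJ₁⟩ := exists_jackson e hα₁ H.nonneg
  obtain ⟨D₂, hD₂, hJ₂⟩ := exists_jackson e hα₂ H.nonneg
  have hC := H.nonneg
  refine ⟨D₁ * D₂ * C, by positivity, fun f t₁ t₂ M ht₁ ht₂ hM => ?_⟩
  obtain ⟨a₁, ca₁, ma₁, mr₁, da₁, dr₁⟩ := hJ₁ _ H.half_fst H.half_fst_neg H.trans_fst t₁ ht₁
  obtain ⟨a₂, ca₂, ma₂, mr₂, da₂, dr₂⟩ := hJ₂ _ H.half_snd H.half_snd_neg H.trans_snd t₂ ht₂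
  have hT₁ : 0 < t₁ ^ α₁ := by positivity
  have hT₂ : 0 < t₂ ^ α₂ := by positivity
  have hX := H.toExpansion
  have q₁ := isMul_one.sub ma₁
  have q₂ := isMul_one.sub ma₂
  have cw : ∀ (α t : ℝ) (a : ℤ → ℂ), (∀ m, a (-m) = (starRingEnd ℂ) (a m)) → ∀ m : ℤ,
      (t : ℂ) * (Complex.I * (-m : ℤ)) ^ (α : ℂ) * a (-m) =
        (starRingEnd ℂ) ((t : ℂ) * (Complex.I * m) ^ (α : ℂ) * a m) := fun α t a ha m => by
    have := weylSym_neg α m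
    unfold weylSym at this
    rw [map_mul, map_mul, Complex.conj_ofReal, this, ha]
  have cr₁ := cw α₁ (t₁ ^ α₁) a₁ ca₁
  have cr₂ := cw α₂ (t₂ ^ α₂) a₂ ca₂
  obtain ⟨g₁, hg₁, -⟩ := hX.exists_apply (ma₁.mul hD₁ q₂) (by positivity) f
  obtain ⟨g₂, hg₂, -⟩ := hX.exists_apply (q₁.mul (by positivity) ma₂) (by positivity) f
  obtain ⟨g, hg, -⟩ := hX.exists_apply (ma₁.mul hD₁ ma₂) (by positivity) f
  obtain ⟨d₁, hd₁, -⟩ := hX.exists_apply (mr₁.mul hD₁ q₂) (by positivity) f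
  obtain ⟨d₂, hd₂, -⟩ := hX.exists_apply (q₁.mul (by positivity) mr₂) (by positivity) f
  obtain ⟨d, hd, -⟩ := hX.exists_apply (mr₁.mul hD₁ mr₂) (by positivity) f
  have hfam : ∀ b ∈ Set.image2 (fun (u v : ℤ × ℤ → ℂ) i => u i * v i)
      (diffFamily Prod.fst α₁ t₁) (diffFamily Prod.snd α₂ t₂),
      ∃ u, (∀ i, φ i u = b i * φ i f) ∧ ‖u‖ ≤ M := by
    rintro _ ⟨_, ⟨h₁, hh₁, rfl⟩, _, ⟨h₂, hh₂, rfl⟩, rfl⟩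
    exact hM h₁ hh₁ h₂ hh₂
  have n₀ := hX.norm_le_of_dom (v := f) (w := f - g₁ - g₂ - g) (da₁.mul da₂)
    (fun i => by simp only [map_sub, hg₁, hg₂, hg]; ring) hfam
  have n₁ := hX.norm_le_of_dom (v := f) (w := d₁) (dr₁.mul da₂) hd₁ hfam
  have n₂ := hX.norm_le_of_dom (v := f) (w := d₂) (da₁.mul dr₂) hd₂ hfam
  have n₃ := hX.norm_le_of_dom (v := f) (w := d) (dr₁.mul dr₂) hd hfam
  have sm : ∀ (T : ℝ) (x : E), 0 < T → T * ‖((T : ℂ)⁻¹ • x)‖ = ‖x‖ := fun T x hT => by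
    rw [norm_smul, norm_inv, Complex.norm_real, Real.norm_of_nonneg hT.le,
      mul_inv_cancel_left₀ hT.ne']
  have hT₁' : ((t₁ ^ α₁ : ℝ) : ℂ) ≠ 0 := by exact_mod_cast hT₁.ne'
  have hT₂' : ((t₂ ^ α₂ : ℝ) : ℂ) ≠ 0 := by exact_mod_cast hT₂.ne'
  refine ⟨g₁, ((t₁ ^ α₁ : ℝ) : ℂ)⁻¹ • d₁, g₂, ((t₂ ^ α₂ : ℝ) : ℂ)⁻¹ • d₂, g,
    ((t₁ ^ α₁ * t₂ ^ α₂ : ℝ) : ℂ)⁻¹ • d, ⟨_, fun i => ?_, hg₁⟩,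
    ⟨_, fun i => ?_, fun i => by rw [map_smul, hd₁, smul_eq_mul, ← mul_assoc]⟩, ⟨_, fun i => ?_, hg₂⟩,
    ⟨_, fun i => ?_, fun i => by rw [map_smul, hd₂, smul_eq_mul, ← mul_assoc]⟩, ⟨_, fun i => ?_, hg⟩,
    ⟨_, fun i => ?_, fun i => by rw [map_smul, hd, smul_eq_mul, ← mul_assoc]⟩,
    fun i => ?_, fun i => ?_, fun i => ?_, n₀, ?_, ?_, ?_⟩
  · simp [ca₁, ca₂]
  · simp only [Prod.fst_neg, Prod.snd_neg, cr₁, ca₂]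
    simp
  · simp [ca₁, ca₂]
  · simp only [Prod.fst_neg, Prod.snd_neg, cr₂, ca₁]
    simp
  · simp [ca₁, ca₂]
  · simp only [Prod.fst_neg, Prod.snd_neg, cr₁, cr₂]
    simp
  · rw [map_smul, smul_eq_mul, hd₁, hg₁, weylSym]
    field_simp
  · rw [map_smul, smul_eq_mul, hd₂, hg₂, weylSym]
    field_simp
  · rw [map_smul, smul_eq_mul, hd, hg, weylSym, weylSym, Complex.ofReal_mul]
    field_simp
  · rwa [sm _ _ hT₁]
  · rwa [sm _ _ hT₂]
  · rwa [sm _ _ (mul_pos hT₁ hT₂)]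

end TrigExpansion

end DoubleExpansions

section Torus

open AddCircle
open scoped NNReal

/-- The torus with periods `2π`. -/
abbrev Torus := Circ × Circ

/-- The normalized Haar measure on the torus. -/
abbrev torusHaar : Measure Torus := circHaar.prod circHaar

/-- The characters of the torus. -/
def ch (i : ℤ × ℤ) : C(Torus, ℂ) := ⟨fun z => fourier i.1 z.1 * fourier i.2 z.2, by fun_prop⟩

lemma ch_apply (i : ℤ × ℤ) (z : Torus) : ch i z = fourier i.1 z.1 * fourier i.2 z.2 := rfl

lemma ch_zero : ch 0 = 1 := by
  ext z
  simp [ch_apply]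

lemma ch_add (i j : ℤ × ℤ) : ch (i + j) = ch i * ch j := by
  ext z
  simp only [ch_apply, Prod.fst_add, Prod.snd_add, fourier_add, ContinuousMap.mul_apply]
  ring

lemma ch_neg (i : ℤ × ℤ) (z : Torus) : ch (-i) z = (starRingEnd ℂ) (ch i z) := by
  simp [ch_apply]

lemma norm_ch (i : ℤ × ℤ) (z : Torus) : ‖ch i z‖ = 1 := by
  simp [ch_apply, fourier_apply, Circle.norm_coe]

/-- The star subalgebra generated by the characters. -/
def chSubalgebra : StarSubalgebra ℂ C(Torus, ℂ) where
  toSubalgebra := Algebra.adjoin ℂ (Set.range ch)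
  star_mem' := by
    change Algebra.adjoin ℂ (Set.range ch) ≤ star (Algebra.adjoin ℂ (Set.range ch))
    refine Algebra.adjoin_le ?_
    rintro _ ⟨n, rfl⟩
    refine Algebra.subset_adjoin ⟨-n, ?_⟩
    ext1 x
    simp only [ch_neg, starRingEnd_apply, ContinuousMap.star_apply]

lemma chSubalgebra_coe :
    chSubalgebra.toSubalgebra.toSubmodule = Submodule.span ℂ (Set.range ch) := by
  apply Algebra.adjoin_eq_span_of_subset
  refine .trans (fun x ↦ Submonoid.closure_induction (fun _ ↦ id) ⟨0, ch_zero⟩ ?_)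
    Submodule.subset_span
  rintro _ _ _ _ ⟨m, rfl⟩ ⟨n, rfl⟩
  exact ⟨m + n, ch_add m n⟩

lemma chSubalgebra_separatesPoints : chSubalgebra.SeparatesPoints := by
  intro x y hxy
  have key : ∀ i : ℤ × ℤ, ch i x ≠ ch i y → ∃ f ∈ (fun (f : C(Torus, ℂ)) => (f : Torus → ℂ)) ''
      (chSubalgebra.toSubalgebra : Set C(Torus, ℂ)), f x ≠ f y := fun i hi =>
    ⟨_, ⟨ch i, Algebra.subset_adjoin ⟨i, rfl⟩, rfl⟩, hi⟩
  by_cases h : x.1 = y.1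
  · refine key (0, 1) fun h' => hxy (Prod.ext h ?_)
    simp only [ch_apply, fourier_zero, fourier_one, one_mul] at h'
    exact AddCircle.injective_toCircle two_pi_pos.ne' (Subtype.ext h')
  · refine key (1, 0) fun h' => h ?_
    simp only [ch_apply, fourier_zero, fourier_one, mul_one] at h'
    exact AddCircle.injective_toCircle two_pi_pos.ne' (Subtype.ext h')

lemma dense_span_ch : Dense (Submodule.span ℂ (Set.range ch) : Set C(Torus, ℂ)) := by
  have := ContinuousMap.starSubalgebra_topologicalClosure_eq_top_of_separatesPoints _
    chSubalgebra_separatesPoints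
  rw [← chSubalgebra_coe]
  rw [dense_iff_closure_eq]
  exact congrArg (fun s : StarSubalgebra ℂ C(Torus, ℂ) => (s : Set C(Torus, ℂ))) this

lemma integral_ch (i : ℤ × ℤ) : ∫ z, ch i z ∂torusHaar = if i = 0 then 1 else 0 := by
  simp only [ch_apply]
  rw [integral_prod_mul (μ := circHaar) (ν := circHaar) (fun x => fourier i.1 x)
    (fun x => fourier i.2 x)]
  have (n : ℤ) : ∫ x, fourier n x ∂circHaar = if n = 0 then 1 else 0 := by
    have h := congrFun (fourierCoeff_fourier (T := 2 * π) n) 0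
    rw [fourierCoeff] at h
    simpa [Pi.single_apply, eq_comm] using h
  rw [this, this]
  simp [Prod.ext_iff]
  grind

/-- The Fourier coefficients of a function on the torus. -/
def tc (F : Torus → ℂ) (i : ℤ × ℤ) : ℂ := ∫ z, ch (-i) z * F z ∂torusHaar

lemma integrable_ch_mul {F : Torus → ℂ} (hF : Integrable F torusHaar) (i : ℤ × ℤ) :
    Integrable (fun z => ch i z * F z) torusHaar :=
  hF.bdd_mul (c := 1) (ch i).continuous.aestronglyMeasurable
    (Filter.Eventually.of_forall fun z => (norm_ch i z).le)

lemma tc_congr {F G : Torus → ℂ} (h : F =ᵐ[torusHaar] G) (i : ℤ × ℤ) : tc F i = tc G i :=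
  integral_congr_ae (h.mono fun z hz => by simp only [hz])

lemma tc_add {F G : Torus → ℂ} (hF : Integrable F torusHaar) (hG : Integrable G torusHaar)
    (i : ℤ × ℤ) : tc (F + G) i = tc F i + tc G i := by
  simp only [tc, Pi.add_apply, mul_add]
  exact integral_add (integrable_ch_mul hF _) (integrable_ch_mul hG _)

lemma tc_const_smul (c : ℂ) (F : Torus → ℂ) (i : ℤ × ℤ) : tc (c • F) i = c * tc F i := by
  simp only [tc, Pi.smul_apply, smul_eq_mul, mul_left_comm _ c]
  exact integral_const_mul _ _

lemma norm_tc_le (F : Torus → ℂ) (i : ℤ × ℤ) : ‖tc F i‖ₑ ≤ eLpNorm F 1 torusHaar := by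
  refine (enorm_integral_le_lintegral_enorm _).trans_eq ?_
  rw [eLpNorm_one_eq_lintegral_enorm]
  refine lintegral_congr fun z => ?_
  rw [enorm_mul, ← ofReal_norm, norm_ch, ENNReal.ofReal_one, one_mul]

lemma tc_ch (i j : ℤ × ℤ) : tc (ch j) i = if i = j then 1 else 0 := by
  simp only [tc, ← ContinuousMap.mul_apply, ← ch_add, integral_ch]
  simp only [neg_add_eq_zero]

/-- The Lebesgue space of exponent `p` on the torus. -/
abbrev TLp (p : ℝ) := Lp ℂ (ENNReal.ofReal p) torusHaar

variable {p : ℝ} [hp1 : Fact (1 ≤ ENNReal.ofReal p)]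

/-- The characters as elements of the Lebesgue space. -/
def chLp (p : ℝ) [Fact (1 ≤ ENNReal.ofReal p)] (i : ℤ × ℤ) : TLp p :=
  ContinuousMap.toLp (ENNReal.ofReal p) torusHaar ℂ (ch i)

lemma memLp_tlp_integrable (F : TLp p) : Integrable F torusHaar :=
  (Lp.memLp F).integrable hp1.out

/-- The Fourier coefficients as functionals on the Lebesgue space. -/
def tcL (p : ℝ) [hp1 : Fact (1 ≤ ENNReal.ofReal p)] (i : ℤ × ℤ) : TLp p →L[ℂ] ℂ :=
  LinearMap.mkContinuous
    { toFun := fun F => tc F i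
      map_add' := fun F G => by
        rw [tc_congr (Lp.coeFn_add F G), tc_add (memLp_tlp_integrable F) (memLp_tlp_integrable G)]
      map_smul' := fun c F => by
        rw [tc_congr (Lp.coeFn_smul c F), tc_const_smul]
        rfl } 1 fun F => by
    have h := (norm_tc_le F i).trans (eLpNorm_le_eLpNorm_of_exponent_le hp1.out
      (Lp.aestronglyMeasurable F))
    rw [one_mul, Lp.norm_def, ← toReal_enorm]
    exact ENNReal.toReal_mono (Lp.eLpNorm_ne_top F) h

lemma tcL_apply (i : ℤ × ℤ) (F : TLp p) : tcL p i F = tc F i := rfl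

lemma tcL_chLp (i j : ℤ × ℤ) : tcL p i (chLp p j) = if i = j then 1 else 0 := by
  rw [tcL_apply, chLp, tc_congr (ContinuousMap.coeFn_toLp _ _), tc_ch]

lemma dense_span_chLp : Dense (Submodule.span ℂ (Set.range (chLp p)) : Set (TLp p)) := by
  have h := (ContinuousMap.toLp_denseRange (E := ℂ) (μ := torusHaar) (p := ENNReal.ofReal p) ℂ
    ENNReal.ofReal_ne_top).dense_image
    (ContinuousMap.toLp (ENNReal.ofReal p) torusHaar ℂ).continuous dense_span_ch
  have h2 : Set.range (chLp p) =
      (ContinuousMap.toLp (ENNReal.ofReal p) torusHaar ℂ).toLinearMap '' Set.range ch := by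
    rw [← Set.range_comp]
    rfl
  rw [h2, Submodule.span_image]
  exact h

lemma norm_sum_chLp (s : Finset (ℤ × ℤ)) (c : ℤ × ℤ → ℂ) :
    ‖∑ i ∈ s, c i • chLp p i‖ₑ =
      eLpNorm (fun z => ∑ i ∈ s, c i * ch i z) (ENNReal.ofReal p) torusHaar := by
  have : ∑ i ∈ s, c i • chLp p i = ContinuousMap.toLp (ENNReal.ofReal p) torusHaar ℂ
      (∑ i ∈ s, c i • ch i) := by
    simp [chLp]
  rw [this, Lp.enorm_def, eLpNorm_congr_ae (ContinuousMap.coeFn_toLp _ _)]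
  congr 1
  ext z
  simp

lemma isMul_chLp {C : ℝ≥0} {a : ℤ × ℤ → ℂ} (h : ∀ (s : Finset (ℤ × ℤ)) (c : ℤ × ℤ → ℂ),
    eLpNorm (fun z => ∑ i ∈ s, c i * a i * ch i z) (ENNReal.ofReal p) torusHaar ≤
      C * eLpNorm (fun z => ∑ i ∈ s, c i * ch i z) (ENNReal.ofReal p) torusHaar) :
    IsMul (chLp p) C a := fun s c => by
  have := h s c
  rw [← norm_sum_chLp, ← norm_sum_chLp] at this
  simpa [← toReal_enorm] using ENNReal.toReal_mono (by finiteness) this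

end Torus

section TorusMultipliers

open AddCircle
open scoped NNReal

/-- Translation on the torus. -/
lemma measurePreserving_translate (w : Torus) :
    MeasurePreserving (fun z : Torus => z + w) torusHaar torusHaar :=
  measurePreserving_add_right torusHaar w

lemma fourier_add_point (n : ℤ) (x y : Circ) : fourier n (x + y) = fourier n x * fourier n y := by
  simp [fourier_apply, smul_add, toCircle_add]

lemma ch_add_point (i : ℤ × ℤ) (z w : Torus) : ch i (z + w) = ch i z * ch i w := by
  simp only [ch_apply, Prod.fst_add, Prod.snd_add, fourier_add_point]
  ring

lemma ch_coe (i : ℤ × ℤ) (s t : ℝ) :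
    ch i ((s : Circ), (t : Circ)) = Complex.exp (Complex.I * (i.1 * s + i.2 * t)) := by
  rw [ch_apply, fourier_coe, fourier_coe, ← Complex.exp_add]
  push_cast
  ring_nf

section

variable {p : ℝ} [hp1 : Fact (1 ≤ ENNReal.ofReal p)]

lemma isMul_translate (w : Torus) : IsMul (chLp p) 1 fun i => ch i w := by
  rw [← NNReal.coe_one]
  refine isMul_chLp fun s c => ?_
  rw [ENNReal.coe_one, one_mul, ← eLpNorm_comp_measurePreserving
    (g := fun z => ∑ i ∈ s, c i * ch i z) (by fun_prop) (measurePreserving_translate w)]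
  refine le_of_eq (congrArg (eLpNorm · _ _) ?_)
  ext z
  refine Finset.sum_congr rfl fun i _ => ?_
  simp only [ch_add_point]
  ring

lemma transMul_fst : TransMul (chLp p) Prod.fst := fun s =>
  (isMul_translate ((s : Circ), ((0 : ℝ) : Circ))).congr fun i => by
    rw [ch_coe]
    simp [mul_comm, mul_assoc]

lemma transMul_snd : TransMul (chLp p) Prod.snd := fun s =>
  (isMul_translate (((0 : ℝ) : Circ), (s : Circ))).congr fun i => by
    rw [ch_coe]
    simp [mul_comm, mul_assoc]

end

lemma RieszBd.indexed {κ : Type*} {q : ℝ} {C : ℝ≥0} (h : RieszBd q C) (s : Finset κ) (f : κ → ℤ)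
    (c : κ → ℂ) : eLpNorm (fun x : Circ => ∑ i ∈ s, c i * sg (f i) * fourier (f i) x)
      (ENNReal.ofReal q) circHaar ≤
      C * eLpNorm (fun x : Circ => ∑ i ∈ s, c i * fourier (f i) x)
        (ENNReal.ofReal q) circHaar := by
  classical
  have h1 := h (s.image f) fun l => ∑ k ∈ s with f k = l, c k
  have hg : ∀ g : ℤ → ℂ, ∑ l ∈ s.image f, (∑ k ∈ s with f k = l, c k) * g l =
      ∑ k ∈ s, c k * g (f k) := fun g => by
    rw [← Finset.sum_fiberwise_of_maps_to (g := f)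
      (t := s.image f) fun k hk => Finset.mem_image_of_mem _ hk]
    refine Finset.sum_congr rfl fun l _ => ?_
    rw [Finset.sum_mul]
    refine Finset.sum_congr rfl fun k hk => ?_
    rw [(Finset.mem_filter.1 hk).2]
  simp only [mul_assoc _ (sg _), hg] at h1
  simpa only [mul_assoc _ (sg _)] using h1

lemma RieszBd.shift {κ : Type*} {q : ℝ} {C : ℝ≥0} (h : RieszBd q C) (s : Finset κ) (f : κ → ℤ)
    (c : κ → ℂ) (k : ℤ) :
    eLpNorm (fun x : Circ => ∑ i ∈ s, c i * sg (f i - k) * fourier (f i) x)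
      (ENNReal.ofReal q) circHaar ≤
      C * eLpNorm (fun x : Circ => ∑ i ∈ s, c i * fourier (f i) x)
        (ENNReal.ofReal q) circHaar := by
  have hn : ∀ (b : κ → ℂ), eLpNorm (fun x : Circ => ∑ i ∈ s, b i * fourier (f i) x)
      (ENNReal.ofReal q) circHaar = eLpNorm (fun x : Circ => ∑ i ∈ s, b i * fourier (f i - k) x)
      (ENNReal.ofReal q) circHaar := fun b => by
    refine eLpNorm_congr_norm_ae (Filter.Eventually.of_forall fun x => ?_)
    have : ∑ i ∈ s, b i * fourier (f i) x = (∑ i ∈ s, b i * fourier (f i - k) x) * fourier k x := by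
      rw [Finset.sum_mul]
      refine Finset.sum_congr rfl fun i _ => ?_
      rw [mul_assoc, ← fourier_add, sub_add_cancel]
    have hk : ‖fourier k x‖ = 1 := by simp [fourier_apply, Circle.norm_coe]
    rw [this, norm_mul, hk, mul_one]
  rw [hn, hn]
  exact h.indexed s (fun i => f i - k) c

lemma eLpNorm_torus_rpow {q : ℝ} (hq : 0 < q) {F : Torus → ℂ}
    (hF : AEStronglyMeasurable F torusHaar) :
    eLpNorm F (ENNReal.ofReal q) torusHaar =
      (∫⁻ x, ∫⁻ y, ‖F (x, y)‖ₑ ^ q ∂circHaar ∂circHaar) ^ (1 / q) := by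
  rw [eLpNorm_eq_lintegral_rpow_enorm_toReal (by simpa using hq) ENNReal.ofReal_ne_top,
    ENNReal.toReal_ofReal hq.le, lintegral_prod]
  exact hF.enorm.pow_const _

lemma eLpNorm_circ_rpow {q : ℝ} (hq : 0 < q) (g : Circ → ℂ) :
    ∫⁻ x, ‖g x‖ₑ ^ q ∂circHaar = eLpNorm g (ENNReal.ofReal q) circHaar ^ q := by
  rw [eLpNorm_eq_lintegral_rpow_enorm_toReal (by simpa using hq) ENNReal.ofReal_ne_top,
    ENNReal.toReal_ofReal hq.le, ← ENNReal.rpow_mul, one_div_mul_cancel hq.ne', ENNReal.rpow_one]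

lemma eLpNorm_torus_le_of_slice {q : ℝ} (hq : 0 < q) {F G : Torus → ℂ} {C : ℝ≥0}
    (hF : Continuous F) (hG : Continuous G)
    (h : ∀ x, eLpNorm (fun y => F (x, y)) (ENNReal.ofReal q) circHaar ≤
      C * eLpNorm (fun y => G (x, y)) (ENNReal.ofReal q) circHaar) :
    eLpNorm F (ENNReal.ofReal q) torusHaar ≤ C * eLpNorm G (ENNReal.ofReal q) torusHaar := by
  rw [eLpNorm_torus_rpow hq hF.aestronglyMeasurable, eLpNorm_torus_rpow hq hG.aestronglyMeasurable]
  have hC : (C : ℝ≥0∞) = ((C : ℝ≥0∞) ^ q) ^ (1 / q) := by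
    rw [← ENNReal.rpow_mul, mul_one_div_cancel hq.ne', ENNReal.rpow_one]
  rw [hC, ← ENNReal.mul_rpow_of_nonneg _ _ (by positivity : 0 ≤ 1 / q),
    ← lintegral_const_mul' _ _ (by finiteness)]
  gcongr with x
  rw [eLpNorm_circ_rpow hq, eLpNorm_circ_rpow hq, ← ENNReal.mul_rpow_of_nonneg _ _ hq.le]
  gcongr
  exact h x

lemma eLpNorm_torus_swap {q : ℝ} {F : Torus → ℂ} (hF : Continuous F) :
    eLpNorm (fun z : Torus => F z.swap) (ENNReal.ofReal q) torusHaar =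
      eLpNorm F (ENNReal.ofReal q) torusHaar :=
  eLpNorm_comp_measurePreserving hF.aestronglyMeasurable Measure.measurePreserving_swap

section

variable {p : ℝ} [hp1 : Fact (1 ≤ ENNReal.ofReal p)] {K : ℝ≥0}

lemma RieszBd.isMul_snd (hp : 0 < p) (h : RieszBd p K) (k : ℤ) :
    IsMul (chLp p) K fun i => sg (i.2 - k) := by
  refine isMul_chLp fun s c => ?_
  refine eLpNorm_torus_le_of_slice hp (by fun_prop) (by fun_prop) fun x => ?_
  have := h.shift s Prod.snd (fun i => c i * fourier i.1 x) k
  simpa only [ch_apply, mul_assoc, mul_left_comm (fourier _ x)] using this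

lemma RieszBd.isMul_fst (hp : 0 < p) (h : RieszBd p K) (k : ℤ) :
    IsMul (chLp p) K fun i => sg (i.1 - k) := by
  refine isMul_chLp fun s c => ?_
  rw [← eLpNorm_torus_swap (by fun_prop),
    ← eLpNorm_torus_swap (F := fun z => ∑ i ∈ s, c i * ch i z) (by fun_prop)]
  refine eLpNorm_torus_le_of_slice hp (by fun_prop) (by fun_prop) fun x => ?_
  have := h.shift s Prod.fst (fun i => c i * fourier i.2 x) k
  simpa only [ch_apply, Prod.swap, mul_assoc, mul_comm (fourier _ x)] using this

lemma halfMul_of_sg {ι E : Type*} [NormedAddCommGroup E] [NormedSpace ℂ E] {e : ι → E} {f : ι → ℤ}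
    {K : ℝ} (hK : 0 ≤ K) (h : ∀ k, IsMul e K fun i => sg (f i - k)) : HalfMul e f (1 + K) := by
  intro k
  refine (((isMul_one.add (h k)).const_mul (1 / 2)).mono ?_).congr fun i => ?_
  · norm_num
    linarith
  · unfold sg
    by_cases hk : k ≤ f i
    · rw [if_pos hk, if_pos (by omega)]
      norm_num
    · rw [if_neg hk, if_neg (by omega)]
      norm_num

/-- The symmetric squares of frequencies. -/
def freqBox (N : ℕ) : Finset (ℤ × ℤ) := Finset.Icc (-N : ℤ) N ×ˢ Finset.Icc (-N : ℤ) N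

lemma exists_trigExpansion (hp : 1 < p) : ∃ C, TrigExpansion (chLp p) (tcL p) freqBox C := by
  obtain ⟨K, hK⟩ := exists_rieszBd hp
  have hp0 : 0 < p := by linarith
  have hK0 : (0 : ℝ) ≤ K := K.2
  have h1 := halfMul_of_sg hK0 (hK.isMul_fst hp0)
  have h2 := halfMul_of_sg hK0 (hK.isMul_snd hp0)
  set c : ℝ := 1 + (1 + K) with hc
  have hc1 : 1 ≤ c := by linarith
  have n1 := h1.neg
  have n2 := h2.neg
  replace h1 := h1.mono (by linarith : 1 + (K : ℝ) ≤ c)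
  replace h2 := h2.mono (by linarith : 1 + (K : ℝ) ≤ c)
  have hcc : c ≤ c * c * (c * c) := by
    have : c * 1 ≤ c * c := by gcongr
    nlinarith
  refine ⟨c * c * (c * c), ⟨dense_span_chLp, fun i => by simp [tcL_chLp],
    fun i j hij => by simp [tcL_chLp, hij], fun M N hMN i hi => ?_, fun i => ?_, by positivity,
    fun N => ?_⟩, h1.mono hcc, n1.mono hcc, h2.mono hcc, n2.mono hcc, transMul_fst, transMul_snd⟩
  · simp only [freqBox, Finset.mem_product, Finset.mem_Icc] at hi ⊢
    omega
  · refine ⟨i.1.natAbs + i.2.natAbs, ?_⟩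
    simp only [freqBox, Finset.mem_product, Finset.mem_Icc]
    omega
  · refine ((((h1 (-N)).mul (by positivity) (n1 (-N))).mul (by positivity)
      ((h2 (-N)).mul (by positivity) (n2 (-N)))).congr fun i => ?_)
    rw [Set.indicator_apply]
    simp only [freqBox, Finset.mem_coe, Finset.mem_product, Finset.mem_Icc, neg_le_neg_iff,
      Pi.one_apply]
    split_ifs <;> simp <;> omega

end

end TorusMultipliers

section Lift

open AddCircle

/-- Periodicity in each variable. -/
structure Periodic2 (f : ℝ → ℝ → ℝ) : Prop where
  fst : ∀ y, Function.Periodic (fun x => f x y) (2 * π)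
  snd : ∀ x, Function.Periodic (f x) (2 * π)

lemma _root_.MemLp0.periodic2 {p : ℝ} {f : ℝ → ℝ → ℝ} (h : MemLp0 p f) : Periodic2 f :=
  ⟨h.periodic_x, h.periodic_y⟩

/-- The representative of a point of the circle in the fundamental interval. -/
def rep (x : Circ) : ℝ := equivIoc (2 * π) 0 x

lemma coe_rep (x : Circ) : (rep x : Circ) = x := coe_equivIoc

lemma measurable_rep : Measurable rep :=
  measurable_subtype_coe.comp (measurableEquivIoc (2 * π) 0).measurable

lemma _root_.Function.Periodic.apply_rep {β : Type*} {g : ℝ → β} (hg : Function.Periodic g (2 * π))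
    (x : ℝ) : g (rep (x : Circ)) = g x := by
  have : rep (x : Circ) = toIocMod two_pi_pos 0 x := rfl
  rw [this, toIocMod]
  exact hg.sub_zsmul_eq _

/-- The function on the torus corresponding to a periodic function of two variables. -/
def lift (f : ℝ → ℝ → ℝ) (z : Torus) : ℂ := (f (rep z.1) (rep z.2) : ℂ)

lemma Periodic2.lift_coe {f : ℝ → ℝ → ℝ} (hf : Periodic2 f) (x y : ℝ) :
    lift f ((x : Circ), (y : Circ)) = f x y := by
  rw [lift, (hf.fst _).apply_rep, (hf.snd _).apply_rep]

lemma measurable_lift {f : ℝ → ℝ → ℝ} (hf : Measurable (Function.uncurry f)) :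
    Measurable (lift f) :=
  Complex.measurable_ofReal.comp
    (hf.comp ((measurable_rep.comp measurable_fst).prodMk (measurable_rep.comp measurable_snd)))

lemma conj_lift (f : ℝ → ℝ → ℝ) (z : Torus) : (starRingEnd ℂ) (lift f z) = lift f z :=
  Complex.conj_ofReal _

lemma lintegral_Ioc_coe (g : Circ → ℝ≥0∞) :
    ∫⁻ x in Set.Ioc (0 : ℝ) (2 * π), g x = ENNReal.ofReal (2 * π) * ∫⁻ x, g x ∂circHaar := by
  have := AddCircle.lintegral_preimage (2 * π) 0 g
  rw [zero_add] at this
  rw [this, volume_eq_smul_haarAddCircle, lintegral_smul_measure, smul_eq_mul]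

lemma intervalIntegral_coe (g : Circ → ℂ) :
    ∫ x in (0 : ℝ)..(2 * π), g x = (2 * π : ℝ) * ∫ x, g x ∂circHaar := by
  have := AddCircle.intervalIntegral_preimage (2 * π) 0 g
  rw [zero_add] at this
  rw [this, integral_haarAddCircle, Complex.real_smul, ← mul_assoc, ← Complex.ofReal_mul,
    mul_inv_cancel₀ two_pi_pos.ne', Complex.ofReal_one, one_mul]

/-- The ratio of the norms with respect to Lebesgue measure and normalized Haar measure. -/
def normRatio (p : ℝ) : ℝ≥0∞ := (ENNReal.ofReal (2 * π) * ENNReal.ofReal (2 * π)) ^ (1 / p)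

lemma normRatio_ne_zero {p : ℝ} : normRatio p ≠ 0 := by
  have : 0 < normRatio p := ENNReal.rpow_pos (by simp [pi_pos]) (by finiteness)
  exact this.ne'

lemma normRatio_ne_top {p : ℝ} (hp : 0 < p) : normRatio p ≠ ⊤ := by
  rw [normRatio]
  have : 0 ≤ 1 / p := by positivity
  finiteness

lemma Periodic2.lp2Norm_eq {p : ℝ} (hp : 0 < p) {f : ℝ → ℝ → ℝ} (hf : Periodic2 f)
    (hm : AEStronglyMeasurable (lift f) torusHaar) :
    Lp2Norm p f = normRatio p * eLpNorm (lift f) (ENNReal.ofReal p) torusHaar := by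
  have h1 : ∀ x y : ℝ, ENNReal.ofReal (|f x y| ^ p) = ‖lift f ((x : Circ), (y : Circ))‖ₑ ^ p := by
    intro x y
    rw [hf.lift_coe, ← ofReal_norm, Complex.norm_real, norm_eq_abs,
      ENNReal.ofReal_rpow_of_nonneg (abs_nonneg _) hp.le]
  rw [eLpNorm_torus_rpow hp hm, Lp2Norm, normRatio,
    ← ENNReal.mul_rpow_of_nonneg _ _ (by positivity)]
  simp only [h1]
  congr 1
  have h2 : ∀ x : ℝ, ∫⁻ y in Set.Ioc (0 : ℝ) (2 * π), ‖lift f ((x : Circ), (y : Circ))‖ₑ ^ p =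
      ENNReal.ofReal (2 * π) * ∫⁻ y, ‖lift f ((x : Circ), y)‖ₑ ^ p ∂circHaar := fun x =>
    lintegral_Ioc_coe fun y => ‖lift f ((x : Circ), y)‖ₑ ^ p
  simp only [h2]
  rw [lintegral_Ioc_coe fun x => ENNReal.ofReal (2 * π) * ∫⁻ y, ‖lift f (x, y)‖ₑ ^ p ∂circHaar,
    lintegral_const_mul' _ _ (by finiteness), mul_assoc]

lemma Periodic2.fourierCoefZ_eq {f : ℝ → ℝ → ℝ} (hf : Periodic2 f)
    (hi : Integrable (lift f) torusHaar) (i : ℤ × ℤ) :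
    fourierCoefZ f i.1 i.2 = tc (lift f) i := by
  have h1 : ∀ x y : ℝ, (f x y : ℂ) * Complex.exp (-Complex.I * ((i.1 : ℂ) * (x : ℂ) +
      (i.2 : ℂ) * (y : ℂ))) = ch (-i) ((x : Circ), (y : Circ)) *
        lift f ((x : Circ), (y : Circ)) := by
    intro x y
    rw [hf.lift_coe, ch_coe, mul_comm]
    congr 2
    simp only [Prod.fst_neg, Prod.snd_neg]
    push_cast
    ring
  rw [fourierCoefZ]
  simp only [h1]
  have h2 : ∀ x : ℝ, ∫ y in (0 : ℝ)..(2 * π), ch (-i) ((x : Circ), (y : Circ)) *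
      lift f ((x : Circ), (y : Circ)) = ((2 * π : ℝ) : ℂ) *
        ∫ y, ch (-i) ((x : Circ), y) * lift f ((x : Circ), y) ∂circHaar := fun x =>
    intervalIntegral_coe fun y => ch (-i) ((x : Circ), y) * lift f ((x : Circ), y)
  simp only [h2]
  rw [intervalIntegral_coe fun x => ((2 * π : ℝ) : ℂ) *
    ∫ y, ch (-i) (x, y) * lift f (x, y) ∂circHaar, integral_const_mul, tc,
    integral_prod _ (integrable_ch_mul hi _)]
  have : ((2 * π : ℝ) : ℂ) ≠ 0 := Complex.ofReal_ne_zero.2 two_pi_pos.ne'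
  push_cast at this ⊢
  field_simp

end Lift

section Differences

open Filter

variable {p : ℝ} {f g : ℝ → ℝ → ℝ} {F G : TLp p}

/-- Translation of functions on the torus. -/
def translate (w : Torus) (F : TLp p) : TLp p :=
  Lp.compMeasurePreserving _ (measurePreserving_translate w) F

lemma coeFn_translate (w : Torus) (F : TLp p) :
    translate w F =ᵐ[torusHaar] fun z => F (z + w) :=
  Lp.coeFn_compMeasurePreserving _ _

lemma norm_translate (w : Torus) (F : TLp p) : ‖translate w F‖ = ‖F‖ :=
  Lp.norm_compMeasurePreserving _ _

/-- The periodic function `f` represents the element `F` of the Lebesgue space on the torus. -/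
structure Represents (f : ℝ → ℝ → ℝ) (F : TLp p) : Prop where
  periodic2 : Periodic2 f
  ae : lift f =ᵐ[torusHaar] F

lemma Represents.sub (hf : Represents f F) (hg : Represents g G) :
    Represents (fun x y => f x y - g x y) (F - G) := by
  refine ⟨⟨fun y x => ?_, fun x y => ?_⟩, ?_⟩
  · have h1 := hf.periodic2.fst y x
    have h2 := hg.periodic2.fst y x
    simp only at h1 h2 ⊢
    rw [h1, h2]
  · simp only [hf.periodic2.snd x y, hg.periodic2.snd x y]
  · filter_upwards [hf.ae, hg.ae, Lp.coeFn_sub F G] with z h1 h2 h3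
    rw [h3, Pi.sub_apply, ← h1, ← h2, lift, lift, lift, Complex.ofReal_sub]

lemma Represents.ae_translate (h : Represents f F) (w : Torus) :
    ∀ᵐ z ∂torusHaar, lift f (z + w) = F (z + w) :=
  (measurePreserving_translate w).quasiMeasurePreserving.ae h.ae

variable [hp1 : Fact (1 ≤ ENNReal.ofReal p)]

lemma tcL_translate (w : Torus) (F : TLp p) (i : ℤ × ℤ) :
    tcL p i (translate w F) = ch i w * tcL p i F := by
  rw [tcL_apply, tcL_apply, tc_congr (coeFn_translate w F), tc, tc,
    ← integral_add_right_eq_self (μ := torusHaar) (fun z => ch (-i) z * F z) w,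
    ← integral_const_mul]
  refine integral_congr_ae (Eventually.of_forall fun z => ?_)
  have : ch i w * ch (-i) w = 1 := by
    rw [← ContinuousMap.mul_apply, ← ch_add, add_neg_cancel, ch_zero, ContinuousMap.one_apply]
  simp only [ch_add_point]
  linear_combination -(ch (-i) z * F (z + w)) * this

lemma exists_diff {α : ℝ} (hα : 0 < α) (w : ℕ → Torus) (F : TLp p) :
    ∃ G : TLp p, (G =ᵐ[torusHaar] fun z => ∑' ν, (diffCoef α ν : ℂ) * F (z + w ν)) ∧
      ∀ i, HasSum (fun ν => (diffCoef α ν : ℂ) * (ch i (w ν) * tcL p i F)) (tcL p i G) := by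
  have hs : Summable fun ν => ‖(diffCoef α ν : ℂ) • translate (w ν) F‖ := by
    simp only [norm_smul, norm_translate, Complex.norm_real, norm_eq_abs]
    exact (summable_abs_diffCoef hα).mul_right _
  refine ⟨∑' ν, (diffCoef α ν : ℂ) • translate (w ν) F, ?_, fun i => ?_⟩
  · have h1 : ∀ᵐ z ∂torusHaar, ∀ ν, ((diffCoef α ν : ℂ) • translate (w ν) F : TLp p) z =
        (diffCoef α ν : ℂ) * F (z + w ν) := ae_all_iff.2 fun ν => by
      filter_upwards [Lp.coeFn_smul (diffCoef α ν : ℂ) (translate (w ν) F),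
        coeFn_translate (w ν) F] with z h1 h2
      rw [h1, Pi.smul_apply, h2, smul_eq_mul]
    filter_upwards [Lp.coeFn_tsum (tsum_enorm_ne_top_iff_summable_norm.2 hs), h1] with z h2 h3
    rw [h2]
    exact tsum_congr h3
  · simpa [tcL_translate] using hs.of_norm.hasSum.mapL (tcL p i)

namespace Represents

lemma lp2Norm (hp : 0 < p) (h : Represents f F) : Lp2Norm p f = normRatio p * ‖F‖ₑ := by
  rw [h.periodic2.lp2Norm_eq hp ((Lp.aestronglyMeasurable F).congr h.ae.symm), Lp.enorm_def,
    eLpNorm_congr_ae h.ae]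

lemma fourierCoefZ (h : Represents f F) (i : ℤ × ℤ) : fourierCoefZ f i.1 i.2 = tcL p i F := by
  rw [h.periodic2.fourierCoefZ_eq ((memLp_tlp_integrable F).congr h.ae.symm), tc_congr h.ae,
    tcL_apply]

lemma exists_diffX (hf : Represents f F) {α : ℝ} (hα : 0 < α) (h : ℝ) :
    ∃ G : TLp p, Represents (diffX α h f) G ∧
      ∀ i, tcL p i G =
        ch i (((α * h : ℝ) : Circ), ((0 : ℝ) : Circ)) * diffSym α h i.1 * tcL p i F := by
  obtain ⟨G, hG, hc⟩ := exists_diff hα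
    (fun ν : ℕ => ((((α - ν) * h : ℝ) : Circ), ((0 : ℝ) : Circ))) F
  refine ⟨G, ⟨⟨fun y x => ?_, fun x y => ?_⟩, ?_⟩, fun i => (hc i).unique ?_⟩
  · refine tsum_congr fun ν => ?_
    have := hf.periodic2.fst y (x + (α - ν) * h)
    simp only at this
    rw [← this]
    ring_nf
  · exact tsum_congr fun ν => by rw [hf.periodic2.snd]
  · filter_upwards [hG, ae_all_iff.2 fun ν : ℕ =>
      hf.ae_translate ((((α - ν) * h : ℝ) : Circ), ((0 : ℝ) : Circ))] with z h1 h2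
    rw [h1, lift, diffX, Complex.ofReal_tsum]
    refine tsum_congr fun ν => ?_
    rw [← h2 ν, Complex.ofReal_mul, ← hf.periodic2.lift_coe, diffCoef, AddCircle.coe_add, coe_rep,
      coe_rep, ← add_zero z.2]
    rfl
  · refine (((hasSum_diffSym hα h i.1).mul_left
        (ch i (((α * h : ℝ) : Circ), ((0 : ℝ) : Circ)))).mul_right (tcL p i F)).congr_fun fun ν => ?_
    have : ch i ((((α - ν) * h : ℝ) : Circ), ((0 : ℝ) : Circ)) =
        ch i (((α * h : ℝ) : Circ), ((0 : ℝ) : Circ)) *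
          Complex.exp (Complex.I * (-(ν * h) : ℝ) * i.1) := by
      rw [ch_coe, ch_coe, ← Complex.exp_add]
      push_cast
      ring_nf
    rw [this]
    ring

lemma exists_diffY (hf : Represents f F) {α : ℝ} (hα : 0 < α) (h : ℝ) :
    ∃ G : TLp p, Represents (diffY α h f) G ∧
      ∀ i, tcL p i G =
        ch i (((0 : ℝ) : Circ), ((α * h : ℝ) : Circ)) * diffSym α h i.2 * tcL p i F := by
  obtain ⟨G, hG, hc⟩ := exists_diff hα
    (fun ν : ℕ => (((0 : ℝ) : Circ), (((α - ν) * h : ℝ) : Circ))) F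
  refine ⟨G, ⟨⟨fun y x => ?_, fun x y => ?_⟩, ?_⟩, fun i => (hc i).unique ?_⟩
  · refine tsum_congr fun ν => ?_
    have := hf.periodic2.fst (y + (α - ν) * h) x
    simp only at this
    rw [this]
  · refine tsum_congr fun ν => ?_
    rw [← hf.periodic2.snd x (y + (α - ν) * h)]
    ring_nf
  · filter_upwards [hG, ae_all_iff.2 fun ν : ℕ =>
      hf.ae_translate (((0 : ℝ) : Circ), (((α - ν) * h : ℝ) : Circ))] with z h1 h2
    rw [h1, lift, diffY, Complex.ofReal_tsum]
    refine tsum_congr fun ν => ?_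
    rw [← h2 ν, Complex.ofReal_mul, ← hf.periodic2.lift_coe, diffCoef, AddCircle.coe_add, coe_rep,
      coe_rep, ← add_zero z.1]
    rfl
  · refine (((hasSum_diffSym hα h i.2).mul_left
        (ch i (((0 : ℝ) : Circ), ((α * h : ℝ) : Circ)))).mul_right (tcL p i F)).congr_fun fun ν => ?_
    have : ch i (((0 : ℝ) : Circ), (((α - ν) * h : ℝ) : Circ)) =
        ch i (((0 : ℝ) : Circ), ((α * h : ℝ) : Circ)) *
          Complex.exp (Complex.I * (-(ν * h) : ℝ) * i.2) := by
      rw [ch_coe, ch_coe, ← Complex.exp_add]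
      push_cast
      ring_nf
    rw [this]
    ring

lemma exists_diff_diff (hp : 0 < p) (hf : Represents f F) {α₁ α₂ : ℝ} (hα₁ : 0 < α₁)
    (hα₂ : 0 < α₂) (h₁ h₂ : ℝ) : ∃ G : TLp p,
      Lp2Norm p (diffX α₁ h₁ (diffY α₂ h₂ f)) = normRatio p * ‖G‖ₑ ∧
      ∀ i, tcL p i G = diffSym α₁ h₁ i.1 * diffSym α₂ h₂ i.2 * tcL p i F := by
  obtain ⟨F₂, hF₂, e₂⟩ := hf.exists_diffY hα₂ h₂
  obtain ⟨F₁, hF₁, e₁⟩ := hF₂.exists_diffX hα₁ h₁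
  refine ⟨translate (-(((α₁ * h₁ : ℝ) : Circ), ((α₂ * h₂ : ℝ) : Circ))) F₁, ?_, fun i => ?_⟩
  · rw [hF₁.lp2Norm hp, ← ofReal_norm, ← ofReal_norm, norm_translate]
  · rw [tcL_translate, e₁, e₂]
    have h : ch i (-(((α₁ * h₁ : ℝ) : Circ), ((α₂ * h₂ : ℝ) : Circ))) *
        ch i (((α₁ * h₁ : ℝ) : Circ), ((0 : ℝ) : Circ)) *
        ch i (((0 : ℝ) : Circ), ((α₂ * h₂ : ℝ) : Circ)) = 1 := by
      rw [Prod.neg_mk, ← AddCircle.coe_neg, ← AddCircle.coe_neg, ch_coe, ch_coe, ch_coe,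
        ← Complex.exp_add, ← Complex.exp_add, ← Complex.exp_zero]
      push_cast
      ring_nf
    linear_combination (diffSym α₁ h₁ i.1 * diffSym α₂ h₂ i.2 * tcL p i F) * h

end Represents

end Differences

section MeanZero

open AddCircle Filter

lemma ae_circ_volume : ae (volume : Measure Circ) = ae circHaar := by
  rw [volume_eq_smul_haarAddCircle]
  exact Measure.ae_ennreal_smul_measure_eq (by simp [pi_pos]) _

lemma ae_coe_of_ae {P : Circ → Prop} (h : ∀ᵐ x ∂circHaar, P x) : ∀ᵐ t : ℝ, P t := by
  rw [← ae_circ_volume] at h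
  rw [← Measure.restrict_univ (μ := (volume : Measure ℝ)), ← iUnion_Ioc_zsmul two_pi_pos,
    ae_restrict_iUnion_iff]
  intro n
  rw [add_one_zsmul]
  exact (AddCircle.measurePreserving_mk (2 * π) (n • (2 * π))).quasiMeasurePreserving.ae h

lemma ae_of_ae_coe {P : Circ → Prop} (hP : MeasurableSet {x | P x}) (h : ∀ᵐ t : ℝ, P t) :
    ∀ᵐ x ∂circHaar, P x := by
  have hm := AddCircle.measurePreserving_mk (2 * π) 0
  rw [← ae_circ_volume, ← hm.map_eq, ae_map_iff hm.measurable.aemeasurable hP]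
  exact ae_restrict_of_ae h

lemma Periodic2.integral_fst_eq_zero_iff {f : ℝ → ℝ → ℝ} (hf : Periodic2 f) (y : ℝ) :
    ∫ x in (0 : ℝ)..(2 * π), f x y = 0 ↔ ∫ x, lift f (x, (y : Circ)) ∂circHaar = 0 := by
  have h := intervalIntegral_coe fun x => lift f (x, (y : Circ))
  simp only [hf.lift_coe, intervalIntegral.integral_ofReal] at h
  rw [← Complex.ofReal_eq_zero, h, mul_eq_zero, Complex.ofReal_eq_zero]
  simp [pi_ne_zero]

lemma Periodic2.integral_snd_eq_zero_iff {f : ℝ → ℝ → ℝ} (hf : Periodic2 f) (x : ℝ) :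
    ∫ y in (0 : ℝ)..(2 * π), f x y = 0 ↔ ∫ y, lift f ((x : Circ), y) ∂circHaar = 0 := by
  have h := intervalIntegral_coe fun y => lift f ((x : Circ), y)
  simp only [hf.lift_coe, intervalIntegral.integral_ofReal] at h
  rw [← Complex.ofReal_eq_zero, h, mul_eq_zero, Complex.ofReal_eq_zero]
  simp [pi_ne_zero]

lemma tc_of_fst_eq_zero {L : Torus → ℂ} (hL : Integrable L torusHaar) {i : ℤ × ℤ} (hi : i.1 = 0) :
    tc L i = ∫ y, fourier (-i.2) y * ∫ x, L (x, y) ∂circHaar ∂circHaar := by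
  rw [tc, integral_prod_symm _ (integrable_ch_mul hL _)]
  simp only [ch_apply, Prod.fst_neg, Prod.snd_neg, hi, neg_zero, fourier_zero, one_mul,
    integral_const_mul]

lemma tc_of_snd_eq_zero {L : Torus → ℂ} (hL : Integrable L torusHaar) {i : ℤ × ℤ} (hi : i.2 = 0) :
    tc L i = ∫ x, fourier (-i.1) x * ∫ y, L (x, y) ∂circHaar ∂circHaar := by
  rw [tc, integral_prod _ (integrable_ch_mul hL _)]
  simp only [ch_apply, Prod.fst_neg, Prod.snd_neg, hi, neg_zero, fourier_zero, mul_one,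
    integral_const_mul]

lemma tc_swap (L : Torus → ℂ) (i : ℤ × ℤ) : tc (fun z => L z.swap) i = tc L i.swap := by
  rw [tc, tc, ← integral_prod_swap]
  refine integral_congr_ae (Eventually.of_forall fun z => ?_)
  simp only [ch_apply, Prod.fst_neg, Prod.snd_neg, Prod.swap, mul_comm (fourier (-i.1) _)]

variable {p : ℝ}

lemma integral_slice_ae_eq_zero (hp : 1 < p) {L : Torus → ℂ} (hm : StronglyMeasurable L)
    (hL : MemLp L (ENNReal.ofReal p) torusHaar) (h0 : ∀ i : ℤ × ℤ, i.1 = 0 → tc L i = 0) :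
    ∀ᵐ y ∂circHaar, ∫ x, L (x, y) ∂circHaar = 0 := by
  have hp0 : 0 < p := by linarith
  have : Fact (1 ≤ ENNReal.ofReal p) := ⟨ENNReal.one_le_ofReal.2 hp.le⟩
  obtain ⟨C, hC⟩ := exists_trigExpansion hp
  set k : Circ → ℂ := fun y => ∫ x, L (x, y) ∂circHaar with hk
  have hks : StronglyMeasurable k := hm.integral_prod_left'
  have hHs : AEStronglyMeasurable (fun z : Torus => k z.2) torusHaar :=
    (hks.comp_measurable measurable_snd).aestronglyMeasurable
  have hkb : ∀ y, ‖k y‖ₑ ^ p ≤ ∫⁻ x, ‖L (x, y)‖ₑ ^ p ∂circHaar := fun y => by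
    rw [eLpNorm_circ_rpow hp0]
    gcongr
    refine (enorm_integral_le_lintegral_enorm _).trans ?_
    rw [← eLpNorm_one_eq_lintegral_enorm]
    exact eLpNorm_le_eLpNorm_of_exponent_le (ENNReal.one_le_ofReal.2 hp.le)
      (hm.comp_measurable (by fun_prop)).aestronglyMeasurable
  have hswap : MemLp (fun z : Torus => L z.swap) (ENNReal.ofReal p) torusHaar :=
    hL.comp_measurePreserving Measure.measurePreserving_swap
  have hH : MemLp (fun z : Torus => k z.2) (ENNReal.ofReal p) torusHaar := by
    refine ⟨hHs, lt_of_le_of_lt ?_ hswap.2⟩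
    rw [eLpNorm_torus_rpow hp0 hHs, eLpNorm_torus_rpow hp0 hswap.1]
    simp only [Prod.swap, lintegral_const, measure_univ, mul_one]
    gcongr with y
    exact hkb y
  have hc : ∀ i, tc (fun z : Torus => k z.2) i = 0 := fun i => by
    by_cases hi : i.1 = 0
    · rw [tc_of_fst_eq_zero (hH.integrable (ENNReal.one_le_ofReal.2 hp.le)) hi, ← h0 i hi,
        tc_of_fst_eq_zero (hL.integrable (ENNReal.one_le_ofReal.2 hp.le)) hi]
      simp only [integral_const, probReal_univ, one_smul, hk]
    · simp only [tc, ch_apply, mul_assoc]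
      rw [integral_prod_mul (μ := circHaar) (ν := circHaar) (fun x => fourier (-i).1 x)
        (fun y => fourier (-i).2 y * k y)]
      have h1 := integral_ch (-i.1, 0)
      simp only [ch_apply, fourier_zero, mul_one] at h1
      rw [integral_fun_fst (μ := circHaar) (ν := circHaar) (fun x => fourier (-i.1) x)] at h1
      simp [hi] at h1
      simp [h1]
  have hz : hH.toLp = 0 := hC.toExpansion.ext fun i => by
    rw [tcL_apply, tc_congr hH.coeFn_toLp, hc, map_zero]
  have h2 : ∀ᵐ z ∂torusHaar, k z.2 = 0 := by
    filter_upwards [hH.coeFn_toLp, Lp.coeFn_zero ℂ (ENNReal.ofReal p) torusHaar] with z h1 h2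
    rw [← h1, hz, h2, Pi.zero_apply]
  exact (Measure.ae_ae_of_ae_prod h2).exists.choose_spec

variable {f : ℝ → ℝ → ℝ} {F : TLp p}

lemma _root_.MemLp0.exists_represents (hp : 0 < p) (hf : MemLp0 p f) :
    ∃ F : TLp p, Represents f F := by
  have hm : AEStronglyMeasurable (lift f) torusHaar := (measurable_lift hf.meas).aestronglyMeasurable
  have h := hf.norm_ne_top
  rw [hf.periodic2.lp2Norm_eq hp hm] at h
  have hL : MemLp (lift f) (ENNReal.ofReal p) torusHaar :=
    ⟨hm, lt_top_iff_ne_top.2 fun h' => h (by rw [h', ENNReal.mul_top normRatio_ne_zero])⟩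
  exact ⟨hL.toLp, hf.periodic2, hL.coeFn_toLp.symm⟩

variable [hp1 : Fact (1 ≤ ENNReal.ofReal p)]

lemma Represents.tcL_eq (hF : Represents f F) (i : ℤ × ℤ) : tcL p i F = tc (lift f) i := by
  rw [tcL_apply, tc_congr hF.ae]

lemma Represents.integrable (hF : Represents f F) : Integrable (lift f) torusHaar :=
  (memLp_tlp_integrable F).congr hF.ae.symm

lemma Represents.zeroMean (hF : Represents f F) (hf : MemLp0 p f) : ZeroMean (tcL p) F := by
  have hs := (measurable_lift hf.meas).stronglyMeasurable
  rintro i (hi | hi)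
  · have : ∀ᵐ y ∂circHaar, ∫ x, lift f (x, y) ∂circHaar = 0 := by
      refine ae_of_ae_coe (measurableSet_eq_fun hs.integral_prod_left'.measurable
        measurable_const) ?_
      filter_upwards [hf.mean_x] with y hy using (hF.periodic2.integral_fst_eq_zero_iff y).1 hy
    rw [hF.tcL_eq, tc_of_fst_eq_zero hF.integrable hi]
    refine integral_eq_zero_of_ae (this.mono fun y hy => ?_)
    simp only [hy, mul_zero, Pi.zero_apply]
  · have : ∀ᵐ x ∂circHaar, ∫ y, lift f (x, y) ∂circHaar = 0 := by
      refine ae_of_ae_coe (measurableSet_eq_fun hs.integral_prod_right'.measurable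
        measurable_const) ?_
      filter_upwards [hf.mean_y] with x hx using (hF.periodic2.integral_snd_eq_zero_iff x).1 hx
    rw [hF.tcL_eq, tc_of_snd_eq_zero hF.integrable hi]
    refine integral_eq_zero_of_ae (this.mono fun y hy => ?_)
    simp only [hy, mul_zero, Pi.zero_apply]

lemma tc_conj (L : Torus → ℂ) (i : ℤ × ℤ) :
    tc (fun z => (starRingEnd ℂ) (L z)) i = (starRingEnd ℂ) (tc L (-i)) := by
  rw [tc, tc, ← integral_conj]
  simp only [map_mul, ← ch_neg, neg_neg]

lemma Represents.conj (hF : Represents f F) (i : ℤ × ℤ) :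
    tcL p (-i) F = (starRingEnd ℂ) (tcL p i F) := by
  rw [hF.tcL_eq, hF.tcL_eq, ← neg_neg i, ← tc_conj, neg_neg]
  simp only [conj_lift]

lemma exists_memLp0 (hp : 1 < p) (hconj : ∀ i, tcL p (-i) F = (starRingEnd ℂ) (tcL p i F))
    (h0 : ZeroMean (tcL p) F) : ∃ g : ℝ → ℝ → ℝ, MemLp0 p g ∧ Represents g F := by
  obtain ⟨C, hC⟩ := exists_trigExpansion hp
  have hp0 : 0 < p := by linarith
  have hreal : ∀ᵐ z ∂torusHaar, (starRingEnd ℂ) (F z) = F z := by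
    have hm : MemLp (fun z => (starRingEnd ℂ) (F z)) (ENNReal.ofReal p) torusHaar := (Lp.memLp F).star
    have : hm.toLp = F := hC.toExpansion.ext fun i => by
      rw [tcL_apply, tc_congr hm.coeFn_toLp, tc_conj, ← tcL_apply, hconj, Complex.conj_conj]
    have h := hm.coeFn_toLp
    rw [this] at h
    exact h.mono fun z hz => hz.symm
  set g : ℝ → ℝ → ℝ := fun x y => (F ((x : Circ), (y : Circ))).re with hg
  have hgm : Measurable (Function.uncurry g) :=
    Complex.measurable_re.comp ((Lp.stronglyMeasurable F).measurable.comp (by fun_prop))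
  have hgF : Represents g F := by
    refine ⟨⟨fun y x => ?_, fun x y => ?_⟩, ?_⟩
    · simp [hg]
    · simp [hg]
    · filter_upwards [hreal] with z hz
      simp only [lift, hg, coe_rep]
      exact Complex.conj_eq_iff_re.1 hz
  have hs := (measurable_lift hgm).stronglyMeasurable
  have hL : MemLp (lift g) (ENNReal.ofReal p) torusHaar := (memLp_congr_ae hgF.ae).2 (Lp.memLp F)
  refine ⟨g, ⟨hgm, hgF.periodic2.fst, hgF.periodic2.snd, ?_, ?_, ?_⟩, hgF⟩
  · rw [hgF.lp2Norm hp0]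
    exact ENNReal.mul_ne_top (normRatio_ne_top hp0) enorm_ne_top
  · have := integral_slice_ae_eq_zero hp hs hL fun i hi => by rw [← hgF.tcL_eq, h0 i (.inl hi)]
    filter_upwards [ae_coe_of_ae this] with y hy
      using (hgF.periodic2.integral_fst_eq_zero_iff y).2 hy
  · have := integral_slice_ae_eq_zero hp (hs.comp_measurable measurable_swap)
      (hL.comp_measurePreserving Measure.measurePreserving_swap) fun i hi => by
        rw [Function.comp_def, tc_swap, ← hgF.tcL_eq, h0 _ (.inr hi)]
    filter_upwards [ae_coe_of_ae this] with y hy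
      using (hgF.periodic2.integral_snd_eq_zero_iff y).2 hy

end MeanZero

section Equivalence

variable {p : ℝ}

lemma ofReal_mul_normRatio_mul_le [Fact (1 ≤ ENNReal.ofReal p)] {t D M : ℝ} {v : TLp p}
    (ht : 0 ≤ t) (hD : 0 ≤ D) (h : t * ‖v‖ ≤ D * M) :
    ENNReal.ofReal t * (normRatio p * ‖v‖ₑ) ≤
      ENNReal.ofReal D * (normRatio p * ENNReal.ofReal M) := by
  rw [mul_left_comm, mul_left_comm (ENNReal.ofReal D), ← ofReal_norm, ← ENNReal.ofReal_mul ht,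
    ← ENNReal.ofReal_mul hD]
  gcongr

lemma exists_mixedMod_le {α₁ α₂ : ℝ} (hp : 1 < p) (hα₁ : 0 < α₁) (hα₂ : 0 < α₂) :
    ∃ D : ℝ, 0 < D ∧ ∀ (f : ℝ → ℝ → ℝ) (δ₁ δ₂ : ℝ), MemLp0 p f → 0 < δ₁ → 0 < δ₂ →
      mixedMod p α₁ α₂ δ₁ δ₂ f ≤ ENNReal.ofReal D * Kfunc p α₁ α₂ δ₁ δ₂ f := by
  have hp0 : 0 < p := by linarith
  have : Fact (1 ≤ ENNReal.ofReal p) := ⟨ENNReal.one_le_ofReal.2 hp.le⟩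
  obtain ⟨C, hC⟩ := exists_trigExpansion hp
  obtain ⟨D, hD, H⟩ := hC.exists_norm_diff_le hα₁ hα₂
  have hD1 : ENNReal.ofReal (D + 1) ≠ 0 := by simp; linarith
  refine ⟨D + 1, by linarith, fun f δ₁ δ₂ hf hδ₁ hδ₂ => ?_⟩
  rw [← ENNReal.div_le_iff' hD1 ENNReal.ofReal_ne_top]
  refine le_iInf fun g₁ => le_iInf fun d₁ => le_iInf fun hg₁ => le_iInf fun hd₁ =>
    le_iInf fun g₂ => le_iInf fun d₂ => le_iInf fun hg₂ => le_iInf fun hd₂ =>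
    le_iInf fun g => le_iInf fun d => le_iInf fun hg => le_iInf fun hd => ?_
  rw [ENNReal.div_le_iff' hD1 ENNReal.ofReal_ne_top]
  refine iSup_le fun h₁ => iSup_le fun hh₁ => iSup_le fun h₂ => iSup_le fun hh₂ => ?_
  obtain ⟨F, rF⟩ := hf.exists_represents hp0
  obtain ⟨G₁, rG₁⟩ := hg₁.exists_represents hp0
  obtain ⟨E₁, rE₁⟩ := hd₁.1.exists_represents hp0
  obtain ⟨G₂, rG₂⟩ := hg₂.exists_represents hp0
  obtain ⟨E₂, rE₂⟩ := hd₂.1.exists_represents hp0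
  obtain ⟨G, rG⟩ := hg.exists_represents hp0
  obtain ⟨E, rE⟩ := hd.1.exists_represents hp0
  obtain ⟨u, hu, cu⟩ := rF.exists_diff_diff hp0 hα₁ hα₂ h₁ h₂
  have key := H h₁ h₂ (F - G₁ - G₂ - G) G₁ E₁ G₂ E₂ G E u (rG₁.zeroMean hg₁) (rG₂.zeroMean hg₂)
    (rG.zeroMean hg)
    (fun i => by simpa [weylSym, ← rE₁.fourierCoefZ, ← rG₁.fourierCoefZ] using hd₁.2 i.1 i.2)
    (fun i => by simpa [weylSym, ← rE₂.fourierCoefZ, ← rG₂.fourierCoefZ] using hd₂.2 i.1 i.2)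
    (fun i => by simpa [weylSym, ← rE.fourierCoefZ, ← rG.fourierCoefZ] using hd.2 i.1 i.2)
    (fun i => by rw [cu]; congr 2; abel)
  rw [hu, (((rF.sub rG₁).sub rG₂).sub rG).lp2Norm hp0, rE₁.lp2Norm hp0, rE₂.lp2Norm hp0,
    rE.lp2Norm hp0]
  have key' : ‖u‖ ≤ (D + 1) * (‖F - G₁ - G₂ - G‖ + δ₁ ^ α₁ * ‖E₁‖ + δ₂ ^ α₂ * ‖E₂‖ +
      δ₁ ^ α₁ * δ₂ ^ α₂ * ‖E‖) := by
    refine key.trans ?_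
    gcongr
    linarith
  have key2 : ‖u‖ₑ ≤ ENNReal.ofReal (D + 1) * (‖F - G₁ - G₂ - G‖ₑ +
      ENNReal.ofReal (δ₁ ^ α₁) * ‖E₁‖ₑ + ENNReal.ofReal (δ₂ ^ α₂) * ‖E₂‖ₑ +
        ENNReal.ofReal (δ₁ ^ α₁ * δ₂ ^ α₂) * ‖E‖ₑ) := by
    simp only [← ofReal_norm]
    rw [← ENNReal.ofReal_mul (by positivity), ← ENNReal.ofReal_mul (by positivity),
      ← ENNReal.ofReal_mul (by positivity), ← ENNReal.ofReal_add (by positivity) (by positivity),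
      ← ENNReal.ofReal_add (by positivity) (by positivity),
      ← ENNReal.ofReal_add (by positivity) (by positivity), ← ENNReal.ofReal_mul (by positivity)]
    exact ENNReal.ofReal_le_ofReal key'
  refine (mul_le_mul_right key2 (normRatio p)).trans_eq ?_
  ring

lemma exists_Kfunc_le {α₁ α₂ : ℝ} (hp : 1 < p) (hα₁ : 0 < α₁) (hα₂ : 0 < α₂) :
    ∃ D : ℝ, 0 < D ∧ ∀ (f : ℝ → ℝ → ℝ) (δ₁ δ₂ : ℝ), MemLp0 p f → 0 < δ₁ → 0 < δ₂ →
      Kfunc p α₁ α₂ δ₁ δ₂ f ≤ ENNReal.ofReal D * mixedMod p α₁ α₂ δ₁ δ₂ f := by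
  have hp0 : 0 < p := by linarith
  have : Fact (1 ≤ ENNReal.ofReal p) := ⟨ENNReal.one_le_ofReal.2 hp.le⟩
  obtain ⟨C, hC⟩ := exists_trigExpansion hp
  obtain ⟨D, hD, H⟩ := hC.exists_realization hα₁ hα₂
  refine ⟨4 * D + 1, by linarith, fun f δ₁ δ₂ hf hδ₁ hδ₂ => ?_⟩
  set W := mixedMod p α₁ α₂ δ₁ δ₂ f with hW
  by_cases hWt : W = ⊤
  · rw [hWt, ENNReal.mul_top (by simp; linarith)]
    exact le_top
  obtain ⟨F, rF⟩ := hf.exists_represents hp0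
  have hnr := normRatio_ne_top hp0
  have hM : W / normRatio p ≠ ⊤ := ENNReal.div_ne_top hWt normRatio_ne_zero
  have hMW : normRatio p * ENNReal.ofReal (W / normRatio p).toReal = W := by
    rw [ENNReal.ofReal_toReal hM, ENNReal.mul_div_cancel normRatio_ne_zero hnr]
  obtain ⟨G₁, E₁, G₂, E₂, G, E, mG₁, mE₁, mG₂, mE₂, mG, mE, c₁, c₂, c, b, b₁, b₂, b₃⟩ :=
    H F δ₁ δ₂ (W / normRatio p).toReal hδ₁ hδ₂ fun h₁ hh₁ h₂ hh₂ => by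
      obtain ⟨u, hu, cu⟩ := rF.exists_diff_diff hp0 hα₁ hα₂ h₁ h₂
      refine ⟨u, cu, ?_⟩
      rw [← toReal_enorm]
      refine ENNReal.toReal_mono hM ?_
      rw [ENNReal.le_div_iff_mul_le (.inl normRatio_ne_zero) (.inl hnr), mul_comm, ← hu]
      exact le_iSup_of_le h₁ (le_iSup_of_le (by rw [abs_of_nonneg hh₁.1]; exact hh₁.2)
        (le_iSup_of_le h₂ (le_iSup_of_le (by rw [abs_of_nonneg hh₂.1]; exact hh₂.2) le_rfl)))
  have hreal : ∀ v, RealImage (tcL p) F v → ∃ g, MemLp0 p g ∧ Represents g v := fun v hv =>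
    exists_memLp0 hp (hv.conj rF.conj) ((rF.zeroMean hf).of_realImage hv)
  obtain ⟨g₁, hg₁, rG₁⟩ := hreal _ mG₁
  obtain ⟨d₁, hd₁, rE₁⟩ := hreal _ mE₁
  obtain ⟨g₂, hg₂, rG₂⟩ := hreal _ mG₂
  obtain ⟨d₂, hd₂, rE₂⟩ := hreal _ mE₂
  obtain ⟨g, hg, rG⟩ := hreal _ mG
  obtain ⟨d, hd, rE⟩ := hreal _ mE
  have w₁ : HasWeylDeriv p α₁ 0 g₁ d₁ := ⟨hd₁, fun m₁ m₂ => by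
    simpa [weylSym, rE₁.fourierCoefZ (m₁, m₂), rG₁.fourierCoefZ (m₁, m₂)] using c₁ (m₁, m₂)⟩
  have w₂ : HasWeylDeriv p 0 α₂ g₂ d₂ := ⟨hd₂, fun m₁ m₂ => by
    simpa [weylSym, rE₂.fourierCoefZ (m₁, m₂), rG₂.fourierCoefZ (m₁, m₂)] using c₂ (m₁, m₂)⟩
  have w₃ : HasWeylDeriv p α₁ α₂ g d := ⟨hd, fun m₁ m₂ => by
    simpa [weylSym, rE.fourierCoefZ (m₁, m₂), rG.fourierCoefZ (m₁, m₂)] using c (m₁, m₂)⟩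
  refine iInf_le_of_le g₁ <| iInf_le_of_le d₁ <| iInf_le_of_le hg₁ <| iInf_le_of_le w₁ <|
    iInf_le_of_le g₂ <| iInf_le_of_le d₂ <| iInf_le_of_le hg₂ <| iInf_le_of_le w₂ <|
    iInf_le_of_le g <| iInf_le_of_le d <| iInf_le_of_le hg <| iInf_le_of_le w₃ ?_
  rw [(((rF.sub rG₁).sub rG₂).sub rG).lp2Norm hp0, rE₁.lp2Norm hp0, rE₂.lp2Norm hp0,
    rE.lp2Norm hp0]
  have e₀ := ofReal_mul_normRatio_mul_le zero_le_one hD ((one_mul _).trans_le b)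
  have e₁ := ofReal_mul_normRatio_mul_le (by positivity) hD b₁
  have e₂ := ofReal_mul_normRatio_mul_le (by positivity) hD b₂
  have e₃ := ofReal_mul_normRatio_mul_le (by positivity) hD b₃
  rw [hMW] at e₀ e₁ e₂ e₃
  rw [ENNReal.ofReal_one, one_mul] at e₀
  refine (add_le_add (add_le_add (add_le_add e₀ e₁) e₂) e₃).trans ?_
  have : ENNReal.ofReal D * W + ENNReal.ofReal D * W + ENNReal.ofReal D * W + ENNReal.ofReal D * W
      = ENNReal.ofReal (4 * D) * W := by
    rw [ENNReal.ofReal_mul (by norm_num)]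
    norm_num
    ring
  rw [this]
  gcongr
  linarith

end Equivalence

end FracSmooth

/-- Equivalence of the mixed modulus of smoothness and the mixed `K`-functional. -/
theorem modulus_equiv_Kfunctional (p α₁ α₂ : ℝ) (hp : 1 < p)
    (hα₁ : 0 < α₁) (hα₂ : 0 < α₂) :
    ∃ C : ℝ, 0 < C ∧ ∀ (f : ℝ → ℝ → ℝ) (δ₁ δ₂ : ℝ), MemLp0 p f →
      0 < δ₁ → δ₁ ≤ π → 0 < δ₂ → δ₂ ≤ π →
      mixedMod p α₁ α₂ δ₁ δ₂ f ≤ ENNReal.ofReal C * Kfunc p α₁ α₂ δ₁ δ₂ f ∧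
      Kfunc p α₁ α₂ δ₁ δ₂ f ≤ ENNReal.ofReal C * mixedMod p α₁ α₂ δ₁ δ₂ f := by
  obtain ⟨D₁, hD₁, h₁⟩ := FracSmooth.exists_mixedMod_le hp hα₁ hα₂
  obtain ⟨D₂, hD₂, h₂⟩ := FracSmooth.exists_Kfunc_le hp hα₁ hα₂
  refine ⟨max D₁ D₂, lt_max_of_lt_left hD₁, fun f δ₁ δ₂ hf hδ₁ _ hδ₂ _ => ⟨?_, ?_⟩⟩
  · refine (h₁ f δ₁ δ₂ hf hδ₁ hδ₂).trans ?_
    gcongr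
    exact le_max_left _ _
  · refine (h₂ f δ₁ δ₂ hf hδ₁ hδ₂).trans ?_
    gcongr
    exact le_max_right _ _

end
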